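/- Let φ₄ be a homogeneous polynomial of degree 4 in (x,y), and let f : ℝ² → ℝ be a smooth function whose 5-jet at the origin is j⁵f(0) = y² + x²y + (1/4)x⁴ + y·φ₄(x,y) (the class Π^p_{c,3}, where the Monge form has an A₅-singularity at the origin). Write c₆₀ for the coefficient of x⁶ in the degree-6 Taylor polynomial of f at 0 and c₄₁ for the coefficient of x⁴ in φ₄, and assume C₃ := c₆₀ − (1/2)c₄₁ ≠ 0. Then the parabolic set of f is a smooth curve near the origin, and there exists η ∈ {1,−1} such that the asymptotic BDE of f is topologically equivalent at 0 to the folded degenerate elementary BDE dy² + (−y + ηx⁴)dx² = 0, i.e. the BDE with coefficients (a,b,c) = (1, 0, −y + ηx⁴). -/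

import Mathlib

open Asymptotics Filter Set

noncomputable section

/-- Partial derivative in the first variable (∂/∂x). -/
def pdx (f : ℝ × ℝ → ℝ) (p : ℝ × ℝ) : ℝ := deriv (fun s => f (s, p.2)) p.1

/-- Partial derivative in the second variable (∂/∂y). -/
def pdy (f : ℝ × ℝ → ℝ) (p : ℝ × ℝ) : ℝ := deriv (fun s => f (p.1, s)) p.2

/-- f_xx -/
def fxx (f : ℝ × ℝ → ℝ) : ℝ × ℝ → ℝ := pdx (pdx f)
/-- f_xy -/
def fxy (f : ℝ × ℝ → ℝ) : ℝ × ℝ → ℝ := pdy (pdx f)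
/-- f_yy -/
def fyy (f : ℝ × ℝ → ℝ) : ℝ × ℝ → ℝ := pdy (pdy f)

/-- The discriminant δ = f_xy² − f_xx·f_yy of the asymptotic BDE of `f`. -/
def bdeDiscr (f : ℝ × ℝ → ℝ) : ℝ × ℝ → ℝ := fun p => (fxy f p) ^ 2 - fxx f p * fyy f p

/-- The BDE `a dy² + 2b dxdy + c dx² = 0`, regarded as the family of quadratic
forms `ω_p(v) = a(p)v₂² + 2b(p)v₁v₂ + c(p)v₁²`. -/
def BDE (a b c : ℝ × ℝ → ℝ) : (ℝ × ℝ) → (ℝ × ℝ) → ℝ :=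
  fun p v => a p * v.2 ^ 2 + 2 * b p * v.1 * v.2 + c p * v.1 ^ 2

/-- The asymptotic BDE `f_yy dy² + 2 f_xy dxdy + f_xx dx² = 0` of the surface `z = f(x,y)`. -/
def asymBDE (f : ℝ × ℝ → ℝ) : (ℝ × ℝ) → (ℝ × ℝ) → ℝ := BDE (fyy f) (fxy f) (fxx f)

/-- `j^k f(0) = P` : the degree-k Taylor polynomial of `f` at the origin is `P`,
i.e. `f − P = o(‖(x,y)‖^k)` as `(x,y) → 0`. -/
def HasJetAt0 (f P : ℝ × ℝ → ℝ) (k : ℕ) : Prop :=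
  (fun p => f p - P p) =o[nhds (0 : ℝ × ℝ)] fun p => ‖p‖ ^ k

/-- `γ` is an integral curve of the BDE `ω` on the open interval `I`:
`γ` is C¹ on `I` with nowhere-vanishing derivative annihilating `ω`. -/
def IsIntegralCurveOnBDE (ω : (ℝ × ℝ) → (ℝ × ℝ) → ℝ) (γ : ℝ → ℝ × ℝ) (I : Set ℝ) : Prop :=
  (∃ a b : ℝ, I = Set.Ioo a b) ∧
  ∃ dγ : ℝ → ℝ × ℝ, ContinuousOn dγ I ∧
    ∀ t ∈ I, HasDerivAt γ (dγ t) t ∧ dγ t ≠ 0 ∧ ω (γ t) (dγ t) = 0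

/-- Topological equivalence of two BDEs at the origin: a local homeomorphism
fixing `0` sending integral curves of one to integral curves of the other. -/
def TopEquivAt0 (ω Ω : (ℝ × ℝ) → (ℝ × ℝ) → ℝ) : Prop :=
  ∃ (U V : Set (ℝ × ℝ)) (h hinv : ℝ × ℝ → ℝ × ℝ),
    IsOpen U ∧ IsOpen V ∧ (0 : ℝ × ℝ) ∈ U ∧ (0 : ℝ × ℝ) ∈ V ∧ h 0 = 0 ∧
    ContinuousOn h U ∧ ContinuousOn hinv V ∧
    Set.BijOn h U V ∧ Set.InvOn hinv h U V ∧
    (∀ γ I, IsIntegralCurveOnBDE ω γ I → Set.MapsTo γ I U →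
      ∃ σ J, IsIntegralCurveOnBDE Ω σ J ∧ h '' (γ '' I) = σ '' J) ∧
    (∀ σ J, IsIntegralCurveOnBDE Ω σ J → Set.MapsTo σ J V →
      ∃ γ I, IsIntegralCurveOnBDE ω γ I ∧ hinv '' (σ '' J) = γ '' I)

/-- Smooth equivalence of two BDEs at the origin: a local C^∞ diffeomorphism `h`
fixing `0` pulling one family of quadratic forms back to a nonvanishing multiple
of the other. -/
def SmoothEquivAt0 (ω Ω : (ℝ × ℝ) → (ℝ × ℝ) → ℝ) : Prop :=
  ∃ (U V : Set (ℝ × ℝ)) (h hinv : ℝ × ℝ → ℝ × ℝ) (ρ : ℝ × ℝ → ℝ),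
    IsOpen U ∧ IsOpen V ∧ (0 : ℝ × ℝ) ∈ U ∧ (0 : ℝ × ℝ) ∈ V ∧ h 0 = 0 ∧
    ContDiffOn ℝ (⊤ : ℕ∞) h U ∧ ContDiffOn ℝ (⊤ : ℕ∞) hinv V ∧
    Set.BijOn h U V ∧ Set.InvOn hinv h U V ∧
    ContDiffOn ℝ (⊤ : ℕ∞) ρ U ∧ (∀ p ∈ U, ρ p ≠ 0) ∧
    (∀ p ∈ U, ∀ v : ℝ × ℝ, Ω (h p) (fderiv ℝ h p v) = ρ p * ω p v)

/-- Fiber topological equivalence at `0` of two 2-parameter families of BDEs: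
a homeomorphism `φ` of parameter spaces (onto its image), fixing `0`, such that
corresponding members of the families are topologically equivalent at `0`. -/
def FiberTopEquivAt0 (ω Ω : (ℝ × ℝ) → (ℝ × ℝ) → (ℝ × ℝ) → ℝ) : Prop :=
  ∃ (W : Set (ℝ × ℝ)) (φ ψ : ℝ × ℝ → ℝ × ℝ),
    W ∈ nhds (0 : ℝ × ℝ) ∧ φ 0 = 0 ∧
    ContinuousOn φ W ∧ ContinuousOn ψ (φ '' W) ∧
    Set.InvOn ψ φ W (φ '' W) ∧
    ∀ q ∈ W, TopEquivAt0 (ω q) (Ω (φ q))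

section PartOne
open Topology

/-- Differential inequality, nonstrict. -/
lemma DI_nonneg {d d' : ℝ → ℝ} {a b L : ℝ} (hab : a ≤ b) (hd : ∀ x ∈ Icc a b, HasDerivAt d (d' x) x)
    (h : ∀ x ∈ Icc a b, -(L * |d x|) ≤ d' x) (ha : 0 ≤ d a) : 0 ≤ d b := by
  by_contra hb
  push Not at hb
  have hc : ContinuousOn d (Icc a b) := fun x hx => (hd x hx).continuousAt.continuousWithinAt
  set S := {x | x ∈ Icc a b ∧ 0 ≤ d x} with hS
  have hSc : IsCompact S := by
    have : S = Icc a b ∩ d ⁻¹' (Ici 0) := by ext; simp [hS]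
    rw [this]
    exact isCompact_Icc.of_isClosed_subset (hc.preimage_isClosed_of_isClosed isClosed_Icc isClosed_Ici) inter_subset_left
  obtain ⟨c, hcS, hcm⟩ := hSc.exists_isGreatest ⟨a, ⟨le_refl _, hab⟩, ha⟩
  have hcb : c < b := lt_of_le_of_ne hcS.1.2 (by rintro rfl; linarith [hcS.2])
  have hneg : ∀ x ∈ Ioc c b, d x < 0 := by
    intro x hx
    by_contra h0
    push Not at h0
    have : x ≤ c := hcm ⟨⟨hcS.1.1.trans hx.1.le, hx.2⟩, h0⟩
    linarith [hx.1]
  have hmono : MonotoneOn (fun x => d x * Real.exp (-(L * x))) (Icc c b) := by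
    have hder : ∀ x ∈ Icc c b, HasDerivAt (fun x => d x * Real.exp (-(L * x)))
        (d' x * Real.exp (-(L * x)) + d x * (Real.exp (-(L * x)) * (-(L * 1)))) x := by
      intro x hx
      exact (hd x ⟨hcS.1.1.trans hx.1, hx.2⟩).mul (((hasDerivAt_id x).const_mul L).neg.exp)
    apply monotoneOn_of_deriv_nonneg (convex_Icc _ _)
    · exact fun x hx => (hder x hx).continuousAt.continuousWithinAt
    · intro x hx
      rw [interior_Icc] at hx
      exact (hder x (Ioo_subset_Icc_self hx)).differentiableAt.differentiableWithinAt
    · intro x hx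
      rw [interior_Icc] at hx
      rw [(hder x (Ioo_subset_Icc_self hx)).deriv]
      have h1 := h x ⟨hcS.1.1.trans hx.1.le, hx.2.le⟩
      have h2 := hneg x ⟨hx.1, hx.2.le⟩
      rw [abs_of_neg h2] at h1
      have h3 := Real.exp_pos (-(L * x))
      have : d' x * Real.exp (-(L * x)) + d x * (Real.exp (-(L * x)) * (-(L * 1))) = (d' x - L * d x) * Real.exp (-(L * x)) := by ring
      rw [this]
      apply mul_nonneg _ h3.le
      linarith
  have := hmono ⟨le_refl c, hcb.le⟩ ⟨hcb.le, le_refl b⟩ hcb.le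
  simp only at this
  have h5 : 0 ≤ d c * Real.exp (-(L * c)) := mul_nonneg hcS.2 (Real.exp_pos _).le
  have h6 : d b * Real.exp (-(L * b)) < 0 := mul_neg_of_neg_of_pos hb (Real.exp_pos _)
  linarith

lemma DI_pos {d d' : ℝ → ℝ} {a b L : ℝ} (hab : a ≤ b) (hd : ∀ x ∈ Icc a b, HasDerivAt d (d' x) x)
    (h : ∀ x ∈ Icc a b, -(L * |d x|) ≤ d' x) (ha : 0 < d a) : 0 < d b := by
  by_contra hb
  push Not at hb
  have hmem : ∀ x ∈ Icc a b, a + b - x ∈ Icc a b := fun x hx => ⟨by linarith [hx.2], by linarith [hx.1]⟩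
  have := DI_nonneg (d := fun x => - d (a + b - x)) (d' := fun x => d' (a + b - x)) (L := L) hab ?_ ?_ ?_
  · simp at this; linarith
  · intro x hx
    have h1 := (hd _ (hmem x hx))
    have h2 : HasDerivAt (fun x => a + b - x) (-1) x := by
      simpa using (hasDerivAt_id x).const_sub (a + b)
    have h3 := (HasDerivAt.scomp x h1 h2).neg
    exact HasDerivAt.congr_deriv h3 (by simp)
  · intro x hx
    have := h _ (hmem x hx)
    simpa using this
  · simpa using hb

/-- The (extended) system. -/
structure Sys (A K : ℝ → ℝ → ℝ) (L s : ℝ) : Prop where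
  hs : s = 1 ∨ s = -1
  cA : Continuous (fun p : ℝ × ℝ => A p.1 p.2)
  cK : Continuous (fun p : ℝ × ℝ => K p.1 p.2)
  lA : ∀ x z w, |A x z - A x w| ≤ L * |z - w|
  lK : ∀ x z w, |K x z - K x w| ≤ L * |z - w|
  bA : ∀ x z, |A x z| ≤ L
  K1 : ∀ x z, 1 / 2 ≤ K x z
  K2 : ∀ x z, K x z ≤ 2
  A0 : ∀ x z, z ≤ 0 → A x z = A x 0
  sA : ∀ x, x ≠ 0 → 0 < s * x * A x 0
  sm : ∀ x, |A x 0| ≤ |x| / 64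

def FF (A K : ℝ → ℝ → ℝ) (σ x z : ℝ) : ℝ := A x z + σ * (K x z * √(min z 1))

def SolOn (A K : ℝ → ℝ → ℝ) (σ : ℝ) (ζ : ℝ → ℝ) (I : Set ℝ) : Prop :=
  ∀ x ∈ I, HasDerivAt ζ (FF A K σ x (ζ x)) x

def rA (A : ℝ → ℝ → ℝ) : ℝ → ℝ → ℝ := fun x z => - A (-x) z
def rK (K : ℝ → ℝ → ℝ) : ℝ → ℝ → ℝ := fun x z => K (-x) z

variable {A K : ℝ → ℝ → ℝ} {L s σ : ℝ}

lemma Sys.refl (S : Sys A K L s) : Sys (rA A) (rK K) L s where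
  hs := S.hs
  cA := by
    have := S.cA.comp (f := fun p : ℝ × ℝ => (-p.1, p.2)) (by fun_prop)
    exact this.neg
  cK := S.cK.comp (f := fun p : ℝ × ℝ => (-p.1, p.2)) (by fun_prop)
  lA := fun x z w => by
    have := S.lA (-x) z w
    simp only [rA]
    rwa [show - A (-x) z - - A (-x) w = -(A (-x) z - A (-x) w) by ring, abs_neg]
  lK := fun x z w => S.lK (-x) z w
  bA := fun x z => by simp only [rA, abs_neg]; exact S.bA _ _
  K1 := fun x z => S.K1 _ _
  K2 := fun x z => S.K2 _ _
  A0 := fun x z h => by simp only [rA]; rw [S.A0 _ _ h]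
  sA := fun x h => by
    have := S.sA (-x) (neg_ne_zero.2 h)
    simp only [rA]; linarith
  sm := fun x => by have := S.sm (-x); simp only [rA, abs_neg] at *; exact this

lemma FF_refl (x z : ℝ) : FF (rA A) (rK K) (-σ) x z = - FF A K σ (-x) z := by
  simp only [FF, rA, rK]; ring

lemma SolOn.refl {ζ : ℝ → ℝ} {I J : Set ℝ} (h : SolOn A K σ ζ I) (hJ : ∀ x ∈ J, -x ∈ I) :
    SolOn (rA A) (rK K) (-σ) (fun x => ζ (-x)) J := by
  intro x hx
  have h1 := h _ (hJ x hx)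
  rw [FF_refl]
  have h3 := HasDerivAt.scomp x h1 (hasDerivAt_neg x)
  exact HasDerivAt.congr_deriv h3 (by simp)

lemma rA_rA : rA (rA A) = A := by ext; simp [rA]
lemma rK_rK : rK (rK K) = K := by ext; simp [rK]

lemma SolOn.mono {ζ : ℝ → ℝ} {I J : Set ℝ} (h : SolOn A K σ ζ I) (hJ : J ⊆ I) : SolOn A K σ ζ J :=
  fun x hx => h x (hJ hx)

lemma SolOn.cont {ζ : ℝ → ℝ} {I : Set ℝ} (h : SolOn A K σ ζ I) : ContinuousOn ζ I :=
  fun x hx => (h x hx).continuousAt.continuousWithinAt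

lemma Sys.Lpos (S : Sys A K L s) : 0 ≤ L := (abs_nonneg _).trans (S.bA 0 0)

lemma FF_cont (S : Sys A K L s) : Continuous (fun p : ℝ × ℝ => FF A K σ p.1 p.2) := by
  have := S.cA; have := S.cK
  unfold FF; fun_prop

lemma FF_neg (S : Sys A K L s) {x z : ℝ} (hz : z ≤ 0) : FF A K σ x z = A x 0 := by
  unfold FF
  rw [S.A0 x z hz, Real.sqrt_eq_zero_of_nonpos (le_trans (min_le_left _ _) hz)]; ring

lemma FF_bound (S : Sys A K L s) (hσ : σ = 1 ∨ σ = -1) (x z : ℝ) : |FF A K σ x z| ≤ L + 2 := by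
  have h1 := S.bA x z
  have h2 : √(min z 1) ≤ 1 := by
    exact Real.sqrt_le_one.2 (min_le_right _ _)
  have h3 := Real.sqrt_nonneg (min z 1)
  have h4 := S.K1 x z
  have h5 := S.K2 x z
  unfold FF
  have h6 : 0 ≤ K x z * √(min z 1) := by positivity
  have h7 : K x z * √(min z 1) ≤ 2 := by nlinarith
  rw [abs_le] at *
  rcases hσ with rfl | rfl <;> constructor <;> linarith

/-- one-sided Lipschitz -/
lemma Ksqrt_mono (S : Sys A K L s) (x z w : ℝ) (h : z ≤ w) :
    -(L * (w - z)) ≤ K x w * √(min w 1) - K x z * √(min z 1) := by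
  have h1 := abs_le.1 (S.lK x w z)
  rw [abs_of_nonneg (sub_nonneg.2 h)] at h1
  have h2 : √(min z 1) ≤ √(min w 1) := Real.sqrt_le_sqrt (min_le_min_right _ h)
  have h3 := S.K1 x w
  have h4 : √(min z 1) ≤ 1 := by
    exact Real.sqrt_le_one.2 (min_le_right _ _)
  have h5 := Real.sqrt_nonneg (min z 1)
  have h6 : K x w * √(min w 1) - K x z * √(min z 1) = K x w * (√(min w 1) - √(min z 1)) + (K x w - K x z) * √(min z 1) := by ring
  rw [h6]
  have h7 : 0 ≤ K x w * (√(min w 1) - √(min z 1)) := mul_nonneg (by linarith) (by linarith)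
  have h8 : 0 ≤ L * (w - z) := mul_nonneg S.Lpos (by linarith)
  nlinarith

/-- σ = -1: forward uniqueness, in order form: a - solution... -/
lemma minus_fwd (S : Sys A K L s) {ζ₁ ζ₂ : ℝ → ℝ} {a b : ℝ} (h1 : SolOn A K (-1) ζ₁ (Icc a b))
    (h2 : SolOn A K (-1) ζ₂ (Icc a b)) (hab : a ≤ b) (h : ζ₁ a = ζ₂ a) : ζ₁ b = ζ₂ b := by
  -- d = -(ζ₁ - ζ₂)^2 has d' ≥ -4L |d|
  have := DI_nonneg (d := fun x => -(ζ₁ x - ζ₂ x)^2) (L := 4 * L)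
    (d' := fun x => -(2 * (ζ₁ x - ζ₂ x)^1 * (FF A K (-1) x (ζ₁ x) - FF A K (-1) x (ζ₂ x)))) hab ?_ ?_ ?_
  · have h0 : (ζ₁ b - ζ₂ b)^2 ≤ 0 := by simpa using this
    have : ζ₁ b - ζ₂ b = 0 := by
      have := le_antisymm h0 (sq_nonneg _)
      exact pow_eq_zero_iff (two_ne_zero) |>.1 this
    linarith
  · intro x hx
    have := (((h1 x hx).sub (h2 x hx)).pow 2).neg
    exact HasDerivAt.congr_deriv this (by simp)
  · intro x hx
    rw [abs_neg, abs_of_nonneg (sq_nonneg _)]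
    set z := ζ₁ x
    set w := ζ₂ x
    have hA := abs_le.1 (S.lA x z w)
    have hL := S.Lpos
    unfold FF
    rcases le_total z w with hzw | hzw
    · have hk := Ksqrt_mono S x z w hzw
      rw [abs_of_nonpos (by linarith)] at hA
      nlinarith
    · have hk := Ksqrt_mono S x w z hzw
      rw [abs_of_nonneg (by linarith)] at hA
      nlinarith
  · simp [h]

end PartOne

section PartTwo
open Topology
variable {A K : ℝ → ℝ → ℝ} {L s σ : ℝ}

lemma energy_zero {E E' : ℝ → ℝ} {a b C : ℝ} (hc : ContinuousOn E (Icc a b))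
    (hd : ∀ x ∈ Ioo a b, HasDerivAt E (E' x) x) (h : ∀ x ∈ Ioo a b, E' x ≤ C * E x)
    (h0 : ∀ x, 0 ≤ E x) (ha : E a = 0) : ∀ x ∈ Icc a b, E x = 0 := by
  have hanti : AntitoneOn (fun x => E x * Real.exp (-(C * x))) (Icc a b) := by
    have hder : ∀ x ∈ Ioo a b, HasDerivAt (fun x => E x * Real.exp (-(C * x)))
        (E' x * Real.exp (-(C * x)) + E x * (Real.exp (-(C * x)) * (-(C * 1)))) x := by
      intro x hx
      exact (hd x hx).mul (((hasDerivAt_id x).const_mul C).neg.exp)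
    apply antitoneOn_of_deriv_nonpos (convex_Icc _ _)
    · exact hc.mul (by fun_prop)
    · intro x hx
      rw [interior_Icc] at hx
      exact (hder x hx).differentiableAt.differentiableWithinAt
    · intro x hx
      rw [interior_Icc] at hx
      rw [(hder x hx).deriv]
      have h3 := Real.exp_pos (-(C * x))
      have := h x hx
      nlinarith
  intro x hx
  have h1 := hanti ⟨le_refl a, hx.1.trans hx.2⟩ hx hx.1
  simp only [ha, zero_mul] at h1
  have h3 := Real.exp_pos (-(C * x))
  have := h0 x
  nlinarith

lemma uniq_of_bound {ζ₁ ζ₂ : ℝ → ℝ} {a b C : ℝ} (h1 : SolOn A K σ ζ₁ (Icc a b))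
    (h2 : SolOn A K σ ζ₂ (Icc a b)) (h : ζ₁ a = ζ₂ a)
    (hb : ∀ x ∈ Ioo a b, (ζ₁ x - ζ₂ x) * (FF A K σ x (ζ₁ x) - FF A K σ x (ζ₂ x)) ≤ C * (ζ₁ x - ζ₂ x)^2) :
    ∀ x ∈ Icc a b, ζ₁ x = ζ₂ x := by
  have := energy_zero (E := fun x => (ζ₁ x - ζ₂ x)^2) (a := a) (b := b) (C := 2 * C)
    (E' := fun x => (2 * (ζ₁ x - ζ₂ x)^1 * (FF A K σ x (ζ₁ x) - FF A K σ x (ζ₂ x)))) ?_ ?_ ?_ ?_ ?_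
  · intro x hx
    have := this x hx
    have := (pow_eq_zero_iff (two_ne_zero)).1 this
    linarith
  · exact (h1.cont.sub h2.cont).pow 2
  · intro x hx
    have := (((h1 x (Ioo_subset_Icc_self hx)).sub (h2 x (Ioo_subset_Icc_self hx))).pow 2)
    exact HasDerivAt.congr_deriv this (by simp)
  · intro x hx
    have := hb x hx
    nlinarith
  · intro x; positivity
  · simp [h]

lemma sqrt_ineq {L A1 A2 K1 K2 u v σ : ℝ} (hσ : σ = 1 ∨ σ = -1) (hL : 0 ≤ L) (hu : 0 < u) (hv : 0 < v) (hu1 : u ≤ 1) (hvu : v ≤ u)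
    (hA : A1 - A2 ≤ L * (u^2 - v^2)) (hA2 : -(L * v^2) ≤ A2) (hK : |K1 - K2| ≤ L * (u^2 - v^2)) :
    (A1 + σ * (K1 * u)) / (2 * u) - (A2 + σ * (K2 * v)) / (2 * v) ≤ 3 * L * (u - v) := by
  have e : (A1 + σ * (K1 * u)) / (2 * u) - (A2 + σ * (K2 * v)) / (2 * v) =
    (A1 - A2) / (2 * u) + (-A2) * (u - v) / (2 * u * v) + σ * (K1 - K2) / 2 := by
    field_simp; ring
  rw [e]
  have hd : 0 ≤ u - v := by linarith
  have hLd := mul_nonneg hL hd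
  have t1 : (A1 - A2) / (2 * u) ≤ L * (u - v) := by
    rw [div_le_iff₀ (by positivity)]
    nlinarith
  have t2 : (-A2) * (u - v) / (2 * u * v) ≤ L * (u - v) := by
    rw [div_le_iff₀ (by positivity)]
    have : (-A2) * (u - v) ≤ L * v ^2 * (u - v) := mul_le_mul_of_nonneg_right (by linarith) hd
    have : L * (u - v) * (v * v) ≤ L * (u - v) * (2 * u * v) := by
      apply mul_le_mul_of_nonneg_left _ hLd
      nlinarith
    nlinarith
  have t3 : σ * (K1 - K2) / 2 ≤ L * (u - v) := by
    have : σ * (K1 - K2) ≤ L * (u^2 - v^2) := by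
      rw [abs_le] at hK
      rcases hσ with rfl | rfl <;> linarith
    nlinarith
  linarith

lemma sqrt_ineq2 (S : Sys A K L s) (hσ : σ = 1 ∨ σ = -1) {x z w : ℝ} (hx : 0 ≤ A x 0) (hz : 0 < z) (hw : 0 < w)
   (hz1 : z ≤ 1) (hw1 : w ≤ 1) :
   (√z - √w) * (FF A K σ x z / (2 * √z) - FF A K σ x w / (2 * √w)) ≤ 3 * L * (√z - √w)^2 := by
  have key : ∀ z w : ℝ, 0 < w → w ≤ z → z ≤ 1 → 
     (FF A K σ x z / (2 * √z) - FF A K σ x w / (2 * √w)) ≤ 3 * L * (√z - √w) := by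
    intro z w hw hwz hz1
    unfold FF
    rw [min_eq_left hz1, min_eq_left (hwz.trans hz1)]
    have hz : 0 < z := by linarith
    have e1 := Real.sq_sqrt hz.le
    have e2 := Real.sq_sqrt hw.le
    have := abs_le.1 (S.lA x w 0)
    have := abs_le.1 (S.lA x z w)
    apply sqrt_ineq hσ S.Lpos (Real.sqrt_pos.2 hz) (Real.sqrt_pos.2 hw) (Real.sqrt_le_one.2 hz1) (Real.sqrt_le_sqrt hwz)
    · rw [e1, e2]
      rw [abs_of_nonneg (sub_nonneg.2 hwz)] at this
      linarith
    · rw [e2]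
      simp only [sub_zero, abs_of_pos hw] at *
      linarith
    · rw [e1, e2]
      have := S.lK x z w
      rwa [abs_of_nonneg (sub_nonneg.2 hwz)] at this
  rcases le_total w z with h | h
  · have := key z w hw h hz1
    have h2 := Real.sqrt_le_sqrt h
    nlinarith
  · have := key w z hz h hw1
    have h2 := Real.sqrt_le_sqrt h
    nlinarith

lemma sqrt_fwd (S : Sys A K L s) (hσ : σ = 1 ∨ σ = -1) {ζ₁ ζ₂ : ℝ → ℝ} {a b : ℝ} (h1 : SolOn A K σ ζ₁ (Icc a b))
    (h2 : SolOn A K σ ζ₂ (Icc a b)) (h1a : ζ₁ a = 0) (h2a : ζ₂ a = 0)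
    (hp1 : ∀ x ∈ Ioo a b, 0 < ζ₁ x ∧ ζ₁ x ≤ 1) (hp2 : ∀ x ∈ Ioo a b, 0 < ζ₂ x ∧ ζ₂ x ≤ 1)
    (hA : ∀ x ∈ Ioo a b, 0 ≤ A x 0) :
    ∀ x ∈ Ico a b, ζ₁ x = ζ₂ x := by
  have := energy_zero (E := fun x => (√(ζ₁ x) - √(ζ₂ x))^2) (a := a) (b := b) (C := 2 * (3 * L))
    (E' := fun x => (2 * (√(ζ₁ x) - √(ζ₂ x))^1 * (FF A K σ x (ζ₁ x) / (2 * √(ζ₁ x)) - FF A K σ x (ζ₂ x) / (2 * √(ζ₂ x))))) ?_ ?_ ?_ ?_ ?_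
  · intro x hx
    rcases eq_or_lt_of_le hx.1 with h | h
    · rw [← h, h1a, h2a]
    have := this x (Ico_subset_Icc_self hx)
    have := (pow_eq_zero_iff (two_ne_zero)).1 this
    have h3 := (hp1 x ⟨h, hx.2⟩).1
    have h4 := (hp2 x ⟨h, hx.2⟩).1
    exact (Real.sqrt_inj h3.le h4.le).1 (by linarith)
  · exact (h1.cont.sqrt.sub h2.cont.sqrt).pow 2
  · intro x hx
    have := (((h1 x (Ioo_subset_Icc_self hx)).sqrt (hp1 x hx).1.ne').sub ((h2 x (Ioo_subset_Icc_self hx)).sqrt (hp2 x hx).1.ne')).pow 2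
    exact HasDerivAt.congr_deriv this (by simp)
  · intro x hx
    have := sqrt_ineq2 S hσ (hA x hx) (hp1 x hx).1 (hp2 x hx).1 (hp1 x hx).2 (hp2 x hx).2
    nlinarith
  · intro x; positivity
  · simp [h1a, h2a]

lemma FF_lip_pos (S : Sys A K L s) (hσ : σ = 1 ∨ σ = -1) {m : ℝ} (hm : 0 < m) (hm1 : m ≤ 1) (x z w : ℝ) (hz : m ≤ z) (hw : m ≤ w) :
    |FF A K σ x z - FF A K σ x w| ≤ (2 * L + 2 / √m) * |z - w| := by
  have h1 := S.lA x z w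
  have h2 := S.lK x z w
  have h3 : |√(min z 1) - √(min w 1)| ≤ |z - w| / √m := by
    set p := √(min z 1)
    set q := √(min w 1)
    have hp : √m ≤ p := Real.sqrt_le_sqrt (le_min hz hm1)
    have hq : √m ≤ q := Real.sqrt_le_sqrt (le_min hw hm1)
    have hm' := Real.sqrt_pos.2 hm
    have e1 : p ^ 2 = min z 1 := Real.sq_sqrt (le_min (by linarith) zero_le_one)
    have e2 : q ^ 2 = min w 1 := Real.sq_sqrt (le_min (by linarith) zero_le_one)
    rw [le_div_iff₀ hm']
    have : |p - q| * (p + q) = |min z 1 - min w 1| := by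
      rw [← e1, ← e2, show p^2 - q^2 = (p - q) * (p + q) by ring, abs_mul, abs_of_pos (a := p + q) (by linarith)]
    have h4 : |min z 1 - min w 1| ≤ |z - w| := (abs_min_sub_min_le_max z 1 w 1).trans (by simp)
    have := abs_nonneg (p - q)
    nlinarith
  have h4 : √(min w 1) ≤ 1 := Real.sqrt_le_one.2 (min_le_right _ _)
  have h5 := Real.sqrt_nonneg (min w 1)
  have h6 := S.K1 x z
  have h7 := S.K2 x z
  unfold FF
  have e : A x z + σ * (K x z * √(min z 1)) - (A x w + σ * (K x w * √(min w 1))) =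
    (A x z - A x w) + σ * (K x z * (√(min z 1) - √(min w 1)) + (K x z - K x w) * √(min w 1)) := by ring
  rw [e]
  have hs : |σ| = 1 := by rcases hσ with rfl | rfl <;> simp
  have b1 : |K x z * (√(min z 1) - √(min w 1))| ≤ 2 * (|z - w| / √m) := by
    rw [abs_mul, abs_of_nonneg (by linarith : 0 ≤ K x z)]
    gcongr
  have b2 : |(K x z - K x w) * √(min w 1)| ≤ L * |z - w| := by
    rw [abs_mul, abs_of_nonneg h5]
    have := abs_nonneg (K x z - K x w)
    nlinarith
  calc _ ≤ |A x z - A x w| + |σ * (K x z * (√(min z 1) - √(min w 1)) + (K x z - K x w) * √(min w 1))| := abs_add_le _ _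
    _ ≤ L * |z - w| + (2 * (|z - w| / √m) + L * |z - w|) := by
      rw [abs_mul, hs, one_mul]
      exact add_le_add h1 ((abs_add_le _ _).trans (add_le_add b1 b2))
    _ = _ := by ring

lemma uniq_pos (S : Sys A K L s) (hσ : σ = 1 ∨ σ = -1) {m : ℝ} (hm : 0 < m) {ζ₁ ζ₂ : ℝ → ℝ} {a b : ℝ} (h1 : SolOn A K σ ζ₁ (Icc a b))
    (h2 : SolOn A K σ ζ₂ (Icc a b)) (h : ζ₁ a = ζ₂ a) (hp1 : ∀ x ∈ Ioo a b, m ≤ ζ₁ x) (hp2 : ∀ x ∈ Ioo a b, m ≤ ζ₂ x) :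
    ∀ x ∈ Icc a b, ζ₁ x = ζ₂ x := by
  apply uniq_of_bound (C := 2 * L + 2 / √(min m 1)) h1 h2 h
  intro x hx
  have := FF_lip_pos S hσ (m := min m 1) (by positivity) (min_le_right _ _) x (ζ₁ x) (ζ₂ x) ((min_le_left _ _).trans (hp1 x hx)) ((min_le_left _ _).trans (hp2 x hx))
  have h3 := le_abs_self ((ζ₁ x - ζ₂ x) * (FF A K σ x (ζ₁ x) - FF A K σ x (ζ₂ x)))
  rw [abs_mul] at h3
  have h4 := abs_nonneg (ζ₁ x - ζ₂ x)
  rw [← sq_abs (ζ₁ x - ζ₂ x)]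
  nlinarith

lemma uniq_neg (S : Sys A K L s) {ζ₁ ζ₂ : ℝ → ℝ} {a b : ℝ} (h1 : SolOn A K σ ζ₁ (Icc a b))
    (h2 : SolOn A K σ ζ₂ (Icc a b)) (h : ζ₁ a = ζ₂ a) (hp1 : ∀ x ∈ Ioo a b, ζ₁ x ≤ 0) (hp2 : ∀ x ∈ Ioo a b, ζ₂ x ≤ 0) :
    ∀ x ∈ Icc a b, ζ₁ x = ζ₂ x := by
  apply uniq_of_bound (C := 0) h1 h2 h
  intro x hx
  rw [FF_neg S (hp1 x hx), FF_neg S (hp2 x hx)]; simp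

lemma ev_right {P : ℝ → Prop} {a : ℝ} (h : ∀ᶠ x in 𝓝[>] a, P x) {b : ℝ} (hab : a < b) : ∃ c ∈ Ioc a b, ∀ x ∈ Ioo a c, P x := by
  rw [eventually_iff, mem_nhdsGT_iff_exists_Ioo_subset' hab] at h
  obtain ⟨u, hu, h⟩ := h
  have hu' : a < u := hu
  exact ⟨min u b, ⟨lt_min hu' hab, min_le_right _ _⟩, fun x hx => h ⟨hx.1, hx.2.trans_le (min_le_left _ _)⟩⟩

lemma ev_pos_right {ζ : ℝ → ℝ} {a d : ℝ} (h : HasDerivAt ζ d a) (h0 : ζ a = 0) (hd : 0 < d) : ∀ᶠ x in 𝓝[>] a, 0 < ζ x := by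
  have h1 := (hasDerivAt_iff_tendsto_slope.1 h).mono_left (nhdsWithin_mono (s := Ioi a) a (fun x (hx : a < x) => hx.ne'))
  filter_upwards [h1.eventually (lt_mem_nhds hd), self_mem_nhdsWithin] with x hx hxa
  rw [slope_def_field, h0, sub_zero] at hx
  have hxa' : 0 < x - a := sub_pos.2 hxa
  by_contra hc
  exact absurd hx (not_lt.2 (div_nonpos_of_nonpos_of_nonneg (not_lt.1 hc) hxa'.le))

lemma ev_neg_right {ζ : ℝ → ℝ} {a d : ℝ} (h : HasDerivAt ζ d a) (h0 : ζ a = 0) (hd : d < 0) : ∀ᶠ x in 𝓝[>] a, ζ x < 0 := by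
  have := ev_pos_right (ζ := fun x => - ζ x) h.neg (by simpa using h0) (by linarith)
  simpa using this

lemma loc_right (S : Sys A K L s) (hσ : σ = 1 ∨ σ = -1) {ζ₁ ζ₂ : ℝ → ℝ} {a b : ℝ} (hab : a < b) (h1 : SolOn A K σ ζ₁ (Icc a b))
    (h2 : SolOn A K σ ζ₂ (Icc a b)) (h : ζ₁ a = ζ₂ a) (hc : σ = -1 ∨ ζ₁ a ≠ 0 ∨ A a 0 ≠ 0) :
    ∀ᶠ x in 𝓝[>] a, ζ₁ x = ζ₂ x := by
  have haI : a ∈ Icc a b := ⟨le_refl _, hab.le⟩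
  have fin : ∀ c ∈ Ioc a b, (∀ x ∈ Ioo a c, ζ₁ x = ζ₂ x) → ∀ᶠ x in 𝓝[>] a, ζ₁ x = ζ₂ x := by
    intro c hc h
    filter_upwards [Ioo_mem_nhdsGT hc.1] with x hx using h x hx
  have sub : ∀ c ∈ Ioc a b, Icc a c ⊆ Icc a b := fun c hc => Icc_subset_Icc_right hc.2
  have c1 : Tendsto ζ₁ (𝓝[>] a) (𝓝 (ζ₁ a)) := (h1 a haI).continuousAt.tendsto.mono_left nhdsWithin_le_nhds
  have c2 : Tendsto ζ₂ (𝓝[>] a) (𝓝 (ζ₁ a)) := by rw [h]; exact (h2 a haI).continuousAt.tendsto.mono_left nhdsWithin_le_nhds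
  by_cases hσ1 : σ = -1
  · subst hσ1
    apply fin b ⟨hab, le_refl _⟩
    intro x hx
    exact minus_fwd S (h1.mono (Icc_subset_Icc_right hx.2.le)) (h2.mono (Icc_subset_Icc_right hx.2.le)) hx.1.le h
  have hc' := hc.resolve_left hσ1
  rcases lt_trichotomy (ζ₁ a) 0 with hz | hz | hz
  · obtain ⟨c, hcI, hcP⟩ := ev_right ((c1.eventually (gt_mem_nhds hz)).and (c2.eventually (gt_mem_nhds hz))) hab
    exact fin c hcI fun x hx => uniq_neg S (h1.mono (sub c hcI)) (h2.mono (sub c hcI)) h (fun x hx => (hcP x hx).1.le) (fun x hx => (hcP x hx).2.le) x (Ioo_subset_Icc_self hx)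
  · have hA : A a 0 ≠ 0 := hc'.resolve_left (by simpa using hz)
    have d1 := h1 a haI
    have d2 := h2 a haI
    rw [← h] at d2
    rw [FF_neg S hz.le] at d1 d2
    rcases lt_or_gt_of_ne hA with hA | hA
    · obtain ⟨c, hcI, hcP⟩ := ev_right ((ev_neg_right d1 hz hA).and (ev_neg_right d2 (h ▸ hz) hA)) hab
      exact fin c hcI fun x hx => uniq_neg S (h1.mono (sub c hcI)) (h2.mono (sub c hcI)) h (fun x hx => (hcP x hx).1.le) (fun x hx => (hcP x hx).2.le) x (Ioo_subset_Icc_self hx)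
    · have cA : Tendsto (fun x => A x 0) (𝓝[>] a) (𝓝 (A a 0)) := by
        have : Continuous (fun x => A x 0) := S.cA.comp (f := fun x : ℝ => (x, (0:ℝ))) (by fun_prop)
        exact this.continuousAt.tendsto.mono_left nhdsWithin_le_nhds
      rw [hz] at c1 c2
      obtain ⟨c, hcI, hcP⟩ := ev_right (((ev_pos_right d1 hz hA).and (ev_pos_right d2 (h ▸ hz) hA)).and
        ((cA.eventually (lt_mem_nhds hA)).and ((c1.eventually (gt_mem_nhds zero_lt_one)).and (c2.eventually (gt_mem_nhds zero_lt_one))))) hab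
      exact fin c hcI fun x hx => sqrt_fwd S hσ (h1.mono (sub c hcI)) (h2.mono (sub c hcI)) hz (h ▸ hz)
        (fun x hx => ⟨(hcP x hx).1.1, (hcP x hx).2.2.1.le⟩) (fun x hx => ⟨(hcP x hx).1.2, (hcP x hx).2.2.2.le⟩)
        (fun x hx => (hcP x hx).2.1.le) x (Ioo_subset_Ico_self hx)
  · have hz2 : ζ₁ a / 2 < ζ₁ a := by linarith
    obtain ⟨c, hcI, hcP⟩ := ev_right ((c1.eventually (lt_mem_nhds hz2)).and (c2.eventually (lt_mem_nhds hz2))) hab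
    exact fin c hcI fun x hx => uniq_pos S hσ (half_pos hz) (h1.mono (sub c hcI)) (h2.mono (sub c hcI)) h (fun x hx => (hcP x hx).1.le) (fun x hx => (hcP x hx).2.le) x (Ioo_subset_Icc_self hx)

lemma glob_right (S : Sys A K L s) (hσ : σ = 1 ∨ σ = -1) {ζ₁ ζ₂ : ℝ → ℝ} {a b : ℝ} (h1 : SolOn A K σ ζ₁ (Icc a b))
    (h2 : SolOn A K σ ζ₂ (Icc a b)) (h : ζ₁ a = ζ₂ a)
    (hc : ∀ x ∈ Ico a b, σ = -1 ∨ ζ₁ x ≠ 0 ∨ x ≠ 0) :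
    ∀ x ∈ Icc a b, ζ₁ x = ζ₂ x := by
  rcases lt_or_ge b a with hab | hab
  · intro x hx; exact absurd (hx.1.trans hx.2) (not_le.2 hab)
  have : Icc a b ⊆ {x | ζ₁ x = ζ₂ x} := by
    apply IsClosed.Icc_subset_of_forall_mem_nhdsWithin
    · have : {x | ζ₁ x = ζ₂ x} ∩ Icc a b = Icc a b ∩ (fun x => ζ₁ x - ζ₂ x) ⁻¹' {0} := by
        ext x; simp [sub_eq_zero, and_comm]
      rw [this]
      exact (h1.cont.sub h2.cont).preimage_isClosed_of_isClosed isClosed_Icc isClosed_singleton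
    · exact h
    · intro x hx
      apply loc_right S hσ hx.2.2 (h1.mono (Icc_subset_Icc_left hx.2.1)) (h2.mono (Icc_subset_Icc_left hx.2.1)) hx.1
      rcases hc x hx.2 with h | h | h
      · exact Or.inl h
      · exact Or.inr (Or.inl h)
      · refine Or.inr (Or.inr fun h0 => ?_)
        have := S.sA x h
        simp [h0] at this
  exact this

lemma pos_after_zero (S : Sys A K L 1) {ζ : ℝ → ℝ} {b : ℝ} (h : SolOn A K σ ζ (Icc 0 b)) (h0 : ζ 0 = 0) :
    ∀ x ∈ Ioc 0 b, 0 < ζ x := by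
  intro x hx
  by_contra hc
  push Not at hc
  have hsub : Icc 0 x ⊆ Icc 0 b := Icc_subset_Icc_right hx.2
  obtain ⟨y, hy, hmin⟩ := isCompact_Icc.exists_isMinOn (nonempty_Icc.2 hx.1.le) (h.cont.mono hsub)
  have key : ∀ y ∈ Ioc 0 x, (∀ w ∈ Icc 0 x, ζ y ≤ ζ w) → False := by
    intro y hy hm
    have hy0 : ζ y ≤ 0 := (hm x ⟨hx.1.le, le_refl _⟩).trans hc
    have hd := h y (hsub (Ioc_subset_Icc_self hy))
    rw [FF_neg S hy0] at hd
    have hp : 0 < A y 0 := by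
      have := S.sA y hy.1.ne'
      rw [one_mul] at this
      exact (pos_iff_pos_of_mul_pos this).1 hy.1
    have h1 := (hasDerivAt_iff_tendsto_slope.1 hd).mono_left (nhdsWithin_mono (s := Iio y) y (fun x (hx : x < y) => hx.ne))
    have h2 := (h1.eventually (lt_mem_nhds hp)).and (Ioo_mem_nhdsLT hy.1)
    obtain ⟨w, hw1, hw2⟩ := h2.exists
    rw [slope_def_field] at hw1
    have := hm w ⟨hw2.1.le, hw2.2.le.trans hy.2⟩
    have : (ζ w - ζ y) / (w - y) ≤ 0 := div_nonpos_of_nonneg_of_nonpos (by linarith) (by linarith [hw2.2])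
    linarith
  rcases eq_or_lt_of_le hy.1 with h' | h'
  · apply key x ⟨hx.1, le_refl _⟩
    intro w hw
    have := hmin hw
    simp only [mem_ofPred_eq, ← h', h0] at this
    linarith
  · exact key y ⟨h', hy.2⟩ (fun w hw => hmin hw)

def Sol (A K : ℝ → ℝ → ℝ) (σ : ℝ) (ζ : ℝ → ℝ) : Prop := SolOn A K σ ζ (Icc (-1) 0)

lemma saddle_zero (S : Sys A K L 1) (hσ : σ = 1 ∨ σ = -1) {ζ₁ ζ₂ : ℝ → ℝ} {b : ℝ} (hb : 0 < b) (h1 : SolOn A K σ ζ₁ (Icc 0 b))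
    (h2 : SolOn A K σ ζ₂ (Icc 0 b)) (h10 : ζ₁ 0 = 0) (h20 : ζ₂ 0 = 0) : ∀ x ∈ Icc 0 b, ζ₁ x = ζ₂ x := by
  have haI : (0:ℝ) ∈ Icc 0 b := ⟨le_refl _, hb.le⟩
  have c1 : Tendsto ζ₁ (𝓝[>] 0) (𝓝 0) := by
    have := (h1 0 haI).continuousAt.tendsto.mono_left (nhdsWithin_le_nhds (s := Ioi 0))
    rwa [h10] at this
  have c2 : Tendsto ζ₂ (𝓝[>] 0) (𝓝 0) := by
    have := (h2 0 haI).continuousAt.tendsto.mono_left (nhdsWithin_le_nhds (s := Ioi 0))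
    rwa [h20] at this
  obtain ⟨c, hcI, hcP⟩ := ev_right ((c1.eventually (gt_mem_nhds zero_lt_one)).and (c2.eventually (gt_mem_nhds zero_lt_one))) hb
  have sub : Icc 0 c ⊆ Icc 0 b := Icc_subset_Icc_right hcI.2
  have e := sqrt_fwd S hσ (h1.mono sub) (h2.mono sub) h10 h20
    (fun x hx => ⟨pos_after_zero S h1 h10 x ⟨hx.1, hx.2.le.trans hcI.2⟩, (hcP x hx).1.le⟩)
    (fun x hx => ⟨pos_after_zero S h2 h20 x ⟨hx.1, hx.2.le.trans hcI.2⟩, (hcP x hx).2.le⟩)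
    (fun x hx => by
      have := S.sA x hx.1.ne'
      rw [one_mul] at this
      exact ((pos_iff_pos_of_mul_pos this).1 hx.1).le)
  have hc2 : c / 2 ∈ Ico 0 c := ⟨by linarith [hcI.1], by linarith [hcI.1]⟩
  intro x hx
  rcases lt_or_ge x c with h | h
  · exact e x ⟨hx.1, h⟩
  · have hs : Icc (c/2) b ⊆ Icc 0 b := Icc_subset_Icc_left hc2.1
    exact glob_right S hσ (h1.mono hs) (h2.mono hs) (e _ hc2) (fun y hy => Or.inr (Or.inr (by linarith [hy.1, hcI.1]))) x ⟨by linarith [hcI.1], hx.2⟩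

/-- Main uniqueness statement. -/
lemma sol_uniq (S : Sys A K L s) (hσ : σ = 1 ∨ σ = -1) {ζ₁ ζ₂ : ℝ → ℝ} (h1 : Sol A K σ ζ₁) (h2 : Sol A K σ ζ₂) {x : ℝ}
    (hx : x ∈ Icc (-1:ℝ) 0) (h : ζ₁ x = ζ₂ x) (hc : x ≠ 0 ∨ ζ₁ x ≠ 0 ∨ s = 1 ∨ σ = 1) : ∀ y ∈ Icc (-1:ℝ) 0, ζ₁ y = ζ₂ y := by
  intro y hy
  rcases le_total x y with hxy | hxy
  · have sub : Icc x 0 ⊆ Icc (-1:ℝ) 0 := Icc_subset_Icc_left hx.1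
    exact glob_right S hσ (h1.mono sub) (h2.mono sub) h (fun w hw => Or.inr (Or.inr hw.2.ne)) y ⟨hxy, hy.2⟩
  · have hσ' : -σ = 1 ∨ -σ = -1 := by rcases hσ with h | h <;> simp [h]
    have r1 := SolOn.refl (J := Icc (-x) 1) h1 (fun w hw => ⟨by linarith [hw.2], by linarith [hw.1, hx.2]⟩)
    have r2 := SolOn.refl (J := Icc (-x) 1) h2 (fun w hw => ⟨by linarith [hw.2], by linarith [hw.1, hx.2]⟩)
    have hyI : -y ∈ Icc (-x) 1 := ⟨by linarith, by linarith [hy.1]⟩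
    suffices hh : ∀ w ∈ Icc (-x) 1, ζ₁ (-w) = ζ₂ (-w) by simpa using hh (-y) hyI
    by_cases hs : s = 1 ∧ x = 0 ∧ ζ₁ x = 0
    · obtain ⟨rfl, rfl, h0⟩ := hs
      rw [neg_zero] at r1 r2 ⊢
      exact saddle_zero S.refl hσ' one_pos r1 r2 (by simpa using h0) (by simpa using h ▸ h0)
    · apply glob_right S.refl hσ' r1 r2 (by simpa using h)
      intro w hw
      by_cases hw0 : w = 0
      · subst hw0
        have hx0 : x = 0 := le_antisymm hx.2 (by linarith [hw.1])
        subst hx0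
        simp only [neg_zero]
        have : s = 1 → ζ₁ 0 ≠ 0 := fun hs' h0 => hs ⟨hs', rfl, h0⟩
        rcases hc with h | h | h | h
        · exact absurd rfl h
        · exact Or.inr (Or.inl h)
        · exact Or.inr (Or.inl (this h))
        · exact Or.inl (by rw [h])
      · exact Or.inr (Or.inr hw0)

end PartTwo

section PartThree
open Topology NNReal
variable {A K : ℝ → ℝ → ℝ} {L s σ : ℝ}

lemma exists_picard (G : ℝ → ℝ → ℝ) (hc : Continuous (fun p : ℝ × ℝ => G p.1 p.2)) {k B : ℝ} (hk : 0 ≤ k) (hB : 0 ≤ B)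
    (hlip : ∀ x z w, |G x z - G x w| ≤ k * |z - w|) (hb : ∀ x z, |G x z| ≤ B) {x0 : ℝ} (hx0 : x0 ∈ Icc (-1:ℝ) 0) (z0 : ℝ) :
    ∃ ζ : ℝ → ℝ, ζ x0 = z0 ∧ ∀ x ∈ Ioo (-2:ℝ) 1, HasDerivAt ζ (G x (ζ x)) x := by
  have hx0' : x0 ∈ Icc (-2:ℝ) 1 := ⟨by linarith [hx0.1], by linarith [hx0.2]⟩
  have P : IsPicardLindelof G (⟨x0, hx0'⟩ : Icc (-2:ℝ) 1) z0 ⟨3 * B, by positivity⟩ 0 ⟨B, hB⟩ ⟨k, hk⟩ := by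
    refine ⟨?_, ?_, ?_, ?_⟩
    · intro t _
      apply LipschitzOnWith.of_dist_le_mul
      intro z _ w _
      rw [Real.dist_eq, Real.dist_eq]
      exact hlip t z w
    · intro z _
      exact (hc.comp (f := fun t : ℝ => (t, z)) (by fun_prop)).continuousOn
    · intro t _ z _
      exact hb t z
    · have : max (1 - x0) (x0 - -2) ≤ 3 := max_le (by linarith [hx0.1]) (by linarith [hx0.2])
      simp only [NNReal.coe_zero, sub_zero]
      change B * max (1 - x0) (x0 - -2) ≤ 3 * B
      nlinarith
  obtain ⟨α, h0, h1⟩ := P.exists_eq_forall_mem_Icc_hasDerivWithinAt₀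
  exact ⟨α, h0, fun x hx => (h1 x (Ioo_subset_Icc_self hx)).hasDerivAt (Icc_mem_nhds hx.1 hx.2)⟩

/-- regularised square root -/
def rsq (η z : ℝ) : ℝ := √(max (min z 1) (η^2)) - η

lemma rsq_nonneg' {η z : ℝ} (h : 0 < η) : 0 ≤ rsq η z := by
  have : √(η^2) ≤ √(max (min z 1) (η^2)) := Real.sqrt_le_sqrt (le_max_right _ _)
  rw [Real.sqrt_sq h.le] at this
  unfold rsq; linarith

lemma rsq_eq {η z : ℝ} (h : 0 < η) : rsq η z = max (√(min z 1)) η - η := by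
  unfold rsq
  rw [Monotone.map_max (f := Real.sqrt) (fun _ _ h => Real.sqrt_le_sqrt h), Real.sqrt_sq h.le]

lemma rsq_le_one {η z : ℝ} (h : 0 < η) (h1 : η ≤ 1) : rsq η z ≤ 1 := by
  rw [rsq_eq h]
  have : max (√(min z 1)) η ≤ 1 := max_le (Real.sqrt_le_one.2 (min_le_right _ _)) h1
  linarith

lemma rsq_anti {η θ z : ℝ} (h : 0 < η) (h1 : η ≤ θ) : rsq θ z ≤ rsq η z := by
  rw [rsq_eq h, rsq_eq (h.trans_le h1)]
  rcases le_total (√(min z 1)) θ with h2 | h2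
  · rw [max_eq_right h2]; have := le_max_right (√(min z 1)) η; linarith
  · rw [max_eq_left h2]; have := le_max_left (√(min z 1)) η; linarith

lemma rsq_close {η z : ℝ} (h : 0 < η) : |rsq η z - √(min z 1)| ≤ η := by
  rw [rsq_eq h]
  have h5 := Real.sqrt_nonneg (min z 1)
  rcases le_total (√(min z 1)) η with h2 | h2
  · rw [max_eq_right h2, abs_le]; constructor <;> linarith
  · rw [max_eq_left h2, abs_le]; constructor <;> linarith

lemma rsq_lip {η z w : ℝ} (h : 0 < η) : |rsq η z - rsq η w| ≤ |z - w| / η := by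
  set p := √(max (min z 1) (η^2)) with hp
  set q := √(max (min w 1) (η^2)) with hq
  have e : rsq η z - rsq η w = p - q := by simp only [rsq, ← hp, ← hq]; ring
  have hp1 : η ≤ p := by
    have : √(η^2) ≤ p := Real.sqrt_le_sqrt (le_max_right _ _)
    rwa [Real.sqrt_sq h.le] at this
  have hq1 : η ≤ q := by
    have : √(η^2) ≤ q := Real.sqrt_le_sqrt (le_max_right _ _)
    rwa [Real.sqrt_sq h.le] at this
  have e1 : p ^ 2 = max (min z 1) (η^2) := Real.sq_sqrt ((sq_nonneg η).trans (le_max_right _ _))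
  have e2 : q ^ 2 = max (min w 1) (η^2) := Real.sq_sqrt ((sq_nonneg η).trans (le_max_right _ _))
  rw [e, le_div_iff₀ h]
  have : |p - q| * (p + q) = |max (min z 1) (η^2) - max (min w 1) (η^2)| := by
    rw [← e1, ← e2, show p^2 - q^2 = (p - q) * (p + q) by ring, abs_mul, abs_of_pos (a := p + q) (by linarith)]
  have h4 : |max (min z 1) (η^2) - max (min w 1) (η^2)| ≤ |z - w| := by
    refine (abs_max_sub_max_le_max _ _ _ _).trans ?_
    simp only [sub_self, abs_zero]
    exact max_le ((abs_min_sub_min_le_max z 1 w 1).trans (by simp)) (abs_nonneg _)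
  have := abs_nonneg (p - q)
  nlinarith

def Gη (A K : ℝ → ℝ → ℝ) (σ η x z : ℝ) : ℝ := A x z + σ * (K x z * rsq η z)

lemma Gη_cont (S : Sys A K L s) (η : ℝ) : Continuous (fun p : ℝ × ℝ => Gη A K σ η p.1 p.2) := by
  have := S.cA; have := S.cK
  unfold Gη rsq; fun_prop

lemma Gη_bound (S : Sys A K L s) (hσ : σ = 1 ∨ σ = -1) {η : ℝ} (h : 0 < η) (h1 : η ≤ 1) (x z : ℝ) : |Gη A K σ η x z| ≤ L + 2 := by
  have h1' := S.bA x z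
  have h2 : rsq η z ≤ 1 := rsq_le_one h h1
  have h3 : 0 ≤ rsq η z := rsq_nonneg' h
  have h4 := S.K1 x z
  have h5 := S.K2 x z
  unfold Gη
  have h6 : 0 ≤ K x z * rsq η z := mul_nonneg (by linarith) h3
  have h7 : K x z * rsq η z ≤ 2 := by nlinarith
  rw [abs_le] at *
  rcases hσ with rfl | rfl <;> constructor <;> linarith

lemma Gη_lip (S : Sys A K L s) (hσ : σ = 1 ∨ σ = -1) {η : ℝ} (h : 0 < η) (hη1 : η ≤ 1) (x z w : ℝ) :
    |Gη A K σ η x z - Gη A K σ η x w| ≤ (2 * L + 2 / η) * |z - w| := by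
  have h1 := S.lA x z w
  have h2 := S.lK x z w
  have h3 := rsq_lip (z := z) (w := w) h
  have h4 : rsq η w ≤ 1 := rsq_le_one h hη1
  have h5 : 0 ≤ rsq η w := rsq_nonneg' h
  have h6 := S.K1 x z
  have h7 := S.K2 x z
  unfold Gη
  have e : A x z + σ * (K x z * rsq η z) - (A x w + σ * (K x w * rsq η w)) =
    (A x z - A x w) + σ * (K x z * (rsq η z - rsq η w) + (K x z - K x w) * rsq η w) := by ring
  rw [e]
  have hs : |σ| = 1 := by rcases hσ with rfl | rfl <;> simp
  have b1 : |K x z * (rsq η z - rsq η w)| ≤ 2 * (|z - w| / η) := by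
    rw [abs_mul, abs_of_nonneg (by linarith : 0 ≤ K x z)]
    gcongr
  have b2 : |(K x z - K x w) * rsq η w| ≤ L * |z - w| := by
    rw [abs_mul, abs_of_nonneg h5]
    have := abs_nonneg (K x z - K x w)
    nlinarith
  calc _ ≤ |A x z - A x w| + |σ * (K x z * (rsq η z - rsq η w) + (K x z - K x w) * rsq η w)| := abs_add_le _ _
    _ ≤ L * |z - w| + (2 * (|z - w| / η) + L * |z - w|) := by
      rw [abs_mul, hs, one_mul]
      exact add_le_add h1 ((abs_add_le _ _).trans (add_le_add b1 b2))
    _ = _ := by ring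

lemma Gη_close (S : Sys A K L s) (hσ : σ = 1 ∨ σ = -1) {η : ℝ} (h : 0 < η) (x z : ℝ) :
    |Gη A K σ η x z - FF A K σ x z| ≤ 2 * η := by
  have h6 := S.K1 x z
  have h7 := S.K2 x z
  have h3 := rsq_close (z := z) h
  unfold Gη FF
  rw [show A x z + σ * (K x z * rsq η z) - (A x z + σ * (K x z * √(min z 1))) = σ * (K x z * (rsq η z - √(min z 1))) by ring]
  have hs : |σ| = 1 := by rcases hσ with rfl | rfl <;> simp
  rw [abs_mul, hs, one_mul, abs_mul, abs_of_nonneg (by linarith : 0 ≤ K x z)]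
  have := abs_nonneg (rsq η z - √(min z 1))
  nlinarith

lemma cmp_aux {G₁ G₂ : ℝ → ℝ → ℝ} {k : ℝ} (hlip : ∀ x z w, |G₁ x z - G₁ x w| ≤ k * |z - w|)
   (hle : ∀ x z, G₁ x z ≤ G₂ x z) {z₁ z₂ : ℝ → ℝ} {x : ℝ} : -(k * |z₂ x - z₁ x|) ≤ G₂ x (z₂ x) - G₁ x (z₁ x) := by
  have h1 := (abs_le.1 (hlip x (z₂ x) (z₁ x))).1
  have h2 := hle x (z₂ x)
  linarith

lemma cmp_fwd {G₁ G₂ : ℝ → ℝ → ℝ} {k : ℝ} (hlip : ∀ x z w, |G₁ x z - G₁ x w| ≤ k * |z - w|)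
   (hle : ∀ x z, G₁ x z ≤ G₂ x z) {z₁ z₂ : ℝ → ℝ} {a b : ℝ} (hab : a ≤ b) 
   (h1 : ∀ x ∈ Icc a b, HasDerivAt z₁ (G₁ x (z₁ x)) x) (h2 : ∀ x ∈ Icc a b, HasDerivAt z₂ (G₂ x (z₂ x)) x) (h : z₁ a = z₂ a) : z₁ b ≤ z₂ b := by
  have := DI_nonneg (d := fun x => z₂ x - z₁ x) (L := k) hab (fun x hx => (h2 x hx).sub (h1 x hx)) (fun x hx => cmp_aux hlip hle) (by simp [h])
  linarith

lemma cmp_bwd {G₁ G₂ : ℝ → ℝ → ℝ} {k : ℝ} (hlip : ∀ x z w, |G₁ x z - G₁ x w| ≤ k * |z - w|)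
   (hle : ∀ x z, G₁ x z ≤ G₂ x z) {z₁ z₂ : ℝ → ℝ} {a b : ℝ} (hab : a ≤ b) 
   (h1 : ∀ x ∈ Icc a b, HasDerivAt z₁ (G₁ x (z₁ x)) x) (h2 : ∀ x ∈ Icc a b, HasDerivAt z₂ (G₂ x (z₂ x)) x) (h : z₁ b = z₂ b) : z₂ a ≤ z₁ a := by
  by_contra hc
  push Not at hc
  have := DI_pos (d := fun x => z₂ x - z₁ x) (L := k) hab (fun x hx => (h2 x hx).sub (h1 x hx)) (fun x hx => cmp_aux hlip hle) (by simpa using hc)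
  simp [h] at this

lemma lip_of_deriv {z z' : ℝ → ℝ} {B a b : ℝ} (h : ∀ x ∈ Icc a b, HasDerivAt z (z' x) x) (hB : ∀ x ∈ Icc a b, |z' x| ≤ B)
    {x y : ℝ} (hx : x ∈ Icc a b) (hy : y ∈ Icc a b) : |z x - z y| ≤ B * |x - y| := by
  have := Convex.norm_image_sub_le_of_norm_hasDerivWithin_le (f := z) (f' := z') (s := Icc a b) (C := B)
    (fun x hx => (h x hx).hasDerivWithinAt) (fun x hx => by rw [Real.norm_eq_abs]; exact hB x hx) (convex_Icc a b) hy hx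
  simpa using this

lemma exists_sol (S : Sys A K L s) (hσ : σ = 1 ∨ σ = -1) {x0 : ℝ} (hx0 : x0 ∈ Icc (-1:ℝ) 0) (z0 : ℝ) :
    ∃ ζ : ℝ → ℝ, Sol A K σ ζ ∧ ζ x0 = z0 := by
  have hL := S.Lpos
  set e : ℕ → ℝ := fun n => 1 / ((n:ℝ) + 1) with he
  have e0 : ∀ n, 0 < e n := fun n => by simp only [he]; positivity
  have e1 : ∀ n, e n ≤ 1 := fun n => by
    simp only [he]; rw [div_le_one (by positivity)]; have : (0:ℝ) ≤ n := Nat.cast_nonneg n; linarith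
  have elim : Tendsto e atTop (𝓝 0) := tendsto_one_div_add_atTop_nhds_zero_nat
  have eanti : ∀ n m, n ≤ m → e m ≤ e n := fun n m h => by
    simp only [he]; gcongr
  have hex : ∀ n, ∃ ζ : ℝ → ℝ, ζ x0 = z0 ∧ ∀ x ∈ Ioo (-2:ℝ) 1, HasDerivAt ζ (Gη A K σ (e n) x (ζ x)) x := fun n =>
    exists_picard _ (Gη_cont S (e n)) (k := 2 * L + 2 / e n) (by have := e0 n; positivity) (B := L + 2) (by linarith)
      (Gη_lip S hσ (e0 n) (e1 n)) (Gη_bound S hσ (e0 n) (e1 n)) hx0 z0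
  choose Z hZ0 hZ using hex
  have sub : Icc (-1:ℝ) 0 ⊆ Ioo (-2:ℝ) 1 := fun x hx => ⟨by linarith [hx.1], by linarith [hx.2]⟩
  have hx0' := sub hx0
  have subJ : ∀ x ∈ Icc (-3/2:ℝ) (1/2), x ∈ Ioo (-2:ℝ) 1 := fun x hx => ⟨by linarith [hx.1], by linarith [hx.2]⟩
  have hx0J : x0 ∈ Icc (-3/2:ℝ) (1/2) := ⟨by linarith [hx0.1], by linarith [hx0.2]⟩
  have hlipZ : ∀ n, ∀ x ∈ Icc (-3/2:ℝ) (1/2), ∀ y ∈ Icc (-3/2:ℝ) (1/2), |Z n x - Z n y| ≤ (L + 2) * |x - y| := fun n x hx y hy =>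
    lip_of_deriv (fun x hx => hZ n x (subJ x hx)) (fun x _ => Gη_bound S hσ (e0 n) (e1 n) _ _) hx hy
  have hbdZ : ∀ n, ∀ x ∈ Icc (-3/2:ℝ) (1/2), |Z n x - z0| ≤ (L + 2) * 2 := by
    intro n x hx
    have := hlipZ n x hx x0 hx0J
    rw [hZ0] at this
    have h2 : |x - x0| ≤ 2 := by rw [abs_le]; constructor <;> linarith [hx.1, hx.2, hx0J.1, hx0J.2]
    nlinarith
  -- monotone
  have hK : ∀ x z n m, n ≤ m → K x z * rsq (e n) z ≤ K x z * rsq (e m) z := fun x z n m h =>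
    mul_le_mul_of_nonneg_left (rsq_anti (e0 m) (eanti n m h)) (by linarith [S.K1 x z])
  have hmono : ∀ x ∈ Icc (-3/2:ℝ) (1/2), (Monotone fun n => Z n x) ∨ (Antitone fun n => Z n x) := by
    intro x hx
    have Isub : ∀ a b : ℝ, a ∈ Icc (-3/2:ℝ) (1/2) → b ∈ Icc (-3/2:ℝ) (1/2) → Icc a b ⊆ Ioo (-2:ℝ) 1 := fun a b ha hb w hw =>
      ⟨by linarith [hw.1, ha.1], by linarith [hw.2, hb.2]⟩
    rcases hσ with hs | hs
    · have hle : ∀ n m, n ≤ m → ∀ x z, Gη A K σ (e n) x z ≤ Gη A K σ (e m) x z := fun n m h x z => by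
        unfold Gη; have := hK x z n m h; rw [hs]; linarith
      rcases le_total x0 x with hxx | hxx
      · left; intro n m h
        exact cmp_fwd (Gη_lip S (Or.inl hs) (e0 n) (e1 n)) (hle n m h) hxx (fun w hw => hZ n w (Isub _ _ hx0J hx hw))
          (fun w hw => hZ m w (Isub _ _ hx0J hx hw)) (by rw [hZ0, hZ0])
      · right; intro n m h
        exact cmp_bwd (Gη_lip S (Or.inl hs) (e0 n) (e1 n)) (hle n m h) hxx (fun w hw => hZ n w (Isub _ _ hx hx0J hw))
          (fun w hw => hZ m w (Isub _ _ hx hx0J hw)) (by rw [hZ0, hZ0])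
    · have hle : ∀ n m, n ≤ m → ∀ x z, Gη A K σ (e m) x z ≤ Gη A K σ (e n) x z := fun n m h x z => by
        unfold Gη; have := hK x z n m h; rw [hs]; linarith
      rcases le_total x0 x with hxx | hxx
      · right; intro n m h
        exact cmp_fwd (Gη_lip S (Or.inr hs) (e0 m) (e1 m)) (hle n m h) hxx (fun w hw => hZ m w (Isub _ _ hx0J hx hw))
          (fun w hw => hZ n w (Isub _ _ hx0J hx hw)) (by rw [hZ0, hZ0])
      · left; intro n m h
        exact cmp_bwd (Gη_lip S (Or.inr hs) (e0 m) (e1 m)) (hle n m h) hxx (fun w hw => hZ m w (Isub _ _ hx hx0J hw))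
          (fun w hw => hZ n w (Isub _ _ hx hx0J hw)) (by rw [hZ0, hZ0])
  have hlim : ∀ x ∈ Icc (-3/2:ℝ) (1/2), ∃ l, Tendsto (fun n => Z n x) atTop (𝓝 l) := by
    intro x hx
    rcases hmono x hx with h | h
    · refine ⟨_, tendsto_atTop_ciSup h ⟨z0 + (L + 2) * 2, ?_⟩⟩
      rintro _ ⟨n, rfl⟩
      have := (abs_le.1 (hbdZ n x hx)).2
      simp only; linarith
    · refine ⟨_, tendsto_atTop_ciInf h ⟨z0 - (L + 2) * 2, ?_⟩⟩
      rintro _ ⟨n, rfl⟩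
      have := (abs_le.1 (hbdZ n x hx)).1
      simp only; linarith
  choose! ξ hξ using hlim
  have hlipξ : ∀ x ∈ Icc (-3/2:ℝ) (1/2), ∀ y ∈ Icc (-3/2:ℝ) (1/2), |ξ x - ξ y| ≤ (L + 2) * |x - y| := fun x hx y hy =>
    le_of_tendsto ((hξ x hx).sub (hξ y hy)).abs (Eventually.of_forall fun n => hlipZ n x hx y hy)
  have hξc : ContinuousOn ξ (Icc (-3/2:ℝ) (1/2)) := by
    have : LipschitzOnWith ⟨L + 2, by linarith⟩ ξ (Icc (-3/2:ℝ) (1/2)) := by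
      apply LipschitzOnWith.of_dist_le_mul
      intro x hx y hy
      rw [Real.dist_eq, Real.dist_eq]
      exact hlipξ x hx y hy
    exact this.continuousOn
  set ξc : ℝ → ℝ := IccExtend (by norm_num : (-3/2:ℝ) ≤ 1/2) (fun x => ξ x) with hξcdef
  have hξcc : Continuous ξc := Continuous.Icc_extend' (continuousOn_iff_continuous_domRestrict.1 hξc)
  have hξce : ∀ x ∈ Icc (-3/2:ℝ) (1/2), ξc x = ξ x := fun x hx => by
    rw [hξcdef, IccExtend_of_mem _ _ hx]
  have hFc : Continuous (fun t => FF A K σ t (ξc t)) := (FF_cont S).comp (f := fun t => (t, ξc t)) (by fun_prop)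
  set W : ℝ → ℝ := fun x => z0 + ∫ t in x0..x, FF A K σ t (ξc t) with hW
  have hWd : ∀ x, HasDerivAt W (FF A K σ x (ξc x)) x := fun x =>
    (intervalIntegral.integral_hasDerivAt_right (hFc.intervalIntegrable _ _) hFc.aestronglyMeasurable.stronglyMeasurableAtFilter hFc.continuousAt).const_add z0
  have hWe : ∀ x ∈ Icc (-3/2:ℝ) (1/2), W x = ξ x := by
    intro x hx
    have hsubI : uIcc x0 x ⊆ Icc (-3/2:ℝ) (1/2) := by
      intro t ht
      rw [mem_uIcc] at ht
      rcases ht with ht | ht <;> constructor <;> linarith [hx.1, hx.2, hx0J.1, hx0J.2]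
    have hGc : ∀ n, ContinuousOn (fun t => Gη A K σ (e n) t (Z n t)) (uIcc x0 x) := by
      intro n
      have : ContinuousOn (fun t => ((t, Z n t) : ℝ × ℝ)) (uIcc x0 x) := continuousOn_id.prodMk
        (fun t ht => (hZ n t (subJ t (hsubI ht))).continuousAt.continuousWithinAt)
      exact (Gη_cont (σ := σ) S (e n)).comp_continuousOn this
    have eq1 : ∀ n, Z n x = z0 + ∫ t in x0..x, Gη A K σ (e n) t (Z n t) := by
      intro n
      rw [intervalIntegral.integral_eq_sub_of_hasDerivAt (f := Z n) (fun t ht => hZ n t (subJ t (hsubI ht))) ((hGc n).intervalIntegrable), hZ0]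
      ring
    have lim2 : Tendsto (fun n => z0 + ∫ t in x0..x, Gη A K σ (e n) t (Z n t)) atTop (𝓝 (W x)) := by
      apply Tendsto.const_add
      apply intervalIntegral.tendsto_integral_filter_of_dominated_convergence (fun _ => L + 2)
      · exact Eventually.of_forall fun n => ((hGc n).mono uIoc_subset_uIcc).aestronglyMeasurable measurableSet_uIoc
      · exact Eventually.of_forall fun n => Eventually.of_forall fun t _ => by
          rw [Real.norm_eq_abs]; exact Gη_bound S hσ (e0 n) (e1 n) _ _
      · exact intervalIntegrable_const
      · refine Eventually.of_forall fun t ht => ?_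
        have htJ := hsubI (uIoc_subset_uIcc ht)
        have l1 : Tendsto (fun n => FF A K σ t (Z n t)) atTop (𝓝 (FF A K σ t (ξc t))) := by
          rw [hξce t htJ]
          have : Continuous (fun z => FF A K σ t z) := (FF_cont S).comp (f := fun z => (t, z)) (by fun_prop)
          exact (this.tendsto _).comp (hξ t htJ)
        have l2 : Tendsto (fun n => Gη A K σ (e n) t (Z n t) - FF A K σ t (Z n t)) atTop (𝓝 0) := by
          apply squeeze_zero_norm (a := fun n => 2 * e n)
          · intro n; rw [Real.norm_eq_abs]; exact Gη_close S hσ (e0 n) _ _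
          · simpa using elim.const_mul 2
        simpa using l2.add l1
    have lim1 : Tendsto (fun n => Z n x) atTop (𝓝 (W x)) := by simpa only [← eq1] using lim2
    exact tendsto_nhds_unique lim1 (hξ x hx)
  refine ⟨W, ?_, by simp [hW]⟩
  intro x hx
  have hxJ : x ∈ Icc (-3/2:ℝ) (1/2) := ⟨by linarith [hx.1], by linarith [hx.2]⟩
  have := hWd x
  rwa [hξce x hxJ, ← hWe x hxJ] at this

/-- Crossing inequality. -/
lemma cross_ineq (S : Sys A K L s) (x z w : ℝ) : -(L * |z - w|) ≤ FF A K 1 x z - FF A K (-1) x w := by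
  have h1 := (abs_le.1 (S.lA x z w)).1
  have h2 : 0 ≤ K x z * √(min z 1) := mul_nonneg (by linarith [S.K1 x z]) (Real.sqrt_nonneg _)
  have h3 : 0 ≤ K x w * √(min w 1) := mul_nonneg (by linarith [S.K1 x w]) (Real.sqrt_nonneg _)
  unfold FF; linarith

lemma cross_nonneg (S : Sys A K L s) {ψ φ : ℝ → ℝ} {a b : ℝ} (hab : a ≤ b) (h1 : SolOn A K 1 ψ (Icc a b)) (h2 : SolOn A K (-1) φ (Icc a b))
    (h : φ a ≤ ψ a) : φ b ≤ ψ b := by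
  have := DI_nonneg (d := fun x => ψ x - φ x) (L := L) hab (fun x hx => (h1 x hx).sub (h2 x hx)) (fun x hx => cross_ineq S x _ _) (by simpa using h)
  linarith

lemma cross_pos (S : Sys A K L s) {ψ φ : ℝ → ℝ} {a b : ℝ} (hab : a ≤ b) (h1 : SolOn A K 1 ψ (Icc a b)) (h2 : SolOn A K (-1) φ (Icc a b))
    (h : φ a < ψ a) : φ b < ψ b := by
  have := DI_pos (d := fun x => ψ x - φ x) (L := L) hab (fun x hx => (h1 x hx).sub (h2 x hx)) (fun x hx => cross_ineq S x _ _) (by simpa using h)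
  linarith

/-- After a crossing at positive height the solutions separate. -/
lemma cross_sep (S : Sys A K L s) {ψ φ : ℝ → ℝ} {a b : ℝ} (hab : a < b) (h1 : SolOn A K 1 ψ (Icc a b)) (h2 : SolOn A K (-1) φ (Icc a b))
    (h : φ a = ψ a) (hp : 0 < ψ a) : φ b < ψ b := by
  have haI : a ∈ Icc a b := ⟨le_refl _, hab.le⟩
  have d := (h1 a haI).sub (h2 a haI)
  have hpos : 0 < FF A K 1 a (ψ a) - FF A K (-1) a (φ a) := by
    rw [h]; unfold FF
    have : 0 < K a (ψ a) * √(min (ψ a) 1) := mul_pos (by linarith [S.K1 a (ψ a)]) (Real.sqrt_pos.2 (by positivity))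
    linarith
  obtain ⟨c, hc, hcP⟩ := ev_right (ev_pos_right d (by simp [h]) hpos) hab
  have hm : (a + c) / 2 ∈ Ioo a c := ⟨by linarith [hc.1], by linarith [hc.1]⟩
  have h3 := hcP _ hm
  simp only [Pi.sub_apply] at h3
  have sub : Icc ((a+c)/2) b ⊆ Icc a b := Icc_subset_Icc_left hm.1.le
  exact cross_pos S (hm.2.le.trans hc.2) (h1.mono sub) (h2.mono sub) (by linarith)

end PartThree

section PartFour
open Topology
variable {A K : ℝ → ℝ → ℝ} {L s σ : ℝ}

open Classical in
def slf (A K : ℝ → ℝ → ℝ) (σ x z : ℝ) : ℝ → ℝ :=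
  if h : ∃ ζ : ℝ → ℝ, Sol A K σ ζ ∧ ζ x = z then h.choose else 0

lemma slf_sol (S : Sys A K L s) (hσ : σ = 1 ∨ σ = -1) {x : ℝ} (hx : x ∈ Icc (-1:ℝ) 0) (z : ℝ) : Sol A K σ (slf A K σ x z) := by
  unfold slf
  rw [dif_pos (exists_sol S hσ hx z)]
  exact (exists_sol S hσ hx z).choose_spec.1

lemma slf_at (S : Sys A K L s) (hσ : σ = 1 ∨ σ = -1) {x : ℝ} (hx : x ∈ Icc (-1:ℝ) 0) (z : ℝ) : slf A K σ x z x = z := by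
  unfold slf
  rw [dif_pos (exists_sol S hσ hx z)]
  exact (exists_sol S hσ hx z).choose_spec.2

def lab (A K : ℝ → ℝ → ℝ) (σ b : ℝ) (p : ℝ × ℝ) : ℝ := slf A K σ p.1 p.2 b

lemma lab_eq (S : Sys A K L s) (hσ : σ = 1 ∨ σ = -1) {ζ : ℝ → ℝ} (h : Sol A K σ ζ) {x z b : ℝ} (hx : x ∈ Icc (-1:ℝ) 0)
    (hb : b ∈ Icc (-1:ℝ) 0) (hz : ζ x = z) (hg : x ≠ 0 ∨ z ≠ 0 ∨ s = 1 ∨ σ = 1) : lab A K σ b (x, z) = ζ b := by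
  apply sol_uniq S hσ (slf_sol S hσ hx z) h hx _ _ b hb
  · simp only [slf_at S hσ hx, hz]
  · simpa only [slf_at S hσ hx] using hg

lemma ivt_zero {d : ℝ → ℝ} {x b : ℝ} (hc : ContinuousOn d (uIcc x b)) (h1 : d x < 0) (h2 : 0 < d b) :
    ∃ y ∈ uIcc x b, d y = 0 ∧ y ≠ x ∧ y ≠ b := by
  have := intermediate_value_uIcc hc
  obtain ⟨y, hy, hy0⟩ := this (show (0:ℝ) ∈ uIcc (d x) (d b) from by
    rw [mem_uIcc]; left; constructor <;> linarith)
  refine ⟨y, hy, hy0, ?_, ?_⟩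
  · rintro rfl; linarith
  · rintro rfl; linarith

lemma ord_aux (S : Sys A K L s) (hσ : σ = 1 ∨ σ = -1) {ζ₁ ζ₂ : ℝ → ℝ} (h1 : Sol A K σ ζ₁) (h2 : Sol A K σ ζ₂) {x b : ℝ}
    (hx : x ∈ Icc (-1:ℝ) 0) (hb : b ∈ Icc (-1:ℝ) 0) (h : ζ₁ x < ζ₂ x) : ζ₁ b ≤ ζ₂ b := by
  by_contra hc
  push Not at hc
  have hsub : uIcc x b ⊆ Icc (-1:ℝ) 0 := uIcc_subset_Icc hx hb
  obtain ⟨y, hy, h0, hyx, hyb⟩ := ivt_zero (d := fun t => ζ₁ t - ζ₂ t) ((h1.cont.sub h2.cont).mono hsub) (by simpa using h) (by simpa using hc)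
  have hyI := hsub hy
  have hy0 : y ≠ 0 := by
    rintro rfl
    rw [mem_uIcc] at hy
    rcases hy with hy | hy
    · exact hyb (le_antisymm hy.2 hb.2)
    · exact hyx (le_antisymm hy.2 hx.2)
  have := sol_uniq S hσ h1 h2 hyI (by linarith) (Or.inl hy0) x hx
  linarith

lemma ord_lt (S : Sys A K L s) (hσ : σ = 1 ∨ σ = -1) {ζ₁ ζ₂ : ℝ → ℝ} (h1 : Sol A K σ ζ₁) (h2 : Sol A K σ ζ₂) {x b : ℝ}
    (hx : x ∈ Icc (-1:ℝ) 0) (hb : b ∈ Icc (-1:ℝ) 0) (h : ζ₁ x < ζ₂ x) (hg : b ≠ 0 ∨ ζ₁ b ≠ 0 ∨ s = 1 ∨ σ = 1) : ζ₁ b < ζ₂ b := by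
  apply lt_of_le_of_ne (ord_aux S hσ h1 h2 hx hb h)
  intro he
  have := sol_uniq S hσ h1 h2 hb he hg x hx
  linarith

def strip : Set (ℝ × ℝ) := {p | p.1 ∈ Icc (-1:ℝ) 0}

lemma lab_cont (S : Sys A K L s) (hσ : σ = 1 ∨ σ = -1) {b : ℝ} (hb : b ∈ Icc (-1:ℝ) 0) (hgb : b ≠ 0 ∨ s = 1 ∨ σ = 1)
    {p : ℝ × ℝ} (hp : p.1 ∈ Icc (-1:ℝ) 0) (hg : p.1 ≠ 0 ∨ p.2 ≠ 0 ∨ s = 1 ∨ σ = 1) :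
    ContinuousWithinAt (lab A K σ b) strip p := by
  have hgb' : ∀ t : ℝ, b ≠ 0 ∨ t ≠ 0 ∨ s = 1 ∨ σ = 1 := fun t => by tauto
  have near : ∀ m0 : ℝ, ContinuousWithinAt (fun q : ℝ × ℝ => q.2 - slf A K σ b m0 q.1) strip p := by
    intro m0
    have h1 : ContinuousOn (slf A K σ b m0) (Icc (-1) 0) := (slf_sol S hσ hb m0).cont
    have h2 : ContinuousWithinAt (fun q : ℝ × ℝ => slf A K σ b m0 q.1) strip p :=
      (h1 p.1 hp).comp (f := Prod.fst) continuous_fst.continuousWithinAt (fun q hq => hq)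
    exact continuous_snd.continuousWithinAt.sub h2
  have e : ∀ m0 : ℝ, p.2 = slf A K σ b m0 p.1 → lab A K σ b p = m0 := by
    intro m0 h
    have := lab_eq S hσ (slf_sol S hσ hb m0) hp hb h.symm hg
    rw [slf_at S hσ hb] at this
    exact this
  apply tendsto_order.2
  constructor
  · intro m0 hm
    have hlt : 0 < p.2 - slf A K σ b m0 p.1 := by
      rcases lt_trichotomy (p.2) (slf A K σ b m0 p.1) with h | h | h
      · have := ord_lt S hσ (slf_sol S hσ hp p.2) (slf_sol S hσ hb m0) hp hb (by rwa [slf_at S hσ hp]) (hgb' _)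
        rw [slf_at S hσ hb] at this
        exact absurd hm (not_lt.2 this.le)
      · exact absurd (e m0 h) hm.ne'
      · linarith
    filter_upwards [(near m0).eventually (lt_mem_nhds hlt), self_mem_nhdsWithin] with q hq hqI
    have := ord_lt S hσ (slf_sol S hσ hb m0) (slf_sol S hσ hqI q.2) hqI hb (by rw [slf_at S hσ hqI]; linarith) (hgb' _)
    rwa [slf_at S hσ hb] at this
  · intro m0 hm
    have hlt : p.2 - slf A K σ b m0 p.1 < 0 := by
      rcases lt_trichotomy (p.2) (slf A K σ b m0 p.1) with h | h | h
      · linarith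
      · exact absurd (e m0 h) hm.ne
      · have := ord_lt S hσ (slf_sol S hσ hb m0) (slf_sol S hσ hp p.2) hp hb (by rwa [slf_at S hσ hp]) (hgb' _)
        rw [slf_at S hσ hb] at this
        exact absurd hm (not_lt.2 this.le)
    filter_upwards [(near m0).eventually (gt_mem_nhds hlt), self_mem_nhdsWithin] with q hq hqI
    have := ord_lt S hσ (slf_sol S hσ hqI q.2) (slf_sol S hσ hb m0) hqI hb (by rw [slf_at S hσ hqI]; linarith) (hgb' _)
    rwa [slf_at S hσ hb] at this

lemma cross_back (S : Sys A K L s) {ψ φ : ℝ → ℝ} {a b : ℝ} (hab : a < b) (h1 : SolOn A K 1 ψ (Icc a b)) (h2 : SolOn A K (-1) φ (Icc a b))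
    (h : φ b = ψ b) (hp : 0 < ψ b) : ψ a < φ a := by
  by_contra hc
  push Not at hc
  have hd : ∀ y ∈ Icc a b, φ y ≤ ψ y := fun y hy =>
    cross_nonneg S hy.1 (h1.mono (Icc_subset_Icc_right hy.2)) (h2.mono (Icc_subset_Icc_right hy.2)) hc
  have hbI : b ∈ Icc a b := ⟨hab.le, le_refl _⟩
  have d := (h1 b hbI).sub (h2 b hbI)
  have hpos : 0 < FF A K 1 b (ψ b) - FF A K (-1) b (φ b) := by
    rw [h]; unfold FF
    have : 0 < K b (ψ b) * √(min (ψ b) 1) := mul_pos (by linarith [S.K1 b (ψ b)]) (Real.sqrt_pos.2 (by positivity))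
    linarith
  have h1 := (hasDerivAt_iff_tendsto_slope.1 d).mono_left (nhdsWithin_mono (s := Iio b) b (fun x (hx : x < b) => hx.ne))
  obtain ⟨w, hw1, hw2⟩ := ((h1.eventually (lt_mem_nhds hpos)).and (Ioo_mem_nhdsLT hab)).exists
  rw [slope_def_field] at hw1
  simp only [Pi.sub_apply, h, sub_self, sub_zero] at hw1
  have := hd w ⟨hw2.1.le, hw2.2.le⟩
  have : (ψ w - φ w) / (w - b) ≤ 0 := div_nonpos_of_nonneg_of_nonpos (by linarith) (by linarith [hw2.2])
  linarith

lemma A0_sign (S : Sys A K L s) {x : ℝ} (hx : x < 0) : s * A x 0 < 0 := by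
  have := S.sA x hx.ne
  nlinarith

lemma SolOn.swap (S : Sys A K L s) {ζ : ℝ → ℝ} {I : Set ℝ} (h : SolOn A K σ ζ I) (hn : ∀ x ∈ I, ζ x ≤ 0) (σ' : ℝ) : SolOn A K σ' ζ I := by
  intro x hx
  have := h x hx
  rw [FF_neg S (hn x hx)] at this ⊢
  exact this

/-- saddle: nonpositive stays negative to the right -/
lemma neg_stay (S : Sys A K L 1) {ζ : ℝ → ℝ} (h : Sol A K σ ζ) {x : ℝ} (hx : x ∈ Ico (-1:ℝ) 0) (h0 : ζ x ≤ 0) :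
    (∀ y ∈ Icc x 0, ζ y ≤ 0) ∧ ∀ y ∈ Ioc x 0, ζ y < 0 := by
  have sub : Icc x 0 ⊆ Icc (-1:ℝ) 0 := Icc_subset_Icc_left hx.1
  have hA : ∀ y < 0, A y 0 < 0 := fun y hy => by simpa using A0_sign S hy
  have h1 : ∀ y ∈ Icc x 0, ζ y ≤ 0 := by
    intro y hy
    exact image_le_of_deriv_right_lt_deriv_boundary' (f := ζ) (B := fun _ => 0) (B' := fun _ => 0) (h.cont.mono sub)
      (fun t ht => (h t (sub (Ico_subset_Icc_self ht))).hasDerivWithinAt) h0 continuousOn_const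
      (fun t _ => hasDerivWithinAt_const _ _ _) (fun t ht he => by rw [FF_neg S he.le]; exact hA t ht.2) hy
  refine ⟨h1, fun y hy => ?_⟩
  have hanti : StrictAntiOn ζ (Icc x 0) := by
    apply strictAntiOn_of_deriv_neg (convex_Icc _ _) (h.cont.mono sub)
    intro t ht
    rw [interior_Icc] at ht
    rw [(h t (sub (Ioo_subset_Icc_self ht))).deriv, FF_neg S (h1 t (Ioo_subset_Icc_self ht))]
    exact hA t ht.2
  have := hanti ⟨le_refl _, hx.2.le⟩ (Ioc_subset_Icc_self hy) hy.1
  linarith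

/-- node: nonnegative stays -/
lemma pos_stay (S : Sys A K L (-1)) {ζ : ℝ → ℝ} (h : Sol A K σ ζ) {x : ℝ} (hx : x ∈ Icc (-1:ℝ) 0) (h0 : 0 ≤ ζ x) :
    (∀ y ∈ Icc x 0, 0 ≤ ζ y) ∧ ∀ y ∈ Ioo x 0, 0 < ζ y := by
  have sub : Icc x 0 ⊆ Icc (-1:ℝ) 0 := Icc_subset_Icc_left hx.1
  have hA : ∀ y < 0, 0 < A y 0 := fun y hy => by simpa using A0_sign S hy
  have h1 : ∀ y ∈ Icc x 0, 0 ≤ ζ y := by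
    intro y hy
    have := image_le_of_deriv_right_lt_deriv_boundary' (f := fun t => - ζ t) (f' := fun t => - FF A K σ t (ζ t))
      (B := fun _ => 0) (B' := fun _ => 0) (h.cont.mono sub).neg
      (fun t ht => (h t (sub (Ico_subset_Icc_self ht))).neg.hasDerivWithinAt) (by simpa using h0) continuousOn_const
      (fun t _ => hasDerivWithinAt_const _ _ _) (fun t ht he => by
        rw [FF_neg S (by linarith [neg_eq_zero.1 he])]; linarith [hA t ht.2]) hy
    simpa using this
  refine ⟨h1, fun y hy => ?_⟩
  apply lt_of_le_of_ne (h1 y (Ioo_subset_Icc_self hy))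
  intro he
  have hd := h y (sub (Ioo_subset_Icc_self hy))
  rw [FF_neg S he.ge] at hd
  have hmin : IsLocalMin ζ y := by
    filter_upwards [Ioo_mem_nhds hy.1 hy.2] with t ht
    rw [← he]; exact h1 t (Ioo_subset_Icc_self ht)
  have := hmin.hasDerivAt_eq_zero hd
  linarith [hA y hy.2]

lemma neg_back (S : Sys A K L (-1)) {ζ : ℝ → ℝ} (h : Sol A K σ ζ) {x : ℝ} (hx : x ∈ Icc (-1:ℝ) 0) (hx0 : x < 0) (h0 : ζ x ≤ 0) :
    ∀ y ∈ Ico (-1:ℝ) x, ζ y < 0 := by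
  intro y hy
  by_contra hc
  push Not at hc
  have := (pos_stay S h ⟨hy.1, hy.2.le.trans hx.2⟩ hc).2 x ⟨hy.2, hx0⟩
  linarith

lemma plus_pos (S : Sys A K L (-1)) {ζ : ℝ → ℝ} (h : Sol A K 1 ζ) {x : ℝ} (hx : x ∈ Icc (-1:ℝ) 0) (h0 : 0 ≤ ζ x) (hx0 : x < 0) :
    0 < ζ 0 := by
  have hA : ∀ y ≤ 0, 0 ≤ A y 0 := fun y hy => by
    rcases eq_or_lt_of_le hy with rfl | hy
    · have := S.sm 0; simp at this; rw [this]
    · have := A0_sign S hy; linarith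
  have hm : 0 < ζ (x/2) := (pos_stay S h hx h0).2 (x/2) ⟨by linarith, by linarith⟩
  have sub : Icc (x/2) 0 ⊆ Icc (-1:ℝ) 0 := Icc_subset_Icc_left (by linarith [hx.1])
  apply DI_pos (L := L) (a := x/2) (by linarith) (fun t ht => h t (sub ht)) _ hm
  intro t ht
  have h1 := (abs_le.1 (S.lA t (ζ t) 0)).1
  rw [sub_zero] at h1
  have h2 : 0 ≤ K t (ζ t) * √(min (ζ t) 1) := mul_nonneg (by linarith [S.K1 t (ζ t)]) (Real.sqrt_nonneg _)
  have h3 := hA t ht.2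
  unfold FF; linarith

structure Chart (A K : ℝ → ℝ → ℝ) (T Tax Td : Set (ℝ × ℝ)) (τ : ℝ → ℝ × ℝ → ℝ) (C : Set (ℝ × ℝ)) (Θ : ℝ × ℝ → ℝ × ℝ) : Prop where
  cpt : IsCompact C
  sub : ∀ p ∈ C, p.1 ∈ Icc (-1:ℝ) 0 ∧ 0 ≤ p.2
  nb : C ∈ 𝓝[{p : ℝ × ℝ | p.1 ≤ 0 ∧ 0 ≤ p.2}] 0
  con : ContinuousOn Θ C
  inj : InjOn Θ C
  zero : Θ 0 = 0
  mapsT : MapsTo Θ C T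
  img : Θ '' C ∈ 𝓝[T] 0
  lab : ∀ σ : ℝ, (σ = 1 ∨ σ = -1) → ∀ p ∈ C, ∀ q ∈ C, p.1 < 0 → q.1 < 0 →
    ((∃ ξ, Sol A K σ ξ ∧ ξ p.1 = p.2 ∧ ξ q.1 = q.2) ↔ τ σ (Θ p) = τ σ (Θ q))
  ax : ∀ p ∈ C, p.1 = 0 ↔ Θ p ∈ Tax
  ax1 : ∀ p ∈ C, p.1 = 0 → (Θ p).1 = p.2
  dc : ∀ p ∈ C, p.2 = 0 ↔ Θ p ∈ Td

end PartFour

section PartFive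
open Topology
variable {A K : ℝ → ℝ → ℝ} {L s σ : ℝ}

lemma hp1 : (1:ℝ) = 1 ∨ (1:ℝ) = -1 := Or.inl rfl
lemma hm1 : (-1:ℝ) = 1 ∨ (-1:ℝ) = -1 := Or.inr rfl
lemma z0I : (0:ℝ) ∈ Icc (-1:ℝ) 0 := by norm_num
lemma m1I : (-1:ℝ) ∈ Icc (-1:ℝ) 0 := by norm_num

lemma lab_iff (S : Sys A K L s) (hσ : σ = 1 ∨ σ = -1) {b : ℝ} (hb : b ∈ Icc (-1:ℝ) 0) (hgb : b ≠ 0 ∨ s = 1 ∨ σ = 1) {p q : ℝ × ℝ}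
    (hp : p.1 ∈ Icc (-1:ℝ) 0) (hq : q.1 ∈ Icc (-1:ℝ) 0) (hp0 : p.1 < 0) (hq0 : q.1 < 0) :
    (∃ ξ, Sol A K σ ξ ∧ ξ p.1 = p.2 ∧ ξ q.1 = q.2) ↔ lab A K σ b p = lab A K σ b q := by
  constructor
  · rintro ⟨ξ, h, h1, h2⟩
    have e1 := lab_eq S hσ h hp hb h1 (Or.inl hp0.ne)
    have e2 := lab_eq S hσ h hq hb h2 (Or.inl hq0.ne)
    rw [Prod.mk.eta] at e1 e2
    rw [e1, e2]
  · intro h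
    refine ⟨slf A K σ p.1 p.2, slf_sol S hσ hp _, slf_at S hσ hp _, ?_⟩
    have := sol_uniq S hσ (slf_sol S hσ hp p.2) (slf_sol S hσ hq q.2) hb h (by tauto) q.1 hq
    rw [this, slf_at S hσ hq]

lemma sd_zero (S : Sys A K L 1) {ψ φ : ℝ → ℝ} (h1 : Sol A K 1 ψ) (h2 : Sol A K (-1) φ) {x : ℝ} (hx : x ∈ Ico (-1:ℝ) 0)
    (hψ : ψ x ≤ 0) (h : ψ x = φ x) : ψ 0 = φ 0 ∧ ψ 0 < 0 := by
  have sub : Icc x 0 ⊆ Icc (-1:ℝ) 0 := Icc_subset_Icc_left hx.1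
  have n1 := neg_stay S h1 hx hψ
  have n2 := neg_stay S h2 hx (h ▸ hψ)
  refine ⟨?_, n1.2 0 ⟨hx.2, le_refl _⟩⟩
  exact uniq_neg S (h1.mono sub) (SolOn.swap S (h2.mono sub) n2.1 1) h (fun y hy => n1.1 y (Ioo_subset_Icc_self hy))
    (fun y hy => n2.1 y (Ioo_subset_Icc_self hy)) 0 ⟨hx.2.le, le_refl _⟩

lemma sd_gap (S : Sys A K L 1) {ψ φ : ℝ → ℝ} (h1 : Sol A K 1 ψ) (h2 : Sol A K (-1) φ) {x : ℝ} (hx : x ∈ Ico (-1:ℝ) 0)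
    (hψ : 0 < ψ x) (h : ψ x = φ x) : φ 0 < ψ 0 := by
  have sub : Icc x 0 ⊆ Icc (-1:ℝ) 0 := Icc_subset_Icc_left hx.1
  exact cross_sep S hx.2 (h1.mono sub) (h2.mono sub) h.symm hψ

lemma sd_start (S : Sys A K L 1) : slf A K 1 0 0 (-1) < slf A K (-1) 0 0 (-1) := by
  set ψ := slf A K 1 0 0
  set φ := slf A K (-1) 0 0
  have h1 : Sol A K 1 ψ := slf_sol S hp1 z0I 0
  have h2 : Sol A K (-1) φ := slf_sol S hm1 z0I 0
  have e1 : ψ 0 = 0 := slf_at S hp1 z0I 0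
  have e2 : φ 0 = 0 := slf_at S hm1 z0I 0
  have p1 : 0 < ψ (-1) := by
    by_contra hc
    push Not at hc
    have := (neg_stay S h1 (x := -1) (by norm_num) hc).2 0 (by norm_num)
    linarith
  rcases lt_trichotomy (ψ (-1)) (φ (-1)) with h | h | h
  · exact h
  · have := cross_sep S (a := -1) (b := 0) (by norm_num) h1 h2 h.symm p1
    linarith
  · have := cross_pos S (a := -1) (b := 0) (by norm_num) h1 h2 h
    linarith

def sT : Set (ℝ × ℝ) := {q | q.2 ≤ q.1}
def sTax : Set (ℝ × ℝ) := {q | q.1 = q.2 ∧ 0 ≤ q.1}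
def sTd : Set (ℝ × ℝ) := {q | q.1 = q.2 ∧ q.1 ≤ 0}
open Classical in
def sτ (σ : ℝ) (q : ℝ × ℝ) : ℝ := if σ = 1 then q.1 else q.2

theorem saddle_chart (S : Sys A K L 1) : ∃ C Θ, Chart A K sT sTax sTd sτ C Θ := by
  have hL := S.Lpos
  set C : Set (ℝ × ℝ) := Icc (-1:ℝ) 0 ×ˢ Icc (0:ℝ) (L+3) with hC
  set Θ : ℝ × ℝ → ℝ × ℝ := fun p => (lab A K 1 0 p, lab A K (-1) 0 p) with hΘ
  have at0 : ∀ z, Θ (0, z) = (z, z) := fun z => by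
    simp only [hΘ, lab]; rw [slf_at S hp1 z0I, slf_at S hm1 z0I]
  have gap : ∀ p ∈ C, p.1 < 0 → 0 < p.2 → (Θ p).2 < (Θ p).1 := by
    intro p hp hx hz
    refine sd_gap S (ψ := slf A K 1 p.1 p.2) (φ := slf A K (-1) p.1 p.2) (slf_sol S hp1 hp.1 p.2) (slf_sol S hm1 hp.1 p.2) (x := p.1) ⟨hp.1.1, hx⟩ ?_ ?_
    · rw [slf_at S hp1 hp.1]; exact hz
    · rw [slf_at S hp1 hp.1, slf_at S hm1 hp.1]
  have dis : ∀ p ∈ C, p.1 < 0 → p.2 = 0 → (Θ p).1 = (Θ p).2 ∧ (Θ p).1 < 0 := by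
    intro p hp hx hz
    refine sd_zero S (ψ := slf A K 1 p.1 p.2) (φ := slf A K (-1) p.1 p.2) (slf_sol S hp1 hp.1 p.2) (slf_sol S hm1 hp.1 p.2) (x := p.1) ⟨hp.1.1, hx⟩ ?_ ?_
    · rw [slf_at S hp1 hp.1]; exact hz.le
    · rw [slf_at S hp1 hp.1, slf_at S hm1 hp.1]
  have tri : ∀ p ∈ C, p = (0, p.2) ∧ 0 ≤ p.2 ∨ p.1 < 0 ∧ 0 < p.2 ∨ p.1 < 0 ∧ p.2 = 0 := by
    intro p hp
    rcases eq_or_lt_of_le hp.1.2 with h | h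
    · left; exact ⟨Prod.ext h rfl, hp.2.1⟩
    · right
      rcases eq_or_lt_of_le hp.2.1 with h' | h'
      · right; exact ⟨h, h'.symm⟩
      · left; exact ⟨h, h'⟩
  have noinj : ∀ p ∈ C, ∀ q ∈ C, Θ p = Θ q → ¬ p.1 < q.1 := by
    intro p hp q hq h hlt
    have hx : p.1 < 0 := hlt.trans_le hq.1.2
    have s1 := slf_sol S hp1 hp.1 p.2
    have s2 := slf_sol S hm1 hp.1 p.2
    have e1 : slf A K 1 p.1 p.2 q.1 = q.2 := by
      rw [sol_uniq S hp1 s1 (slf_sol S hp1 hq.1 q.2) z0I (congrArg Prod.fst h) (by simp) q.1 hq.1, slf_at S hp1 hq.1]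
    have e2 : slf A K (-1) p.1 p.2 q.1 = q.2 := by
      rw [sol_uniq S hm1 s2 (slf_sol S hm1 hq.1 q.2) z0I (congrArg Prod.snd h) (by simp) q.1 hq.1, slf_at S hm1 hq.1]
    have sub : Icc p.1 q.1 ⊆ Icc (-1:ℝ) 0 := Icc_subset_Icc hp.1.1 hq.1.2
    rcases eq_or_lt_of_le hp.2.1 with h' | h'
    · have := (neg_stay S s1 ⟨hp.1.1, hx⟩ (by rw [slf_at S hp1 hp.1]; exact h'.ge)).2 q.1 ⟨hlt, hq.1.2⟩
      linarith [hq.2.1]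
    · have := cross_sep S hlt (s1.mono sub) (s2.mono sub) (by rw [slf_at S hp1 hp.1, slf_at S hm1 hp.1]) (by rw [slf_at S hp1 hp.1]; exact h')
      linarith
  refine ⟨C, Θ, ?_, ?_, ?_, ?_, ?_, ?_, ?_, ?_, ?_, ?_, ?_, ?_⟩
  · exact isCompact_Icc.prod isCompact_Icc
  · exact fun p hp => ⟨hp.1, hp.2.1⟩
  · rw [mem_nhdsWithin]
    refine ⟨Ioi (-1) ×ˢ Iio (L+3), isOpen_Ioi.prod isOpen_Iio, ⟨by norm_num, by simp; linarith⟩, ?_⟩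
    rintro p ⟨⟨h1, h2⟩, h3, h4⟩
    exact ⟨⟨le_of_lt h1, h3⟩, h4, le_of_lt h2⟩
  · have hsub : C ⊆ strip := fun p hp => hp.1
    intro p hp
    exact ((lab_cont S hp1 z0I (by simp) hp.1 (by simp)).mono hsub).prodMk ((lab_cont S hm1 z0I (by simp) hp.1 (by simp)).mono hsub)
  · intro p hp q hq h
    have h1 : p.1 = q.1 := le_antisymm (not_lt.1 (noinj q hq p hp h.symm)) (not_lt.1 (noinj p hp q hq h))
    have e1 : slf A K 1 p.1 p.2 q.1 = q.2 := by
      rw [sol_uniq S hp1 (slf_sol S hp1 hp.1 p.2) (slf_sol S hp1 hq.1 q.2) z0I (congrArg Prod.fst h) (by simp) q.1 hq.1, slf_at S hp1 hq.1]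
    rw [← h1, slf_at S hp1 hp.1] at e1
    exact Prod.ext h1 e1
  · exact at0 0
  · intro p hp
    show (Θ p).2 ≤ (Θ p).1
    rcases tri p hp with h | h | h
    · rw [h.1, at0]
    · exact (gap p hp h.1 h.2).le
    · exact (dis p hp h.1 h.2).1.ge
  · set ζ := (slf A K 1 0 0 (-1) + slf A K (-1) 0 0 (-1)) / 2
    have hst := sd_start S
    have a1 : 0 < slf A K 1 (-1) ζ 0 := by
      have := ord_lt S hp1 (slf_sol S hp1 z0I 0) (slf_sol S hp1 m1I ζ) m1I z0I (by rw [slf_at S hp1 m1I]; simp only [ζ]; linarith) (by simp)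
      rwa [slf_at S hp1 z0I] at this
    have a2 : slf A K (-1) (-1) ζ 0 < 0 := by
      have := ord_lt S hm1 (slf_sol S hm1 m1I ζ) (slf_sol S hm1 z0I 0) m1I z0I (by rw [slf_at S hm1 m1I]; simp only [ζ]; linarith) (by simp)
      rwa [slf_at S hm1 z0I] at this
    have a3 : slf A K 1 (-1) 0 0 < 0 :=
      (neg_stay S (slf_sol S hp1 m1I 0) (x := -1) (by norm_num) (by rw [slf_at S hp1 m1I])).2 0 (by norm_num)
    rw [mem_nhdsWithin]
    refine ⟨Ioo (max (-1) (slf A K 1 (-1) 0 0)) (min 1 (slf A K 1 (-1) ζ 0)) ×ˢ Ioi (slf A K (-1) (-1) ζ 0), isOpen_Ioo.prod isOpen_Ioi, ?_, ?_⟩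
    · exact ⟨⟨max_lt (by norm_num) a3, lt_min (by norm_num) a1⟩, a2⟩
    rintro q ⟨⟨⟨q1, q2⟩, q3⟩, hT⟩
    have q1a := (max_lt_iff.1 q1).1
    have q1b := (max_lt_iff.1 q1).2
    have q2a := (lt_min_iff.1 q2).1
    have q2b := (lt_min_iff.1 q2).2
    replace q3 : slf A K (-1) (-1) ζ 0 < q.2 := q3
    replace hT : q.2 ≤ q.1 := hT
    set ψ := slf A K 1 0 q.1 with hψ
    set φ := slf A K (-1) 0 q.2 with hφ
    have h1 : Sol A K 1 ψ := slf_sol S hp1 z0I _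
    have h2 : Sol A K (-1) φ := slf_sol S hm1 z0I _
    have e1 : ψ 0 = q.1 := slf_at S hp1 z0I _
    have e2 : φ 0 = q.2 := slf_at S hm1 z0I _
    have bd : ∀ y ∈ Icc (-1:ℝ) 0, ψ y ≤ L + 3 := by
      intro y hy
      have h := lip_of_deriv (B := L + 2) (fun x hx => h1 x hx) (fun x hx => FF_bound S hp1 x (ψ x)) hy z0I
      rw [e1] at h
      have h3 := (abs_le.1 h).2
      have : |y - 0| ≤ 1 := by rw [abs_le]; constructor <;> linarith [hy.1, hy.2]
      nlinarith
    have fin : ∀ y ∈ Icc (-1:ℝ) 0, 0 ≤ ψ y → φ y = ψ y → q ∈ Θ '' C := by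
      intro y hy hy0 he
      refine ⟨(y, ψ y), ⟨hy, hy0, bd y hy⟩, ?_⟩
      apply Prod.ext
      · simp only [hΘ]; rw [lab_eq S hp1 h1 hy z0I rfl (by simp), e1]
      · simp only [hΘ]; rw [lab_eq S hm1 h2 hy z0I he (by simp), e2]
    rcases eq_or_lt_of_le hT with hq | hq
    · rcases le_or_gt 0 q.1 with h0 | h0
      · exact fin 0 z0I (by rw [e1]; exact h0) (by rw [e1, e2, hq])
      · have : 0 < ψ (-1) := by
          by_contra hc
          push Not at hc
          rcases eq_or_lt_of_le hc with hc | hc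
          · have := sol_uniq S hp1 h1 (slf_sol S hp1 m1I 0) m1I (by rw [slf_at S hp1 m1I, hc]) (by simp) 0 z0I
            linarith
          · have := ord_lt S hp1 h1 (slf_sol S hp1 m1I 0) m1I z0I (by rwa [slf_at S hp1 m1I]) (by simp)
            linarith
        obtain ⟨y, hy, hy0⟩ := intermediate_value_Icc' (by norm_num : (-1:ℝ) ≤ 0) h1.cont (show (0:ℝ) ∈ Icc (ψ 0) (ψ (-1)) from ⟨by rw [e1]; exact h0.le, this.le⟩)
        have hyl : y < 0 := lt_of_le_of_ne hy.2 (by rintro rfl; linarith)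
        refine ⟨(y, 0), ⟨hy, le_refl _, by linarith⟩, ?_⟩
        have hh := dis (y, 0) ⟨hy, le_refl _, by linarith⟩ hyl rfl
        have hh1 : (Θ (y, 0)).1 = q.1 := by
          simp only [hΘ]; rw [lab_eq S hp1 h1 hy z0I hy0 (by simp), e1]
        exact Prod.ext hh1 (by rw [← hh.1, hh1, hq])
    · have d1 : ψ (-1) < ζ := by
        by_contra hc
        push Not at hc
        rcases eq_or_lt_of_le hc with hc | hc
        · have := sol_uniq S hp1 h1 (slf_sol S hp1 m1I ζ) m1I (by rw [slf_at S hp1 m1I, hc]) (by simp) 0 z0I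
          linarith
        · have := ord_lt S hp1 (slf_sol S hp1 m1I ζ) h1 m1I z0I (by rwa [slf_at S hp1 m1I]) (by simp)
          linarith
      have d2 : ζ < φ (-1) := by
        by_contra hc
        push Not at hc
        rcases eq_or_lt_of_le hc with hc | hc
        · have := sol_uniq S hm1 h2 (slf_sol S hm1 m1I ζ) m1I (by rw [slf_at S hm1 m1I, hc]) (by simp) 0 z0I
          linarith
        · have := ord_lt S hm1 h2 (slf_sol S hm1 m1I ζ) m1I z0I (by rwa [slf_at S hm1 m1I]) (by simp)
          linarith
      obtain ⟨y, hy, hy0⟩ := intermediate_value_Icc (by norm_num : (-1:ℝ) ≤ 0) (h1.cont.sub h2.cont)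
        (show (0:ℝ) ∈ Icc (ψ (-1) - φ (-1)) (ψ 0 - φ 0) from ⟨by linarith, by linarith⟩)
      have hy0' : ψ y = φ y := by simp only [Pi.sub_apply] at hy0; linarith
      have hyl : y < 0 := lt_of_le_of_ne hy.2 (by rintro rfl; linarith)
      refine fin y hy ?_ hy0'.symm
      by_contra hc
      push Not at hc
      have := (sd_zero S h1 h2 ⟨hy.1, hyl⟩ hc.le hy0').1
      linarith
  · intro σ hσ p hp q hq hp0 hq0
    have := lab_iff S hσ z0I (by simp) hp.1 hq.1 hp0 hq0
    rw [this]
    rcases hσ with rfl | rfl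
    · simp [sτ, hΘ]
    · have : (-1:ℝ) ≠ 1 := by norm_num
      simp [sτ, hΘ, this]
  · intro p hp
    rcases tri p hp with h | h | h
    · rw [h.1, at0]; simp [sTax, h.2]
    · have := gap p hp h.1 h.2
      simp only [sTax, mem_ofPred_eq]
      constructor
      · intro; linarith [h.1]
      · rintro ⟨h1, _⟩; linarith
    · have := dis p hp h.1 h.2
      simp only [sTax, mem_ofPred_eq]
      constructor
      · intro; linarith [h.1]
      · rintro ⟨h1, _⟩; linarith
  · intro p hp h
    have : p = (0, p.2) := Prod.ext h rfl
    rw [this, at0]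
  · intro p hp
    rcases tri p hp with h | h | h
    · rw [h.1, at0]; simp only [sTd, mem_ofPred_eq, true_and]
      constructor
      · intro h; exact h.le
      · intro h'; linarith [h.2]
    · have := gap p hp h.1 h.2
      simp only [sTd, mem_ofPred_eq]
      constructor
      · intro; linarith [h.2]
      · rintro ⟨h1, _⟩; linarith
    · have := dis p hp h.1 h.2
      simp only [sTd, mem_ofPred_eq]
      exact ⟨fun _ => ⟨this.1, this.2.le⟩, fun _ => h.2⟩

end PartFive

section PartSix
open Topology
variable {A K : ℝ → ℝ → ℝ} {L s σ : ℝ}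

lemma kap {g v : ℝ → ℝ} (hg : StrictMono g) (cg : Continuous g) (g0 : g 0 = 0) (hv : Monotone v) (cv : Continuous v) {nS : ℝ}
    (hn : 0 < nS) (hS : ∀ n, v n ≤ 0 ↔ n ≤ nS) (hv2 : ∀ n₁ n₂, n₁ < n₂ → 0 < v n₁ → v n₁ < v n₂) :
    ∃ κ : ℝ → ℝ, Continuous κ ∧ StrictMono κ ∧ (∀ n ≤ 0, κ n = g n) ∧ (∀ n, nS < n → κ n = 1 + v n) ∧ ∀ n ≤ nS, κ n ≤ 1 := by
  have m1 : Monotone (fun n => min (g n) 0) := fun x y h => min_le_min_right _ (hg.monotone h)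
  have m2 : Monotone (fun n => max 0 (min (n / nS) 1)) := fun x y h => max_le_max_left _ (min_le_min_right _ (by gcongr))
  have m3 : Monotone (fun n => max 0 (v n)) := fun x y h => max_le_max_left _ (hv h)
  refine ⟨fun n => min (g n) 0 + max 0 (min (n / nS) 1) + max 0 (v n), by fun_prop, ?_, ?_, ?_, ?_⟩
  · intro x y h
    have h1 := m1 h.le
    have h2 := m2 h.le
    have h3 := m3 h.le
    simp only at h1 h2 h3 ⊢
    rcases lt_or_ge x 0 with hx | hx
    · have e1 : g x < 0 := by rw [← g0]; exact hg hx
      have : min (g x) 0 < min (g y) 0 := by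
        rw [min_eq_left e1.le]; exact lt_min (hg h) e1
      linarith
    rcases lt_or_ge x nS with hx' | hx'
    · have : max 0 (min (x / nS) 1) < max 0 (min (y / nS) 1) := by
        have e : x / nS < 1 := by rwa [div_lt_one hn]
        have e0 : 0 ≤ x / nS := by positivity
        rw [min_eq_left e.le, max_eq_right e0]
        apply lt_max_of_lt_right
        exact lt_min (by gcongr) e
      linarith
    · have hy : 0 < v y := by
        by_contra hc
        have := (hS y).1 (not_lt.1 hc)
        linarith
      have : max 0 (v x) < max 0 (v y) := by
        apply lt_max_of_lt_right
        apply max_lt hy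
        rcases le_or_gt (v x) 0 with h0 | h0
        · linarith
        · exact hv2 x y h h0
      linarith
  · intro n h
    have e1 : g n ≤ 0 := by rw [← g0]; exact hg.monotone h
    have e2 : v n ≤ 0 := (hS n).2 (h.trans hn.le)
    have e3 : n / nS ≤ 0 := div_nonpos_of_nonpos_of_nonneg h hn.le
    simp only
    rw [min_eq_left e1, max_eq_left e2, max_eq_left ((min_le_left _ _).trans e3)]; ring
  · intro n h
    have e1 : 0 ≤ g n := by rw [← g0]; exact hg.monotone (hn.le.trans h.le)
    have e2 : 0 < v n := by
      by_contra hc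
      have := (hS n).1 (not_lt.1 hc)
      linarith
    have e3 : 1 ≤ n / nS := by rw [le_div_iff₀ hn]; linarith
    simp only
    rw [min_eq_right e1, max_eq_right e2.le, min_eq_right e3, max_eq_right zero_le_one]; ring
  · intro n h
    have e2 : v n ≤ 0 := (hS n).2 h
    simp only
    rw [max_eq_left e2]
    have h1 : max 0 (min (n / nS) 1) ≤ 1 := max_le zero_le_one (min_le_right _ _)
    have h2 := min_le_right (g n) 0
    linarith

lemma nd_barrier (S : Sys A K L (-1)) {X : ℝ} (hX0 : 0 < X) (hX1 : X < 1) (hLX : L * X < 1) {φ : ℝ → ℝ} (h : Sol A K (-1) φ)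
    (h0 : φ (-X) = X^2 / 64) : φ 0 ≤ 0 := by
  have hL := S.Lpos
  have sub : Icc (-X) 0 ⊆ Icc (-1:ℝ) 0 := Icc_subset_Icc_left (by linarith)
  have := image_le_of_deriv_right_lt_deriv_boundary' (f := φ) (f' := fun t => FF A K (-1) t (φ t)) (B := fun x => x^2/64) (B' := fun x => x / 32) (a := -X) (b := 0) (h.cont.mono sub)
      (fun t ht => (h t (sub (Ico_subset_Icc_self ht))).hasDerivWithinAt) (by rw [h0]; simp) (by fun_prop)
      (fun t _ => by
        have := ((hasDerivAt_pow 2 t).div_const 64).hasDerivWithinAt (s := Ici t)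
        exact HasDerivWithinAt.congr_deriv this (by norm_num; ring)) (fun t ht he => by
        have ht0 : 0 < -t := by linarith [ht.2]
        have ht1 : -t ≤ X := by linarith [ht.1]
        have e1 : √(min (φ t) 1) = -t / 8 := by
          rw [he, min_eq_left (by nlinarith), show t^2/64 = (-t/8)^2 by ring, Real.sqrt_sq (by linarith)]
        unfold FF
        rw [e1]
        have k1 := S.K1 t (φ t)
        have a1 := (abs_le.1 (S.lA t (φ t) 0)).2
        have a2 := (abs_le.1 (S.sm t)).2
        rw [abs_of_neg ht.2] at a2
        rw [sub_zero, he, abs_of_nonneg (by positivity)] at a1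
        rw [he] at k1 ⊢
        have k2 : 1/2 * (-t/8) ≤ K t (t^2/64) * (-t/8) := by gcongr
        have : L * (-t) < 1 := lt_of_le_of_lt (by gcongr) hLX
        have : L * (-t) * (-t) < 1 * (-t) := by gcongr
        nlinarith) (⟨by linarith, le_refl _⟩ : (0:ℝ) ∈ Icc (-X) 0)
  simpa using this

lemma nd_back (S : Sys A K L (-1)) {ψ φ : ℝ → ℝ} (h1 : Sol A K 1 ψ) (h2 : Sol A K (-1) φ) {a b : ℝ} (ha : -1 ≤ a) (hab : a ≤ b) (hb : b < 0)
    (h : ψ b = φ b) (h0 : ψ b ≤ 0) : ψ a = φ a ∧ ψ a ≤ 0 := by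
  have sub : Icc a b ⊆ Icc (-1:ℝ) 0 := Icc_subset_Icc ha hb.le
  have hbI : b ∈ Icc (-1:ℝ) 0 := sub ⟨hab, le_refl _⟩
  have n1 : ∀ y ∈ Icc a b, ψ y ≤ 0 := fun y hy => by
    rcases eq_or_lt_of_le hy.2 with rfl | hh
    · exact h0
    · exact (neg_back S h1 hbI hb h0 y ⟨ha.trans hy.1, hh⟩).le
  have n2 : ∀ y ∈ Icc a b, φ y ≤ 0 := fun y hy => by
    rcases eq_or_lt_of_le hy.2 with rfl | hh
    · exact h ▸ h0
    · exact (neg_back S h2 hbI hb (h ▸ h0) y ⟨ha.trans hy.1, hh⟩).le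
  have := lip_of_deriv (z := fun x => ψ x - φ x) (z' := fun _ => 0) (B := 0) (a := a) (b := b) (fun x hx => by
    have d := (h1 x (sub hx)).sub (h2 x (sub hx))
    rw [FF_neg S (n1 x hx), FF_neg S (n2 x hx), sub_self] at d
    exact d) (by simp) (left_mem_Icc.2 hab) (right_mem_Icc.2 hab)
  refine ⟨?_, n1 a (left_mem_Icc.2 hab)⟩
  rw [zero_mul] at this
  have := abs_nonpos_iff.1 this
  linarith

lemma nd_X (S : Sys A K L (-1)) : ∃ M₀ > 0, ∀ M, 0 < M → M < M₀ → ∃ X, 0 < X ∧ X < 1 ∧ L * X < 1 ∧ lab A K 1 0 (-X, 0) = M := by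
  have hL := S.Lpos
  have hx1 : 0 < 1 / (L + 2) := by positivity
  have hx2 : 1 / (L + 2) < 1 := by rw [div_lt_one (by positivity)]; linarith
  set x₁ := 1 / (L + 2)
  have hI : -x₁ ∈ Icc (-1:ℝ) 0 := ⟨by linarith, by linarith⟩
  refine ⟨lab A K 1 0 (-x₁, 0), ?_, ?_⟩
  · exact plus_pos S (slf_sol S hp1 hI 0) hI (by rw [slf_at S hp1 hI]) (by linarith)
  · intro M hM hM1
    have hc : ContinuousOn (fun x => lab A K 1 0 (x, 0)) (Icc (-x₁) 0) := by
      intro x hx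
      have hx' : x ∈ Icc (-1:ℝ) 0 := ⟨by linarith [hx.1], hx.2⟩
      exact (lab_cont S hp1 z0I (by simp) (p := (x, 0)) hx' (by simp)).comp (f := fun x : ℝ => (x, (0:ℝ))) (by fun_prop) (fun y hy => ⟨by linarith [hy.1], hy.2⟩)
    have e0 : lab A K 1 0 (0, 0) = 0 := slf_at S hp1 z0I 0
    obtain ⟨y, hy, hyM⟩ := intermediate_value_Icc' (by linarith : -x₁ ≤ 0) hc (show M ∈ Icc _ _ from ⟨by rw [e0]; exact hM.le, hM1.le⟩)
    simp only at hyM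
    have hy0 : y < 0 := lt_of_le_of_ne hy.2 (by rintro rfl; linarith)
    refine ⟨-y, by linarith, by linarith [hy.1], ?_, by rw [neg_neg]; exact hyM⟩
    have h1 : L * -y ≤ L * x₁ := by gcongr; linarith [hy.1]
    have : L * x₁ < 1 := by
      simp only [x₁]; rw [mul_one_div, div_lt_one (by positivity)]; linarith
    linarith

def nT (M : ℝ) : Set (ℝ × ℝ) := {q | 0 ≤ q.1 ∧ q.1 * (q.1 - M) ≤ q.2 ∧ q.2 ≤ q.1 * (1 + q.1)}
def nTax : Set (ℝ × ℝ) := {q | q.2 = q.1 * (1 + q.1)}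
def nTd (M : ℝ) : Set (ℝ × ℝ) := {q | q.2 = q.1 * (q.1 - M)}
open Classical in
def nτ (σ : ℝ) (q : ℝ × ℝ) : ℝ := if σ = 1 then q.1 else q.2 / q.1

/-- the node chart data -/
lemma nd_data (S : Sys A K L (-1)) {M X : ℝ} (hX0 : 0 < X) (hX1 : X < 1) (hLX : L * X < 1) (hM : lab A K 1 0 (-X, 0) = M) :
    ∃ κ : ℝ → ℝ, Continuous κ ∧ StrictMono κ ∧ (∀ ψ, Sol A K 1 ψ → ψ (-X) ≤ 0 → κ (ψ (-X)) = ψ 0 - M) ∧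
      (∀ φ, Sol A K (-1) φ → 0 < φ 0 → κ (φ (-X)) = 1 + φ 0) ∧ ∀ φ, Sol A K (-1) φ → φ 0 ≤ 0 → κ (φ (-X)) ≤ 1 := by
  have hI : -X ∈ Icc (-1:ℝ) 0 := ⟨by linarith, by linarith⟩
  have hXn : -X ≠ 0 := by linarith
  set g : ℝ → ℝ := fun n => lab A K 1 0 (-X, n) - M with hg
  set v : ℝ → ℝ := fun n => lab A K (-1) 0 (-X, n) with hv
  have gψ : ∀ ψ, Sol A K 1 ψ → g (ψ (-X)) = ψ 0 - M := fun ψ h => by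
    simp only [hg]; rw [lab_eq S hp1 h hI z0I rfl (by simp)]
  have vφ : ∀ φ, Sol A K (-1) φ → v (φ (-X)) = φ 0 := fun φ h => by
    simp only [hv]; rw [lab_eq S hm1 h hI z0I rfl (Or.inl hXn)]
  have vm : Monotone v := by
    intro x y h
    rcases eq_or_lt_of_le h with rfl | h
    · exact le_refl _
    exact ord_aux S hm1 (slf_sol S hm1 hI x) (slf_sol S hm1 hI y) hI z0I (by rwa [slf_at S hm1 hI, slf_at S hm1 hI])
  have vs : Function.Surjective v := fun w => ⟨slf A K (-1) 0 w (-X), by rw [vφ _ (slf_sol S hm1 z0I w), slf_at S hm1 z0I]⟩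
  have vc : Continuous v := vm.continuous_of_surjective vs
  have gm : StrictMono g := by
    intro x y h
    have := ord_lt S hp1 (slf_sol S hp1 hI x) (slf_sol S hp1 hI y) hI z0I (by rwa [slf_at S hp1 hI, slf_at S hp1 hI]) (by simp)
    simp only [hg, lab]; linarith
  have gc : Continuous g := by
    have : Continuous (fun n => lab A K 1 0 (-X, n)) := by
      rw [continuous_iff_continuousAt]
      intro n
      rw [← continuousWithinAt_univ]
      exact (lab_cont S hp1 z0I (by simp) (p := (-X, n)) hI (by simp)).comp (f := fun n : ℝ => (-X, n)) (by fun_prop) (fun y _ => hI)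
    exact this.sub continuous_const
  have hpos : v (X^2/64) ≤ 0 := nd_barrier S hX0 hX1 hLX (slf_sol S hm1 hI _) (slf_at S hm1 hI _)
  set E := {n | v n ≤ 0} with hE
  have hEc : IsClosed E := isClosed_le vc continuous_const
  have hEb : BddAbove E := by
    obtain ⟨n1, hn1⟩ := vs 1
    refine ⟨n1, fun n hn => ?_⟩
    by_contra hc
    have := vm (not_le.1 hc).le
    have : v n ≤ 0 := hn
    linarith
  have hEm : sSup E ∈ E := hEc.csSup_mem ⟨_, hpos⟩ hEb
  have hS : ∀ n, v n ≤ 0 ↔ n ≤ sSup E := fun n => ⟨fun h => le_csSup hEb h, fun h => (vm h).trans hEm⟩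
  have hnS : 0 < sSup E := lt_of_lt_of_le (by positivity) (le_csSup hEb hpos)
  obtain ⟨κ, k1, k2, k3, k4, k5⟩ := kap gm gc (by simp only [hg, hM, sub_self]) vm vc hnS hS (by
    intro x y h h0
    exact ord_lt S hm1 (slf_sol S hm1 hI x) (slf_sol S hm1 hI y) hI z0I (by rwa [slf_at S hm1 hI, slf_at S hm1 hI]) (Or.inr (Or.inl h0.ne')))
  refine ⟨κ, k1, k2, ?_, ?_, ?_⟩
  · intro ψ h h0; rw [k3 _ h0, gψ ψ h]
  · intro φ h h0
    rw [k4, vφ φ h]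
    rw [← not_le, ← hS, vφ φ h]; linarith
  · intro φ h h0
    apply k5; rw [← hS, vφ φ h]; exact h0

theorem node_chart (S : Sys A K L (-1)) : ∃ M₀ > 0, ∀ M, 0 < M → M < M₀ → ∃ C Θ, Chart A K (nT M) nTax (nTd M) nτ C Θ := by
  have hL := S.Lpos
  obtain ⟨M₀, hM₀, hh⟩ := nd_X S
  refine ⟨M₀, hM₀, fun M hM0 hM1 => ?_⟩
  obtain ⟨X, hX0, hX1, hLX, hM⟩ := hh M hM0 hM1
  obtain ⟨κ, κc, κm, κ1, κ2, κ3⟩ := nd_data S hX0 hX1 hLX hM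
  have hI : -X ∈ Icc (-1:ℝ) 0 := ⟨by linarith, by linarith⟩
  have hXn : -X ≠ 0 := by linarith
  set ℓ := lab A K 1 0 with hℓ
  set χ : ℝ × ℝ → ℝ := fun p => κ (lab A K (-1) (-X) p) with hχ
  set C : Set (ℝ × ℝ) := {p | p ∈ Icc (-1:ℝ) 0 ×ˢ Icc (0:ℝ) (M + L + 2) ∧ ℓ p ≤ M} with hC
  set Θ : ℝ × ℝ → ℝ × ℝ := fun p => (ℓ p, ℓ p * χ p) with hΘ
  have hlc : ContinuousOn ℓ strip := fun p hp => lab_cont S hp1 z0I (by simp) hp (by simp)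
  have ℓ0 : ∀ z, ℓ (0, z) = z := fun z => slf_at S hp1 z0I z
  have hMψ : ∀ ψ, Sol A K 1 ψ → 0 < ψ (-X) → M < ψ 0 := by
    intro ψ h h0
    rw [← hM]
    exact ord_lt S hp1 (slf_sol S hp1 hI 0) h hI z0I (by rwa [slf_at S hp1 hI]) (by simp)
  -- members of C
  have hCX : ∀ p ∈ C, -X ≤ p.1 := by
    intro p hp
    by_contra hc
    push Not at hc
    have := (pos_stay S (slf_sol S hp1 hp.1.1 p.2) hp.1.1 (by rw [slf_at S hp1 hp.1.1]; exact hp.1.2.1)).2 (-X) ⟨hc, by linarith⟩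
    have := hMψ _ (slf_sol S hp1 hp.1.1 p.2) this
    exact absurd hp.2 (not_le.2 this)
  have tri : ∀ p ∈ C, p = 0 ∨ p.1 = 0 ∧ 0 < p.2 ∨ p.1 < 0 ∧ 0 < p.2 ∨ p.1 < 0 ∧ p.2 = 0 := by
    intro p hp
    rcases eq_or_lt_of_le hp.1.1.2 with h | h <;> rcases eq_or_lt_of_le hp.1.2.1 with h' | h'
    · left; exact Prod.ext h h'.symm
    · right; left; exact ⟨h, h'⟩
    · right; right; right; exact ⟨h, h'.symm⟩
    · right; right; left; exact ⟨h, h'⟩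
  have ℓpos : ∀ p ∈ C, p ≠ 0 → 0 < ℓ p := by
    intro p hp hne
    rcases eq_or_lt_of_le hp.1.1.2 with h | h
    · have e : p = (0, p.2) := Prod.ext h rfl
      rw [e, ℓ0]
      apply lt_of_le_of_ne hp.1.2.1
      intro h'; exact hne (Prod.ext h h'.symm)
    · exact plus_pos S (ζ := slf A K 1 p.1 p.2) (slf_sol S hp1 hp.1.1 p.2) hp.1.1 (by rw [slf_at S hp1 hp.1.1]; exact hp.1.2.1) h
  -- disc
  have fd : ∀ p ∈ C, p.1 < 0 → p.2 = 0 → χ p = ℓ p - M := by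
    intro p hp h1 h2
    have := nd_back S (slf_sol S hp1 hp.1.1 p.2) (slf_sol S hm1 hp.1.1 p.2) hI.1 (hCX p hp) h1
      (by rw [slf_at S hp1 hp.1.1, slf_at S hm1 hp.1.1]) (by rw [slf_at S hp1 hp.1.1]; exact h2.le)
    have k := κ1 _ (slf_sol S hp1 hp.1.1 p.2) this.2
    rw [this.1] at k
    exact k
  have fpos : ∀ p ∈ C, 0 < p.2 → ℓ p - M < χ p := by
    intro p hp h2
    have s1 := slf_sol S hp1 hp.1.1 p.2
    have s2 := slf_sol S hm1 hp.1.1 p.2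
    have hle : slf A K 1 p.1 p.2 (-X) ≤ 0 := by
      by_contra hc
      exact absurd hp.2 (not_le.2 (hMψ _ s1 (not_le.1 hc)))
    have hlt : -X < p.1 := by
      apply lt_of_le_of_ne (hCX p hp)
      intro he
      rw [he, slf_at S hp1 hp.1.1] at hle
      linarith
    have sub : Icc (-X) p.1 ⊆ Icc (-1:ℝ) 0 := Icc_subset_Icc hI.1 hp.1.1.2
    have := cross_back S hlt (s1.mono sub) (s2.mono sub) (by rw [slf_at S hp1 hp.1.1, slf_at S hm1 hp.1.1]) (by rw [slf_at S hp1 hp.1.1]; exact h2)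
    have k := κ1 _ s1 hle
    have k2 := κm this
    have : ℓ p - M = κ (slf A K 1 p.1 p.2 (-X)) := k.symm
    rw [this]
    exact k2
  have fax : ∀ p ∈ C, p.1 = 0 → 0 < p.2 → χ p = 1 + ℓ p := by
    intro p hp h1 h2
    have e : p = (0, p.2) := Prod.ext h1 rfl
    have k := κ2 _ (slf_sol S hm1 z0I p.2) (by rw [slf_at S hm1 z0I]; exact h2)
    rw [slf_at S hm1 z0I] at k
    rw [e, ℓ0]
    exact k
  have fup : ∀ p ∈ C, p.1 < 0 → χ p < 1 + ℓ p := by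
    intro p hp h1
    have s1 := slf_sol S hp1 hp.1.1 p.2
    have s2 := slf_sol S hm1 hp.1.1 p.2
    have hl := ℓpos p hp (by rintro rfl; exact lt_irrefl _ h1)
    rcases eq_or_lt_of_le hp.1.2.1 with h' | h'
    · rw [fd p hp h1 h'.symm]; linarith
    rcases le_or_gt (slf A K (-1) p.1 p.2 0) 0 with h0 | h0
    · have : χ p ≤ 1 := κ3 _ s2 h0
      linarith
    · have k : χ p = 1 + slf A K (-1) p.1 p.2 0 := κ2 _ s2 h0
      have sub : Icc p.1 0 ⊆ Icc (-1:ℝ) 0 := Icc_subset_Icc_left hp.1.1.1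
      have := cross_sep S h1 (s1.mono sub) (s2.mono sub) (by rw [slf_at S hp1 hp.1.1, slf_at S hm1 hp.1.1]) (by rw [slf_at S hp1 hp.1.1]; exact h')
      have e : ℓ p = slf A K 1 p.1 p.2 0 := rfl
      rw [k, e]; linarith
  have bds : ∀ p ∈ C, p ≠ 0 → ℓ p - M ≤ χ p ∧ χ p ≤ 1 + ℓ p := by
    intro p hp hne
    rcases tri p hp with h | h | h | h
    · exact absurd h hne
    · exact ⟨(fpos p hp h.2).le, (fax p hp h.1 h.2).le⟩
    · exact ⟨(fpos p hp h.2).le, (fup p hp h.1).le⟩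
    · exact ⟨(fd p hp h.1 h.2).ge, (fup p hp h.1).le⟩
  have Θ0 : Θ 0 = 0 := by
    have : ℓ 0 = 0 := ℓ0 0
    simp only [hΘ, this, zero_mul]; rfl
  have l0 : ℓ 0 = 0 := ℓ0 0
  have lnn : ∀ p ∈ C, 0 ≤ ℓ p := fun p hp => by
    by_cases h : p = 0
    · rw [h, l0]
    · exact (ℓpos p hp h).le
  have χc : ∀ p ∈ C, p ≠ 0 → ContinuousWithinAt χ strip p := by
    intro p hp hne
    have : p.1 ≠ 0 ∨ p.2 ≠ 0 := by
      by_contra hc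
      push Not at hc
      exact hne (Prod.ext hc.1 hc.2)
    exact κc.continuousAt.comp_continuousWithinAt (lab_cont S hm1 hI (Or.inl hXn) hp.1.1 (by tauto))
  have hsub : C ⊆ strip := fun p hp => hp.1.1
  have noinj : ∀ p ∈ C, ∀ q ∈ C, q ≠ 0 → p ≠ 0 → ℓ p = ℓ q → χ p = χ q → ¬ p.1 < q.1 := by
    intro p hp q hq hq0 hp0 h1 h2 hlt
    have hx : p.1 < 0 := hlt.trans_le hq.1.1.2
    have s1 := slf_sol S hp1 hp.1.1 p.2
    have s2 := slf_sol S hm1 hp.1.1 p.2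
    have e1 : slf A K 1 p.1 p.2 q.1 = q.2 := by
      rw [sol_uniq S hp1 s1 (slf_sol S hp1 hq.1.1 q.2) z0I h1 (by simp) q.1 hq.1.1, slf_at S hp1 hq.1.1]
    have e2 : slf A K (-1) p.1 p.2 q.1 = q.2 := by
      rw [sol_uniq S hm1 s2 (slf_sol S hm1 hq.1.1 q.2) hI (κm.injective h2) (Or.inl hXn) q.1 hq.1.1, slf_at S hm1 hq.1.1]
    have sub : Icc p.1 q.1 ⊆ Icc (-1:ℝ) 0 := Icc_subset_Icc hp.1.1.1 hq.1.1.2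
    rcases eq_or_lt_of_le hq.1.2.1 with h' | h'
    · have hq1 : q.1 < 0 := by
        apply lt_of_le_of_ne hq.1.1.2
        intro h; exact hq0 (Prod.ext h h'.symm)
      have := neg_back S s1 hq.1.1 hq1 (by rw [e1]; exact h'.ge) p.1 ⟨hp.1.1.1, hlt⟩
      rw [slf_at S hp1 hp.1.1] at this
      linarith [hp.1.2.1]
    · have := cross_back S hlt (s1.mono sub) (s2.mono sub) (by rw [e1, e2]) (by rw [e1]; exact h')
      rw [slf_at S hp1 hp.1.1, slf_at S hm1 hp.1.1] at this
      exact lt_irrefl _ this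
  refine ⟨C, Θ, ?_, ?_, ?_, ?_, ?_, ?_, ?_, ?_, ?_, ?_, ?_, ?_⟩
  · have hc : IsCompact (Icc (-1:ℝ) 0 ×ˢ Icc (0:ℝ) (M + L + 2)) := isCompact_Icc.prod isCompact_Icc
    have := (hlc.mono (fun p (hp : p ∈ Icc (-1:ℝ) 0 ×ˢ Icc (0:ℝ) (M + L + 2)) => hp.1)).preimage_isClosed_of_isClosed hc.isClosed (isClosed_Iic (a := M))
    exact hc.of_isClosed_subset this inter_subset_left
  · exact fun p hp => ⟨hp.1.1, hp.1.2.1⟩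
  · have hQ : {p : ℝ × ℝ | p.1 ≤ 0 ∧ 0 ≤ p.2} ∩ (Ioi (-1) ×ˢ Iio (M + L+2)) ⊆ Icc (-1:ℝ) 0 ×ˢ Icc (0:ℝ) (M + L + 2) := by
      rintro p ⟨⟨h3, h4⟩, h1, h2⟩
      exact ⟨⟨le_of_lt h1, h3⟩, h4, le_of_lt h2⟩
    have hO : (Ioi (-1) ×ˢ Iio (M + L+2) : Set (ℝ × ℝ)) ∈ 𝓝 0 := (isOpen_Ioi.prod isOpen_Iio).mem_nhds ⟨by norm_num, by simp; linarith⟩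
    have h1 : Icc (-1:ℝ) 0 ×ˢ Icc (0:ℝ) (M + L + 2) ∈ 𝓝[{p : ℝ × ℝ | p.1 ≤ 0 ∧ 0 ≤ p.2}] 0 :=
      mem_of_superset (inter_mem self_mem_nhdsWithin (mem_nhdsWithin_of_mem_nhds hO)) hQ
    have h2 : ∀ᶠ p in 𝓝[strip] 0, ℓ p < M := (hlc 0 z0I).eventually (gt_mem_nhds (by rw [l0]; exact hM0))
    rw [eventually_nhdsWithin_iff] at h2
    filter_upwards [h1, mem_nhdsWithin_of_mem_nhds h2] with p hp hp2
    exact ⟨hp, (hp2 hp.1).le⟩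
  · intro p hp
    by_cases h : p = 0
    · subst h
      refine ((hlc 0 z0I).mono hsub).prodMk ?_
      have : Tendsto (fun p => ℓ p * χ p) (𝓝[C] 0) (𝓝 0) := by
        have hl : Tendsto (fun p => ℓ p * (1 + M)) (𝓝[C] 0) (𝓝 0) := by
          have : Tendsto ℓ (𝓝[C] 0) (𝓝 (ℓ 0)) := (hlc 0 z0I).mono hsub
          rw [l0] at this
          simpa using this.mul_const (1 + M)
        apply squeeze_zero_norm' _ hl
        filter_upwards [self_mem_nhdsWithin] with q hq
        by_cases h : q = 0
        · rw [h, l0]; simp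
        · have := bds q hq h
          have l1 := lnn q hq
          have l2 := hq.2
          rw [Real.norm_eq_abs, abs_mul, abs_of_nonneg l1]
          gcongr
          rw [abs_le]; constructor <;> linarith
      show Tendsto _ _ (𝓝 (ℓ 0 * χ 0))
      rw [l0, zero_mul]
      exact this
    · exact ((hlc p hp.1.1).mono hsub).prodMk (((hlc p hp.1.1).mono hsub).mul ((χc p hp h).mono hsub))
  · intro p hp q hq h
    have h1 : ℓ p = ℓ q := congrArg Prod.fst h
    by_cases p0 : p = 0
    · by_contra hne
      have := ℓpos q hq (by rintro rfl; exact hne p0)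
      rw [← h1, p0, l0] at this; linarith
    by_cases q0 : q = 0
    · have := ℓpos p hp p0
      rw [h1, q0, l0] at this; linarith
    have h2 : χ p = χ q := by
      have : ℓ p * χ p = ℓ q * χ q := congrArg Prod.snd h
      rw [← h1] at this
      exact mul_left_cancel₀ (ℓpos p hp p0).ne' this
    have hx : p.1 = q.1 := le_antisymm (not_lt.1 (noinj q hq p hp p0 q0 h1.symm h2.symm)) (not_lt.1 (noinj p hp q hq q0 p0 h1 h2))
    have e1 : slf A K 1 p.1 p.2 q.1 = q.2 := by
      rw [sol_uniq S hp1 (slf_sol S hp1 hp.1.1 p.2) (slf_sol S hp1 hq.1.1 q.2) z0I h1 (by simp) q.1 hq.1.1, slf_at S hp1 hq.1.1]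
    rw [← hx, slf_at S hp1 hp.1.1] at e1
    exact Prod.ext hx e1
  · exact Θ0
  · intro p hp
    by_cases h : p = 0
    · rw [h, Θ0]; simp [nT]
    · have b := bds p hp h
      have l := lnn p hp
      exact ⟨l, mul_le_mul_of_nonneg_left b.1 l, mul_le_mul_of_nonneg_left b.2 l⟩
  · rw [mem_nhdsWithin]
    refine ⟨Iio M ×ˢ univ, isOpen_Iio.prod isOpen_univ, ⟨by simpa using hM0, trivial⟩, ?_⟩
    rintro q ⟨⟨q1, -⟩, q2, q3, q4⟩
    replace q1 : q.1 < M := q1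
    have zC : (0:ℝ × ℝ) ∈ C := ⟨⟨z0I, le_refl _, by show (0:ℝ) ≤ _; linarith⟩, by rw [l0]; exact hM0.le⟩
    rcases eq_or_lt_of_le q2 with h0 | h0
    · refine ⟨0, zC, ?_⟩
      rw [Θ0]
      rw [← h0] at q3 q4
      exact Prod.ext h0 (by show 0 = q.2; linarith)
    set u := q.1
    set ψ := slf A K 1 0 u
    have s1 : Sol A K 1 ψ := slf_sol S hp1 z0I u
    have e0 : ψ 0 = u := slf_at S hp1 z0I u
    have hle : ψ (-X) ≤ 0 := by
      by_contra hc
      have := hMψ _ s1 (not_le.1 hc)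
      linarith
    obtain ⟨a, ha, ha0⟩ := intermediate_value_Icc hI.2 (s1.cont.mono (Icc_subset_Icc_left hI.1)) (show (0:ℝ) ∈ Icc _ _ from ⟨hle, by rw [e0]; exact h0.le⟩)
    have hal : a < 0 := lt_of_le_of_ne ha.2 (by rintro rfl; linarith)
    have haI : a ∈ Icc (-1:ℝ) 0 := ⟨hI.1.trans ha.1, ha.2⟩
    have hnn := (pos_stay S s1 haI ha0.ge)
    have hyI : ∀ y ∈ Icc a 0, y ∈ Icc (-1:ℝ) 0 := fun y hy => ⟨haI.1.trans hy.1, hy.2⟩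
    have hℓ' : ∀ y ∈ Icc a 0, ℓ (y, ψ y) = u := fun y hy => by
      rw [hℓ, lab_eq S hp1 s1 (hyI y hy) z0I rfl (by simp), e0]
    have hyC : ∀ y ∈ Icc a 0, (y, ψ y) ∈ C := by
      intro y hy
      refine ⟨⟨hyI y hy, hnn.1 y hy, ?_⟩, by rw [hℓ' y hy]; exact q1.le⟩
      have h := lip_of_deriv (B := L + 2) (fun x hx => s1 x hx) (fun x hx => FF_bound S hp1 x (ψ x)) (hyI y hy) z0I
      rw [e0] at h
      have h3 := (abs_le.1 h).2
      have h4 : |y - 0| ≤ 1 := by rw [abs_le]; constructor <;> linarith [(hyI y hy).1, hy.2]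
      have h5 : (L + 2) * |y - 0| ≤ (L + 2) * 1 := by gcongr
      show ψ y ≤ M + L + 2
      linarith
    have hyn : ∀ y ∈ Icc a 0, (y, ψ y) ≠ (0 : ℝ × ℝ) := by
      intro y hy h
      have := hℓ' y hy
      rw [h, l0] at this
      linarith
    have cc : ContinuousOn (fun y => χ (y, ψ y)) (Icc a 0) := by
      intro y hy
      have hcy : ContinuousWithinAt ψ (Icc a 0) y := s1.cont.mono (fun y hy => hyI y hy) y hy
      exact (χc _ (hyC y hy) (hyn y hy)).comp (f := fun y => (y, ψ y)) (continuousWithinAt_id.prodMk hcy) (fun y hy => hyI y hy)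
    have aI : a ∈ Icc a 0 := ⟨le_refl _, hal.le⟩
    have oI : (0:ℝ) ∈ Icc a 0 := ⟨hal.le, le_refl _⟩
    have ca := fd _ (hyC a aI) hal ha0
    have co := fax _ (hyC 0 oI) rfl (by simp only [e0]; exact h0)
    rw [hℓ' a aI] at ca
    rw [hℓ' 0 oI] at co
    obtain ⟨y, hy, hyq⟩ := intermediate_value_Icc hal.le cc (show q.2 / u ∈ Icc _ _ from ⟨by
      show χ (a, ψ a) ≤ _
      rw [ca, le_div_iff₀ h0, mul_comm]; exact q3, by
      show _ ≤ χ (0, ψ 0)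
      rw [co, div_le_iff₀ h0, mul_comm]; exact q4⟩)
    refine ⟨_, hyC y hy, ?_⟩
    simp only [hΘ]
    rw [hℓ' y hy]
    have : χ (y, ψ y) = q.2 / u := hyq
    rw [this]
    exact Prod.ext rfl (by field_simp)
  · intro σ hσ p hp q hq hp0 hq0
    have pn : p ≠ 0 := by rintro rfl; exact lt_irrefl _ hp0
    have qn : q ≠ 0 := by rintro rfl; exact lt_irrefl _ hq0
    rcases hσ with rfl | rfl
    · rw [lab_iff S hp1 z0I (by simp) hp.1.1 hq.1.1 hp0 hq0]
      simp [nτ, hΘ, hℓ]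
    · rw [lab_iff S hm1 hI (Or.inl hXn) hp.1.1 hq.1.1 hp0 hq0]
      have h1 := (ℓpos p hp pn).ne'
      have h2 := (ℓpos q hq qn).ne'
      have : (-1:ℝ) ≠ 1 := by norm_num
      simp only [nτ, hΘ, this, if_false]
      rw [mul_div_cancel_left₀ _ h1, mul_div_cancel_left₀ _ h2]
      exact κm.injective.eq_iff.symm
  · intro p hp
    rcases tri p hp with h | h | h | h
    · rw [h, Θ0]; simp [nTax]
    · simp only [nTax, hΘ, mem_ofPred_eq, fax p hp h.1 h.2, h.1]
    · have l := ℓpos p hp (by rintro rfl; exact lt_irrefl _ h.1)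
      simp only [nTax, hΘ, mem_ofPred_eq]
      exact ⟨fun h' => by linarith [h.1], fun h' => absurd (mul_left_cancel₀ l.ne' h') (fup p hp h.1).ne⟩
    · have l := ℓpos p hp (by rintro rfl; exact lt_irrefl _ h.1)
      simp only [nTax, hΘ, mem_ofPred_eq]
      exact ⟨fun h' => by linarith [h.1], fun h' => absurd (mul_left_cancel₀ l.ne' h') (fup p hp h.1).ne⟩
  · intro p hp h
    have : p = (0, p.2) := Prod.ext h rfl
    show ℓ p = p.2
    rw [this, ℓ0]
  · intro p hp
    rcases tri p hp with h | h | h | h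
    · rw [h, Θ0]; simp [nTd]
    · have l := ℓpos p hp (by rintro rfl; exact lt_irrefl _ h.2)
      simp only [nTd, hΘ, mem_ofPred_eq]
      exact ⟨fun h' => by linarith [h.2], fun h' => absurd (mul_left_cancel₀ l.ne' h') (fpos p hp h.2).ne'⟩
    · have l := ℓpos p hp (by rintro rfl; exact lt_irrefl _ h.1)
      simp only [nTd, hΘ, mem_ofPred_eq]
      exact ⟨fun h' => by linarith [h.2], fun h' => absurd (mul_left_cancel₀ l.ne' h') (fpos p hp h.2).ne'⟩
    · simp only [nTd, hΘ, mem_ofPred_eq, fd p hp h.1 h.2, h.2]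

end PartSix

section PartSeven
open Topology
variable {A K A' K' : ℝ → ℝ → ℝ} {L L' s σ : ℝ} {T Tax Td : Set (ℝ × ℝ)} {τ : ℝ → ℝ × ℝ → ℝ} {C C' : Set (ℝ × ℝ)} {Θ Θ' : ℝ × ℝ → ℝ × ℝ}

def QQ : Set (ℝ × ℝ) := {p | p.1 ≤ 0 ∧ 0 ≤ p.2}

structure LHo (A K A' K' : ℝ → ℝ → ℝ) (U V : Set (ℝ × ℝ)) (h h' : ℝ × ℝ → ℝ × ℝ) : Prop where
  oU : IsOpen U
  zU : (0 : ℝ × ℝ) ∈ U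
  c : ContinuousOn h (U ∩ QQ)
  m : MapsTo h (U ∩ QQ) (V ∩ QQ)
  li : ∀ p ∈ U ∩ QQ, h' (h p) = p
  ax : ∀ p ∈ U ∩ QQ, p.1 = 0 → h p = p
  neg : ∀ p ∈ U ∩ QQ, p.1 < 0 → (h p).1 < 0
  disc : ∀ p ∈ U ∩ QQ, p.2 = 0 → (h p).2 = 0
  box : ∀ p ∈ U ∩ QQ, -1 ≤ p.1
  sol : ∀ σ : ℝ, (σ = 1 ∨ σ = -1) → ∀ ξ, Sol A K σ ξ → ∃ ξ', Sol A' K' σ ξ' ∧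
    ∀ p ∈ U ∩ QQ, p.1 < 0 → p.2 = ξ p.1 → (h p).2 = ξ' (h p).1

lemma invFunOn_cont (hC : IsCompact C) (hc : ContinuousOn Θ C) (hi : InjOn Θ C) : ContinuousOn (Function.invFunOn Θ C) (Θ '' C) := by
  rw [continuousOn_iff_isClosed]
  intro F hF
  refine ⟨Θ '' (C ∩ F), ((hC.inter_right hF).image_of_continuousOn (hc.mono inter_subset_left)).isClosed, ?_⟩
  ext q
  constructor
  · rintro ⟨h1, p, hp, rfl⟩
    rw [mem_preimage, hi.leftInvOn_invFunOn hp] at h1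
    exact ⟨⟨p, ⟨hp, h1⟩, rfl⟩, p, hp, rfl⟩
  · rintro ⟨⟨p, ⟨hp, h1⟩, rfl⟩, -⟩
    exact ⟨by rw [mem_preimage, hi.leftInvOn_invFunOn hp]; exact h1, p, hp, rfl⟩

lemma Chart.zmem (ch : Chart A K T Tax Td τ C Θ) : (0 : ℝ × ℝ) ∈ C := mem_of_mem_nhdsWithin (by simp) ch.nb

lemma Chart.small (ch : Chart A K T Tax Td τ C Θ) {O : Set (ℝ × ℝ)} (hO : IsOpen O) (h0 : (0 : ℝ × ℝ) ∈ O) : Θ '' (C ∩ O) ∈ 𝓝[T] 0 := by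
  have h1 : IsCompact (Θ '' (C \ O)) := (ch.cpt.diff hO).image_of_continuousOn (ch.con.mono sdiff_subset)
  have h2 : (Θ '' (C \ O))ᶜ ∈ 𝓝 (0 : ℝ × ℝ) := by
    apply h1.isClosed.isOpen_compl.mem_nhds
    rintro ⟨p, hp, hp0⟩
    have : p = 0 := ch.inj hp.1 ch.zmem (by rw [hp0, ch.zero])
    exact hp.2 (this ▸ h0)
  filter_upwards [ch.img, mem_nhdsWithin_of_mem_nhds h2] with q hq hq2
  obtain ⟨p, hp, rfl⟩ := hq
  refine ⟨p, ⟨hp, ?_⟩, rfl⟩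
  by_contra hc
  exact hq2 ⟨p, ⟨hp, hc⟩, rfl⟩

lemma lh_one (S : Sys A K L s) (S' : Sys A' K' L' s) (ch : Chart A K T Tax Td τ C Θ) (ch' : Chart A' K' T Tax Td τ C' Θ')
    {O O' W U V : Set (ℝ × ℝ)} (oU : IsOpen U) (h0O : (0 : ℝ × ℝ) ∈ O)
    (hOC : O ∩ QQ ⊆ C) (h0W : (0 : ℝ × ℝ) ∈ W) (hW' : W ∩ T ⊆ Θ' '' (C' ∩ O'))
    (hU : ∀ p ∈ QQ, p ∈ U ↔ p ∈ O ∧ Θ p ∈ W) (hV : ∀ p ∈ QQ, p ∈ V ↔ p ∈ O' ∧ Θ' p ∈ W) :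
    LHo A K A' K' U V (fun p => Function.invFunOn Θ' C' (Θ p)) (fun p => Function.invFunOn Θ C (Θ' p)) := by
  set h := fun p => Function.invFunOn Θ' C' (Θ p)
  have hUC : ∀ p ∈ U ∩ QQ, p ∈ C := fun p hp => hOC ⟨((hU p hp.2).1 hp.1).1, hp.2⟩
  have hex : ∀ p ∈ U ∩ QQ, h p ∈ C' ∧ Θ' (h p) = Θ p ∧ h p ∈ V ∩ QQ := by
    intro p hp
    obtain ⟨p', hp', he⟩ := hW' ⟨((hU p hp.2).1 hp.1).2, ch.mapsT (hUC p hp)⟩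
    have e : h p = p' := by simp only [h]; rw [← he, ch'.inj.leftInvOn_invFunOn hp'.1]
    have hq : p' ∈ QQ := ⟨(ch'.sub p' hp'.1).1.2, (ch'.sub p' hp'.1).2⟩
    rw [e]
    exact ⟨hp'.1, he, (hV p' hq).2 ⟨hp'.2, by rw [he]; exact ((hU p hp.2).1 hp.1).2⟩, hq⟩
  have hneg : ∀ p ∈ U ∩ QQ, p.1 < 0 → (h p).1 < 0 := by
    intro p hp hx
    have h1 := hex p hp
    apply lt_of_le_of_ne h1.2.2.2.1
    intro h2
    rw [ch'.ax _ h1.1, h1.2.1, ← ch.ax _ (hUC p hp)] at h2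
    linarith
  constructor
  · exact oU
  · rw [hU 0 (by simp [QQ]), ch.zero]; exact ⟨h0O, h0W⟩
  · apply (invFunOn_cont ch'.cpt ch'.con ch'.inj).comp (ch.con.mono hUC)
    intro p hp
    obtain ⟨p', hp', he⟩ := hW' ⟨((hU p hp.2).1 hp.1).2, ch.mapsT (hUC p hp)⟩
    exact ⟨p', hp'.1, he⟩
  · intro p hp; exact (hex p hp).2.2
  · intro p hp
    show Function.invFunOn Θ C (Θ' (h p)) = p
    rw [(hex p hp).2.1, ch.inj.leftInvOn_invFunOn (hUC p hp)]
  · intro p hp hx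
    have h1 := hex p hp
    have h2 : (h p).1 = 0 := by rw [ch'.ax _ h1.1, h1.2.1, ← ch.ax _ (hUC p hp)]; exact hx
    have h3 := ch'.ax1 _ h1.1 h2
    rw [h1.2.1, ch.ax1 _ (hUC p hp) hx] at h3
    exact Prod.ext (h2.trans hx.symm) h3.symm
  · exact hneg
  · intro p hp hz
    have h1 := hex p hp
    rw [ch'.dc _ h1.1, h1.2.1, ← ch.dc _ (hUC p hp)]; exact hz
  · intro p hp; exact (ch.sub p (hUC p hp)).1.1
  · intro σ hσ ξ hξ
    by_cases hne : ∃ p ∈ U ∩ QQ, p.1 < 0 ∧ p.2 = ξ p.1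
    · obtain ⟨p, hp, hx, hz⟩ := hne
      have h1 := hex p hp
      obtain ⟨ξ', hξ', he⟩ := exists_sol S' hσ (ch'.sub _ h1.1).1 (h p).2
      refine ⟨ξ', hξ', fun q hq hqx hqz => ?_⟩
      have h2 := hex q hq
      have e := (ch.lab σ hσ p (hUC p hp) q (hUC q hq) hx hqx).1 ⟨ξ, hξ, hz.symm, hqz.symm⟩
      rw [← h1.2.1, ← h2.2.1] at e
      obtain ⟨ξ'', k1, k2, k3⟩ := (ch'.lab σ hσ _ h1.1 _ h2.1 (hneg p hp hx) (hneg q hq hqx)).2 e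
      rw [← k3]
      exact sol_uniq S' hσ k1 hξ' (ch'.sub _ h1.1).1 (by rw [k2, he]) (Or.inl (hneg p hp hx).ne) _ (ch'.sub _ h2.1).1
    · obtain ⟨ξ', hξ', he⟩ := exists_sol S' hσ z0I 0
      refine ⟨ξ', hξ', fun q hq hqx hqz => absurd ⟨q, hq, hqx, hqz⟩ hne⟩

lemma pull_open (hc : ContinuousOn Θ C) {O W : Set (ℝ × ℝ)} (hO : IsOpen O) (hOC : O ∩ QQ ⊆ C) (hW : IsOpen W) :
    ∃ U, IsOpen U ∧ ∀ p ∈ QQ, p ∈ U ↔ p ∈ O ∧ Θ p ∈ W := by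
  obtain ⟨u, hu, he⟩ := (continuousOn_iff'.1 (hc.mono hOC)) W hW
  refine ⟨u ∩ O, hu.inter hO, fun p hp => ?_⟩
  have := Set.ext_iff.1 he p
  simp only [mem_inter_iff, mem_preimage] at this ⊢
  tauto

theorem lh_exists (S : Sys A K L s) (S' : Sys A' K' L' s) (ch : Chart A K T Tax Td τ C Θ) (ch' : Chart A' K' T Tax Td τ C' Θ') :
    ∃ U V h h', LHo A K A' K' U V h h' ∧ LHo A' K' A K V U h' h := by
  obtain ⟨O, hO, h0O, hOC⟩ := mem_nhdsWithin.1 ch.nb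
  obtain ⟨O', hO', h0O', hOC'⟩ := mem_nhdsWithin.1 ch'.nb
  obtain ⟨W, hW, h0W, hWT⟩ := mem_nhdsWithin.1 (inter_mem (ch.small hO h0O) (ch'.small hO' h0O'))
  obtain ⟨U, oU, hU⟩ := pull_open ch.con hO hOC hW
  obtain ⟨V, oV, hV⟩ := pull_open ch'.con hO' hOC' hW
  exact ⟨U, V, _, _, lh_one S S' ch ch' oU h0O hOC h0W (fun p hp => (hWT hp).2) hU hV,
    lh_one S' S ch' ch oV h0O' hOC' h0W (fun p hp => (hWT hp).1) hV hU⟩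

theorem lh_sys (S : Sys A K L s) (S' : Sys A' K' L' s) : ∃ U V h h', LHo A K A' K' U V h h' ∧ LHo A' K' A K V U h' h := by
  rcases S.hs with rfl | rfl
  · obtain ⟨C, Θ, ch⟩ := saddle_chart S
    obtain ⟨C', Θ', ch'⟩ := saddle_chart S'
    exact lh_exists S S' ch ch'
  · obtain ⟨M, hM, h⟩ := node_chart S
    obtain ⟨M', hM', h'⟩ := node_chart S'
    have : 0 < min M M' / 2 := by positivity
    have e1 : min M M' / 2 < M := by linarith [min_le_left M M', lt_min hM hM']
    have e2 : min M M' / 2 < M' := by linarith [min_le_right M M', lt_min hM hM']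
    obtain ⟨C, Θ, ch⟩ := h _ this e1
    obtain ⟨C', Θ', ch'⟩ := h' _ this e2
    exact lh_exists S S' ch ch'

end PartSeven

section PartEight
open Topology
variable {A K A' K' : ℝ → ℝ → ℝ} {L L' s σ : ℝ}

structure GH (A K A' K' : ℝ → ℝ → ℝ) (U V : Set (ℝ × ℝ)) (h h' : ℝ × ℝ → ℝ × ℝ) : Prop where
  oU : IsOpen U
  zU : (0 : ℝ × ℝ) ∈ U
  c : ContinuousOn h U
  m : MapsTo h U V
  li : ∀ p ∈ U, h' (h p) = p
  ax : ∀ p ∈ U, p.1 = 0 → h p = p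
  neg : ∀ p ∈ U, p.1 < 0 → (h p).1 < 0
  pos : ∀ p ∈ U, 0 < p.1 → 0 < (h p).1
  znn : ∀ p ∈ U, 0 ≤ p.2 → 0 ≤ (h p).2
  zle : ∀ p ∈ U, p.2 ≤ 0 → (h p).2 = p.2
  box : ∀ p ∈ U, p.1 ∈ Icc (-1:ℝ) 1
  solL : ∀ σ : ℝ, (σ = 1 ∨ σ = -1) → ∀ ξ, Sol A K σ ξ → ∃ ξ', Sol A' K' σ ξ' ∧
    ∀ p ∈ U, p.1 < 0 → 0 ≤ p.2 → p.2 = ξ p.1 → (h p).2 = ξ' (h p).1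
  solR : ∀ σ : ℝ, (σ = 1 ∨ σ = -1) → ∀ ξ, Sol (rA A) (rK K) σ ξ → ∃ ξ', Sol (rA A') (rK K') σ ξ' ∧
    ∀ p ∈ U, 0 < p.1 → 0 ≤ p.2 → p.2 = ξ (-p.1) → (h p).2 = ξ' (-(h p).1)

open Classical in
def glue (hL hR : ℝ × ℝ → ℝ × ℝ) (p : ℝ × ℝ) : ℝ × ℝ :=
  if p.1 ≤ 0 then ((hL (p.1, max p.2 0)).1, (hL (p.1, max p.2 0)).2 + min p.2 0)
  else (-(hR (-p.1, max p.2 0)).1, (hR (-p.1, max p.2 0)).2 + min p.2 0)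

def glueU (UL UR : Set (ℝ × ℝ)) : Set (ℝ × ℝ) :=
  {p | (p.1 ≤ 0 → (p.1, max p.2 0) ∈ UL) ∧ (0 ≤ p.1 → (-p.1, max p.2 0) ∈ UR)}

lemma glueU_open {UL UR : Set (ℝ × ℝ)} (h1 : IsOpen UL) (h2 : IsOpen UR) : IsOpen (glueU UL UR) := by
  rw [← isClosed_compl_iff]
  have : (glueU UL UR)ᶜ = ({p | p.1 ≤ 0} ∩ (fun p : ℝ × ℝ => (p.1, max p.2 0)) ⁻¹' ULᶜ) ∪
    ({p | 0 ≤ p.1} ∩ (fun p : ℝ × ℝ => (-p.1, max p.2 0)) ⁻¹' URᶜ) := by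
    ext p; simp only [glueU, mem_compl_iff, mem_ofPred_eq, mem_union, mem_inter_iff, mem_preimage]; tauto
  rw [this]
  exact ((isClosed_le continuous_fst continuous_const).inter (h1.isClosed_compl.preimage (by fun_prop))).union
    ((isClosed_le continuous_const continuous_fst).inter (h2.isClosed_compl.preimage (by fun_prop)))

lemma glue_one {UL VL UR VR : Set (ℝ × ℝ)} {hL hL' hR hR' : ℝ × ℝ → ℝ × ℝ}
    (l : LHo A K A' K' UL VL hL hL') (r : LHo (rA A) (rK K) (rA A') (rK K') UR VR hR hR') :
    GH A K A' K' (glueU UL UR) (glueU VL VR) (glue hL hR) (glue hL' hR') := by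
  have pl : ∀ p ∈ glueU UL UR, p.1 ≤ 0 → (p.1, max p.2 0) ∈ UL ∩ QQ := fun p hp h => ⟨hp.1 h, h, le_max_right _ _⟩
  have pr : ∀ p ∈ glueU UL UR, 0 ≤ p.1 → (-p.1, max p.2 0) ∈ UR ∩ QQ := fun p hp h => ⟨hp.2 h, by simpa using h, le_max_right _ _⟩
  have el : ∀ p : ℝ × ℝ, p.1 ≤ 0 → glue hL hR p = ((hL (p.1, max p.2 0)).1, (hL (p.1, max p.2 0)).2 + min p.2 0) := fun p h => if_pos h
  have mm : ∀ x : ℝ, max x 0 + min x 0 = x := fun x => by rw [max_add_min]; ring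
  have er : ∀ p ∈ glueU UL UR, 0 ≤ p.1 → glue hL hR p = (-(hR (-p.1, max p.2 0)).1, (hR (-p.1, max p.2 0)).2 + min p.2 0) := by
    intro p hp h
    rcases eq_or_lt_of_le h with h0 | h0
    · rw [el p h0.ge, l.ax _ (pl p hp h0.ge) h0.symm, r.ax _ (pr p hp h) (by simp [← h0])]
      simp [← h0]
    · exact if_neg (not_le.2 h0)
  have zz : ∀ {q : ℝ × ℝ} {z : ℝ}, 0 ≤ q.2 → (z ≤ 0 → q.2 = 0) → max (q.2 + min z 0) 0 = q.2 ∧ min (q.2 + min z 0) 0 = min z 0 := by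
    intro q z h1 h2
    rcases le_total z 0 with h | h
    · rw [h2 h, min_eq_left h]; simp [h]
    · rw [min_eq_right h]; simp [h1]
  have zl : ∀ p ∈ glueU UL UR, p.1 ≤ 0 → 0 ≤ (hL (p.1, max p.2 0)).2 ∧ (p.2 ≤ 0 → (hL (p.1, max p.2 0)).2 = 0) := by
    intro p hp h
    exact ⟨(l.m (pl p hp h)).2.2, fun h0 => l.disc _ (pl p hp h) (max_eq_right h0)⟩
  have zr : ∀ p ∈ glueU UL UR, 0 ≤ p.1 → 0 ≤ (hR (-p.1, max p.2 0)).2 ∧ (p.2 ≤ 0 → (hR (-p.1, max p.2 0)).2 = 0) := by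
    intro p hp h
    exact ⟨(r.m (pr p hp h)).2.2, fun h0 => r.disc _ (pr p hp h) (max_eq_right h0)⟩
  have cl : ContinuousOn (glue hL hR) (glueU UL UR ∩ {p | p.1 ≤ 0}) := by
    have : ContinuousOn (fun p : ℝ × ℝ => ((hL (p.1, max p.2 0)).1, (hL (p.1, max p.2 0)).2 + min p.2 0)) (glueU UL UR ∩ {p | p.1 ≤ 0}) := by
      have c1 : ContinuousOn (fun p : ℝ × ℝ => hL (p.1, max p.2 0)) (glueU UL UR ∩ {p | p.1 ≤ 0}) :=
        l.c.comp (by fun_prop) (fun p hp => pl p hp.1 hp.2)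
      exact (continuous_fst.comp_continuousOn c1).prodMk ((continuous_snd.comp_continuousOn c1).add (continuous_snd.min continuous_const).continuousOn)
    exact this.congr (fun p hp => el p hp.2)
  have cr : ContinuousOn (glue hL hR) (glueU UL UR ∩ {p | 0 ≤ p.1}) := by
    have : ContinuousOn (fun p : ℝ × ℝ => (-(hR (-p.1, max p.2 0)).1, (hR (-p.1, max p.2 0)).2 + min p.2 0)) (glueU UL UR ∩ {p | 0 ≤ p.1}) := by
      have c1 : ContinuousOn (fun p : ℝ × ℝ => hR (-p.1, max p.2 0)) (glueU UL UR ∩ {p | 0 ≤ p.1}) :=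
        r.c.comp (by fun_prop) (fun p hp => pr p hp.1 hp.2)
      exact (continuous_fst.comp_continuousOn c1).neg.prodMk ((continuous_snd.comp_continuousOn c1).add (continuous_snd.min continuous_const).continuousOn)
    exact this.congr (fun p hp => er p hp.1 hp.2)
  have hax : ∀ p ∈ glueU UL UR, p.1 = 0 → glue hL hR p = p := by
    intro p hp h
    rw [el p h.le, l.ax _ (pl p hp h.le) h]
    exact Prod.ext rfl (mm p.2)
  have hneg : ∀ p ∈ glueU UL UR, p.1 < 0 → (glue hL hR p).1 < 0 := by
    intro p hp h
    rw [el p h.le]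
    exact l.neg _ (pl p hp h.le) h
  have hpos : ∀ p ∈ glueU UL UR, 0 < p.1 → 0 < (glue hL hR p).1 := by
    intro p hp h
    rw [er p hp h.le]
    have := r.neg _ (pr p hp h.le) (by simpa using h)
    simp only; linarith
  constructor
  · exact glueU_open l.oU r.oU
  · exact ⟨fun _ => by show ((0:ℝ), max (0:ℝ) 0) ∈ UL; rw [max_self]; exact l.zU,
      fun _ => by show (-(0:ℝ), max (0:ℝ) 0) ∈ UR; rw [max_self, neg_zero]; exact r.zU⟩
  · intro p hp
    rcases lt_trichotomy p.1 0 with h | h | h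
    · apply (cl p ⟨hp, h.le⟩).mono_of_mem_nhdsWithin
      exact inter_mem self_mem_nhdsWithin (mem_nhdsWithin_of_mem_nhds (mem_of_superset ((isOpen_lt continuous_fst continuous_const).mem_nhds h) (fun q (hq : q.1 < 0) => hq.le)))
    · have := (cl p ⟨hp, h.le⟩).union (cr p ⟨hp, h.ge⟩)
      apply this.mono
      intro q hq
      rcases le_total q.1 0 with h | h
      · left; exact ⟨hq, h⟩
      · right; exact ⟨hq, h⟩
    · apply (cr p ⟨hp, h.le⟩).mono_of_mem_nhdsWithin
      exact inter_mem self_mem_nhdsWithin (mem_nhdsWithin_of_mem_nhds (mem_of_superset ((isOpen_lt continuous_const continuous_fst).mem_nhds h) (fun q (hq : 0 < q.1) => hq.le)))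
  · intro p hp
    constructor
    · intro h
      have h' : p.1 ≤ 0 := by by_contra hc; linarith [hpos p hp (not_le.1 hc)]
      rw [el p h']
      simp only
      rw [(zz (zl p hp h').1 (zl p hp h').2).1]
      exact (l.m (pl p hp h')).1
    · intro h
      have h' : 0 ≤ p.1 := by by_contra hc; linarith [hneg p hp (not_le.1 hc)]
      rw [er p hp h']
      simp only
      rw [(zz (zr p hp h').1 (zr p hp h').2).1, neg_neg]
      exact (r.m (pr p hp h')).1
  · intro p hp
    rcases le_or_gt p.1 0 with h | h
    · have h2 : (glue hL hR p).1 ≤ 0 := by rw [el p h]; exact (l.m (pl p hp h)).2.1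
      have e : glue hL' hR' (glue hL hR p) = ((hL' ((glue hL hR p).1, max (glue hL hR p).2 0)).1, (hL' ((glue hL hR p).1, max (glue hL hR p).2 0)).2 + min (glue hL hR p).2 0) := if_pos h2
      rw [e, el p h]
      simp only
      rw [(zz (zl p hp h).1 (zl p hp h).2).1, (zz (zl p hp h).1 (zl p hp h).2).2, Prod.mk.eta, l.li _ (pl p hp h)]
      exact Prod.ext rfl (mm p.2)
    · have h2 : ¬ (glue hL hR p).1 ≤ 0 := not_le.2 (hpos p hp h)
      have e : glue hL' hR' (glue hL hR p) = (-(hR' (-(glue hL hR p).1, max (glue hL hR p).2 0)).1, (hR' (-(glue hL hR p).1, max (glue hL hR p).2 0)).2 + min (glue hL hR p).2 0) := if_neg h2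
      rw [e, er p hp h.le]
      simp only
      rw [(zz (zr p hp h.le).1 (zr p hp h.le).2).1, (zz (zr p hp h.le).1 (zr p hp h.le).2).2, neg_neg, Prod.mk.eta, r.li _ (pr p hp h.le)]
      exact Prod.ext (neg_neg _) (mm p.2)
  · exact hax
  · exact hneg
  · exact hpos
  · intro p hp h0
    rcases le_total p.1 0 with h | h
    · rw [el p h, min_eq_right h0]; simpa using (zl p hp h).1
    · rw [er p hp h, min_eq_right h0]; simpa using (zr p hp h).1
  · intro p hp h0
    rcases le_total p.1 0 with h | h
    · rw [el p h, min_eq_left h0]; simpa using (zl p hp h).2 h0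
    · rw [er p hp h, min_eq_left h0]; simpa using (zr p hp h).2 h0
  · intro p hp
    rcases le_total p.1 0 with h | h
    · have := l.box _ (pl p hp h); exact ⟨this, by linarith⟩
    · have := r.box _ (pr p hp h); simp only at this; exact ⟨by linarith, by linarith⟩
  · intro σ hσ ξ hξ
    obtain ⟨ξ', h1, h2⟩ := l.sol σ hσ ξ hξ
    refine ⟨ξ', h1, fun p hp hx hz he => ?_⟩
    rw [el p hx.le, min_eq_right hz]
    simp only [add_zero]
    exact h2 _ (pl p hp hx.le) hx (by simpa [max_eq_left hz] using he)
  · intro σ hσ ξ hξ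
    obtain ⟨ξ', h1, h2⟩ := r.sol σ hσ ξ hξ
    refine ⟨ξ', h1, fun p hp hx hz he => ?_⟩
    rw [er p hp hx.le, min_eq_right hz]
    simp only [add_zero, neg_neg]
    exact h2 _ (pr p hp hx.le) (by simpa using hx) (by simpa [max_eq_left hz] using he)

theorem gh_sys (S : Sys A K L s) (S' : Sys A' K' L' s) : ∃ U V h h', GH A K A' K' U V h h' ∧ GH A' K' A K V U h' h := by
  obtain ⟨UL, VL, hL, hL', l, l'⟩ := lh_sys S S'
  obtain ⟨UR, VR, hR, hR', r, r'⟩ := lh_sys S.refl S'.refl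
  exact ⟨_, _, _, _, glue_one l r, glue_one l' r'⟩

/-- abstract arcs -/
structure PArc (A K : ℝ → ℝ → ℝ) (P : ℝ → ℝ × ℝ) (α β : ℝ) : Prop where
  c : ContinuousOn P (Ioo α β)
  i : InjOn (fun t => (P t).1) (Ioo α β)
  nn : ∀ t ∈ Ioo α β, 0 ≤ (P t).2
  sol : ∃ σL σR : ℝ, (σL = 1 ∨ σL = -1) ∧ (σR = 1 ∨ σR = -1) ∧ ∃ ξL ξR, Sol A K σL ξL ∧ Sol (rA A) (rK K) (-σR) ξR ∧
    (∀ t ∈ Ioo α β, (P t).1 < 0 → 0 < (P t).2 ∧ (P t).2 = ξL (P t).1) ∧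
    (∀ t ∈ Ioo α β, 0 < (P t).1 → 0 < (P t).2 ∧ (P t).2 = ξR (-(P t).1)) ∧
    (∀ t ∈ Ioo α β, (P t).1 = 0 → 0 < (P t).2 → σL = σR)

lemma PArc.map {U V : Set (ℝ × ℝ)} {h h' : ℝ × ℝ → ℝ × ℝ} (g : GH A K A' K' U V h h') (g' : GH A' K' A K V U h' h)
    {P : ℝ → ℝ × ℝ} {α β : ℝ} (hP : PArc A K P α β) (hU : MapsTo P (Ioo α β) U) : PArc A' K' (fun t => h (P t)) α β := by
  obtain ⟨σL, σR, hσL, hσR, ξL, ξR, sL, sR, eL, eR, e0⟩ := hP.sol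
  obtain ⟨ξL', sL', kL⟩ := g.solL σL hσL ξL sL
  obtain ⟨ξR', sR', kR⟩ := g.solR (-σR) (by rcases hσR with h | h <;> simp [h]) ξR sR
  have zpos : ∀ p ∈ U, 0 < p.2 → 0 < (h p).2 := by
    intro p hp h0
    apply lt_of_le_of_ne (g.znn p hp h0.le)
    intro he
    have := g'.zle _ (g.m hp) he.ge
    rw [g.li p hp] at this
    linarith
  have fL : ∀ t ∈ Ioo α β, (h (P t)).1 < 0 → (P t).1 < 0 := by
    intro t ht hx
    rcases lt_trichotomy (P t).1 0 with h1 | h1 | h1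
    · exact h1
    · rw [g.ax _ (hU ht) h1] at hx; exact hx
    · linarith [g.pos _ (hU ht) h1]
  have fR : ∀ t ∈ Ioo α β, 0 < (h (P t)).1 → 0 < (P t).1 := by
    intro t ht hx
    rcases lt_trichotomy (P t).1 0 with h1 | h1 | h1
    · linarith [g.neg _ (hU ht) h1]
    · rw [g.ax _ (hU ht) h1] at hx; exact hx
    · exact h1
  have f0 : ∀ t ∈ Ioo α β, (h (P t)).1 = 0 → (P t).1 = 0 := by
    intro t ht hx
    rcases lt_trichotomy (P t).1 0 with h1 | h1 | h1
    · linarith [g.neg _ (hU ht) h1]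
    · exact h1
    · linarith [g.pos _ (hU ht) h1]
  have EL : ∀ t ∈ Ioo α β, (h (P t)).1 < 0 → 0 < (h (P t)).2 ∧ (h (P t)).2 = ξL' (h (P t)).1 := by
    intro t ht hx
    have e := eL t ht (fL t ht hx)
    exact ⟨zpos _ (hU ht) e.1, kL _ (hU ht) (fL t ht hx) e.1.le e.2⟩
  have ER : ∀ t ∈ Ioo α β, 0 < (h (P t)).1 → 0 < (h (P t)).2 ∧ (h (P t)).2 = ξR' (-(h (P t)).1) := by
    intro t ht hx
    have e := eR t ht (fR t ht hx)
    exact ⟨zpos _ (hU ht) e.1, kR _ (hU ht) (fR t ht hx) e.1.le e.2⟩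
  constructor
  · exact g.c.comp hP.c hU
  · intro t ht u hu he
    simp only at he
    have key : (h (P t)).2 = (h (P u)).2 → t = u := by
      intro h2
      have h3 : h (P t) = h (P u) := Prod.ext he h2
      have h4 : P t = P u := by rw [← g.li _ (hU ht), h3, g.li _ (hU hu)]
      exact hP.i ht hu (congrArg Prod.fst h4)
    rcases lt_trichotomy (h (P t)).1 0 with h1 | h1 | h1
    · apply key; rw [(EL t ht h1).2, (EL u hu (he ▸ h1)).2, he]
    · exact hP.i ht hu (by simp only; rw [f0 t ht h1, f0 u hu (he ▸ h1)])
    · apply key; rw [(ER t ht h1).2, (ER u hu (he ▸ h1)).2, he]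
  · intro t ht; exact g.znn _ (hU ht) (hP.nn t ht)
  · refine ⟨σL, σR, hσL, hσR, ξL', ξR', sL', sR', EL, ER, ?_⟩
    intro t ht hx hz
    have h1 := f0 t ht hx
    rw [g.ax _ (hU ht) h1] at hz
    exact e0 t ht h1 hz

end PartEight

section PartNine
open Topology
variable {A K : ℝ → ℝ → ℝ} {L s σ : ℝ}

lemma img_open {X : ℝ → ℝ} {α β : ℝ} (c : ContinuousOn X (Ioo α β)) (i : InjOn X (Ioo α β)) : IsOpen (X '' Ioo α β) := by
  rw [isOpen_iff_mem_nhds]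
  rintro _ ⟨t, ht, rfl⟩
  obtain ⟨a, ha1, ha2⟩ := exists_between ht.1
  obtain ⟨b, hb1, hb2⟩ := exists_between ht.2
  have sub : Icc a b ⊆ Ioo α β := fun w hw => ⟨ha1.trans_le hw.1, hw.2.trans_lt hb2⟩
  have hab : a ≤ b := (ha2.trans hb1).le
  have h1 := (c.mono sub).strictMonoOn_of_injOn_Icc' hab (i.mono sub)
  have ma : a ∈ Icc a b := ⟨le_refl _, hab⟩
  have mb : b ∈ Icc a b := ⟨hab, le_refl _⟩
  have mt : t ∈ Icc a b := ⟨ha2.le, hb1.le⟩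
  rcases h1 with h1 | h1
  · refine mem_of_superset (Icc_mem_nhds (h1 ma mt ha2) (h1 mt mb hb1)) ?_
    exact (intermediate_value_Icc hab (c.mono sub)).trans (image_mono sub)
  · refine mem_of_superset (Icc_mem_nhds (h1 mt mb hb1) (h1 ma mt ha2)) ?_
    exact (intermediate_value_Icc' hab (c.mono sub)).trans (image_mono sub)

lemma ivl_inv {X : ℝ → ℝ} {α β : ℝ} (c : ContinuousOn X (Ioo α β)) (i : InjOn X (Ioo α β)) (b : ∀ t ∈ Ioo α β, X t ∈ Icc (-1:ℝ) 1) :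
    ∃ (p q : ℝ) (T : ℝ → ℝ), X '' Ioo α β = Ioo p q ∧ (∀ u ∈ Ioo p q, T u ∈ Ioo α β ∧ X (T u) = u) ∧
      (∀ t ∈ Ioo α β, T (X t) = t) ∧ ContinuousOn T (Ioo p q) := by
  have e : ∃ p q, X '' Ioo α β = Ioo p q := by
    rcases (Ioo α β).eq_empty_or_nonempty with h0 | h0
    · exact ⟨0, 0, by simp [h0]⟩
    have hb : BddBelow (X '' Ioo α β) := ⟨-1, by rintro _ ⟨t, ht, rfl⟩; exact (b t ht).1⟩
    have ha : BddAbove (X '' Ioo α β) := ⟨1, by rintro _ ⟨t, ht, rfl⟩; exact (b t ht).2⟩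
    refine ⟨sInf (X '' Ioo α β), sSup (X '' Ioo α β), Subset.antisymm ?_ ?_⟩
    · intro x hx
      have := (img_open c i).mem_nhds hx
      obtain ⟨ε, e0, he⟩ := Metric.mem_nhds_iff.1 this
      rw [Real.ball_eq_Ioo] at he
      have h1 := csInf_le hb (he (show x - ε/2 ∈ _ from ⟨by linarith, by linarith⟩))
      have h2 := le_csSup ha (he (show x + ε/2 ∈ _ from ⟨by linarith, by linarith⟩))
      exact ⟨by linarith, by linarith⟩
    · exact IsConnected.Ioo_csInf_csSup_subset ⟨h0.image X, isPreconnected_Ioo.image X c⟩ hb ha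
  obtain ⟨p, q, e⟩ := e
  have ex : ∀ u ∈ Ioo p q, ∃ t, t ∈ Ioo α β ∧ X t = u := fun u hu => by rw [← e] at hu; exact hu
  choose! T hT using ex
  have mX : ∀ t ∈ Ioo α β, X t ∈ Ioo p q := fun t ht => e ▸ mem_image_of_mem X ht
  have li : ∀ t ∈ Ioo α β, T (X t) = t := fun t ht => i (hT _ (mX t ht)).1 ht (hT _ (mX t ht)).2
  refine ⟨p, q, T, e, hT, li, ?_⟩
  intro u hu
  apply ContinuousAt.continuousWithinAt
  rw [ContinuousAt, tendsto_order]
  have key : ∀ a b, a < T u → T u < b → ∀ᶠ v in 𝓝 u, a < T v ∧ T v < b := by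
    intro a b ha hb
    have sub : Ioo (max a α) (min b β) ⊆ Ioo α β := Ioo_subset_Ioo (le_max_right _ _) (min_le_right _ _)
    have := img_open (c.mono sub) (i.mono sub)
    have hm : u ∈ X '' Ioo (max a α) (min b β) :=
      ⟨T u, ⟨max_lt ha (hT u hu).1.1, lt_min hb (hT u hu).1.2⟩, (hT u hu).2⟩
    filter_upwards [this.mem_nhds hm]
    rintro _ ⟨t, ht, rfl⟩
    rw [li t (sub ht)]
    exact ⟨(le_max_left _ _).trans_lt ht.1, ht.2.trans_le (min_le_left _ _)⟩
  refine ⟨fun a ha => ?_, fun b hb => ?_⟩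
  · filter_upwards [key a (T u + 1) ha (by linarith)] with v hv using hv.1
  · filter_upwards [key (T u - 1) b (by linarith) hb] with v hv using hv.2

lemma arc_left (S : Sys A K L s) {J : Set ℝ} (oJ : IsOpen J) (cJ : J.OrdConnected) (bJ : J ⊆ Ico (-1) 0) {ζ G : ℝ → ℝ} {e : ℝ}
    (he : e = 1 ∨ e = -1) (hd : ∀ u ∈ J, HasDerivAt ζ (A u (ζ u) + e * (K u (ζ u) * G u)) u) (hc : ContinuousOn G J)
    (hG : ∀ u ∈ J, G u ^ 2 = ζ u) (h1 : ∀ u ∈ J, ζ u ≤ 1) :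
    ∃ σ : ℝ, (σ = 1 ∨ σ = -1) ∧ ∃ ξ, Sol A K σ ξ ∧ ∀ u ∈ J, 0 < ζ u ∧ ζ u = ξ u ∧ e * G u = σ * √(ζ u) := by
  rcases J.eq_empty_or_nonempty with h0 | ⟨u0, hu0⟩
  · obtain ⟨ξ, hξ, -⟩ := exists_sol S hp1 z0I 0
    exact ⟨1, hp1, ξ, hξ, by simp [h0]⟩
  have pos : ∀ u ∈ J, 0 < ζ u := by
    intro u hu
    rcases (show 0 ≤ ζ u by rw [← hG u hu]; positivity).eq_or_lt with h | h
    · exfalso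
      have hg : G u = 0 := by have := hG u hu; rw [← h] at this; exact pow_eq_zero_iff (two_ne_zero) |>.1 this
      have hm : IsLocalMin ζ u := by
        filter_upwards [oJ.mem_nhds hu] with w hw
        rw [← h, ← hG w hw]; positivity
      have := hm.hasDerivAt_eq_zero (hd u hu)
      rw [hg, ← h] at this
      have h2 := S.sA u (bJ hu).2.ne
      have : A u 0 = 0 := by linarith
      rw [this] at h2; simp at h2
    · exact h
  have ne : ∀ u ∈ J, G u ≠ 0 := by
    intro u hu h; have := hG u hu; have := pos u hu; rw [h] at *; simp at *; linarith
  have sg : ∃ τ : ℝ, (τ = 1 ∨ τ = -1) ∧ ∀ u ∈ J, 0 < τ * G u := by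
    rcases (ne u0 hu0).lt_or_gt with h | h
    · refine ⟨-1, Or.inr rfl, fun u hu => ?_⟩
      by_contra hn
      have : 0 < G u := lt_of_le_of_ne (by linarith) (ne u hu).symm
      obtain ⟨w, hw, h0⟩ := cJ.isPreconnected.intermediate_value hu0 hu hc ⟨h.le, this.le⟩
      exact ne w hw h0
    · refine ⟨1, Or.inl rfl, fun u hu => ?_⟩
      by_contra hn
      have : G u < 0 := lt_of_le_of_ne (by linarith) (ne u hu)
      obtain ⟨w, hw, h0⟩ := cJ.isPreconnected.intermediate_value hu hu0 hc ⟨this.le, h.le⟩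
      exact ne w hw h0
  obtain ⟨τ, hτ, ht⟩ := sg
  have eG : ∀ u ∈ J, G u = τ * √(ζ u) := by
    intro u hu
    have h := ht u hu
    have h2 : √(ζ u) = τ * G u := by
      rw [← hG u hu, show G u ^ 2 = (τ * G u)^2 by rcases hτ with r | r <;> rw [r] <;> ring, Real.sqrt_sq h.le]
    rw [h2]; rcases hτ with r | r <;> rw [r] <;> ring
  have hσ : e * τ = 1 ∨ e * τ = -1 := by rcases he with r | r <;> rcases hτ with r' | r' <;> simp [r, r']
  have hs : SolOn A K (e * τ) ζ J := by
    intro u hu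
    refine (hd u hu).congr_deriv ?_
    rw [FF, min_eq_left (h1 u hu), eG u hu]; ring
  have I0 : ∀ u ∈ J, u ∈ Icc (-1:ℝ) 0 := fun u hu => ⟨(bJ hu).1, (bJ hu).2.le⟩
  obtain ⟨ξ, hξ, hx⟩ := exists_sol S hσ (I0 u0 hu0) (ζ u0)
  refine ⟨e * τ, hσ, ξ, hξ, fun u hu => ⟨pos u hu, ?_, by rw [eG u hu]; ring⟩⟩
  have fw : ∀ (a b : ℝ) (ha : a ∈ J) (hb : b ∈ J) (ψ : ℝ → ℝ), Sol A K (e * τ) ψ → a ≤ b → ζ a = ψ a → ζ b = ψ b := by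
    intro a b ha hb ψ hψ hab h
    have sub : Icc a b ⊆ J := cJ.out ha hb
    exact glob_right S hσ (hs.mono sub) (hψ.mono (fun w hw => I0 w (sub hw))) h
      (fun x hx => Or.inr (Or.inr (bJ (sub ⟨hx.1, hx.2.le⟩)).2.ne)) b ⟨hab, le_refl _⟩
  rcases le_total u0 u with h | h
  · exact fw u0 u hu0 hu ξ hξ h hx.symm
  · obtain ⟨ψ, hψ, hy⟩ := exists_sol S hσ (I0 u hu) (ζ u)
    have h3 := fw u u0 hu hu0 ψ hψ h hy.symm
    rw [← hy]
    exact sol_uniq S hσ hψ hξ (I0 u0 hu0) (by rw [← h3, hx]) (Or.inl (bJ hu0).2.ne) u (I0 u hu)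

end PartNine

section PartTen
open Topology
variable {A K : ℝ → ℝ → ℝ} {L s σ : ℝ}

/-- normal form data for a BDE near the origin -/
structure NF (ω : (ℝ × ℝ) → (ℝ × ℝ) → ℝ) (A K : ℝ → ℝ → ℝ) (N W : Set (ℝ × ℝ)) (D Y B Dx Dy : ℝ × ℝ → ℝ) (e : ℝ) : Prop where
  he : e = 1 ∨ e = -1
  oN : IsOpen N
  zN : (0 : ℝ × ℝ) ∈ N
  oW : IsOpen W
  D0 : D 0 = 0
  m : ∀ p ∈ N, (p.1, D p) ∈ W
  m' : ∀ q ∈ W, (q.1, Y q) ∈ N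
  li : ∀ p ∈ N, Y (p.1, D p) = p.2
  ri : ∀ q ∈ W, D (q.1, Y q) = q.2
  dD : ∀ p ∈ N, HasFDerivAt D (Dx p • ContinuousLinearMap.fst ℝ ℝ ℝ + Dy p • ContinuousLinearMap.snd ℝ ℝ ℝ) p
  dY : ∀ q ∈ W, DifferentiableAt ℝ Y q
  cB : ContinuousOn B N
  hA : ∀ p ∈ N, 0 ≤ D p → A p.1 (D p) = Dx p - Dy p * B p
  hK : ∀ p ∈ N, 0 ≤ D p → K p.1 (D p) = e * Dy p
  ne : ∀ p ∈ N, Dy p ≠ 0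
  lt : ∀ p ∈ N, D p ≤ 1
  bx : ∀ p ∈ N, p.1 ∈ Icc (-1:ℝ) 1
  om : ∀ p ∈ N, ∀ v : ℝ × ℝ, ω p v = 0 ↔ (v.2 + B p * v.1) ^ 2 = D p * v.1 ^ 2

variable {ω : (ℝ × ℝ) → (ℝ × ℝ) → ℝ} {N W : Set (ℝ × ℝ)} {D Y B Dx Dy : ℝ × ℝ → ℝ} {e : ℝ}

lemma nf_to_parc (S : Sys A K L s) (F : NF ω A K N W D Y B Dx Dy e) {γ : ℝ → ℝ × ℝ} {α β : ℝ}
    (hγ : IsIntegralCurveOnBDE ω γ (Ioo α β)) (hm : MapsTo γ (Ioo α β) N) :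
    PArc A K (fun t => ((γ t).1, D (γ t))) α β := by
  obtain ⟨-, v, cv, hv⟩ := hγ
  have e2 : e * e = 1 := by rcases F.he with h | h <;> rw [h] <;> norm_num
  have q : ∀ t ∈ Ioo α β, ((v t).2 + B (γ t) * (v t).1) ^ 2 = D (γ t) * (v t).1 ^ 2 := fun t ht =>
    (F.om _ (hm ht) _).1 (hv t ht).2.2
  have v1 : ∀ t ∈ Ioo α β, (v t).1 ≠ 0 := by
    intro t ht h0
    have := q t ht
    rw [h0] at this
    have h2 : (v t).2 = 0 := by simpa using this
    exact (hv t ht).2.1 (Prod.ext h0 h2)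
  have dX : ∀ t ∈ Ioo α β, HasDerivAt (fun t => (γ t).1) (v t).1 t := fun t ht => (hv t ht).1.fst
  have cγ : ContinuousOn γ (Ioo α β) := fun t ht => (hv t ht).1.continuousAt.continuousWithinAt
  have cD : ContinuousOn D N := fun p hp => (F.dD p hp).continuousAt.continuousWithinAt
  have cP : ContinuousOn (fun t => ((γ t).1, D (γ t))) (Ioo α β) :=
    (continuous_fst.comp_continuousOn cγ).prodMk (cD.comp cγ hm)
  have iX : InjOn (fun t => (γ t).1) (Ioo α β) := by
    have key : ∀ t ∈ Ioo α β, ∀ u ∈ Ioo α β, t < u → (γ t).1 ≠ (γ u).1 := by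
      intro t ht u hu htu heq
      have sub : Icc t u ⊆ Ioo α β := fun w hw => ⟨ht.1.trans_le hw.1, hw.2.trans_lt hu.2⟩
      obtain ⟨w, hw, h0⟩ := exists_hasDerivAt_eq_zero htu ((continuous_fst.comp_continuousOn cγ).mono sub) heq (fun w hw => dX w (sub (Ioo_subset_Icc_self hw)))
      exact v1 w (sub (Ioo_subset_Icc_self hw)) h0
    intro t ht u hu heq
    rcases lt_trichotomy t u with h | h | h
    · exact absurd heq (key t ht u hu h)
    · exact h
    · exact absurd heq.symm (key u hu t ht h)
  obtain ⟨p, r, T, eJ, hT, lT, cT⟩ := ivl_inv (continuous_fst.comp_continuousOn cγ) iX (fun t ht => F.bx _ (hm ht))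
  set ζ : ℝ → ℝ := fun u => D (γ (T u)) with hζ
  set G : ℝ → ℝ := fun u => ((v (T u)).2 + B (γ (T u)) * (v (T u)).1) / (v (T u)).1 with hG
  have nn : ∀ t ∈ Ioo α β, 0 ≤ D (γ t) := by
    intro t ht
    have h1 := q t ht
    have h2 : 0 < (v t).1 ^ 2 := by have := v1 t ht; positivity
    by_contra hc
    nlinarith [sq_nonneg ((v t).2 + B (γ t) * (v t).1)]
  have cG : ContinuousOn G (Ioo p r) := by
    have cvT : ContinuousOn (fun u => v (T u)) (Ioo p r) := cv.comp cT (fun u hu => (hT u hu).1)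
    have cBT : ContinuousOn (fun u => B (γ (T u))) (Ioo p r) := F.cB.comp (cγ.comp cT (fun u hu => (hT u hu).1)) (fun u hu => hm (hT u hu).1)
    exact ((continuous_snd.comp_continuousOn cvT).add (cBT.mul (continuous_fst.comp_continuousOn cvT))).div
      (continuous_fst.comp_continuousOn cvT) (fun u hu => v1 _ (hT u hu).1)
  have G2 : ∀ u ∈ Ioo p r, G u ^ 2 = ζ u := by
    intro u hu
    simp only [hG, hζ]
    rw [div_pow, q _ (hT u hu).1]
    have := v1 _ (hT u hu).1
    field_simp
  have dζ : ∀ u ∈ Ioo p r, HasDerivAt ζ (A u (ζ u) + e * (K u (ζ u) * G u)) u := by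
    intro u hu
    have ht := (hT u hu).1
    have h1 := HasDerivAt.of_local_left_inverse ((cT u hu).continuousAt (isOpen_Ioo.mem_nhds hu)) (dX _ ht) (v1 _ ht)
      (by filter_upwards [isOpen_Ioo.mem_nhds hu] with w hw using (hT w hw).2)
    have h2 := ((F.dD _ (hm ht)).comp_hasDerivAt (T u) (hv _ ht).1).scomp u h1
    refine HasDerivAt.congr_deriv h2 ?_
    have hx : (γ (T u)).1 = u := (hT u hu).2
    have a1 := F.hA _ (hm ht) (nn _ ht)
    have a2 := F.hK _ (hm ht) (nn _ ht)
    rw [hx] at a1 a2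
    have a3 : e * (K u (D (γ (T u))) * G u) = Dy (γ (T u)) * G u := by rw [a2]; linear_combination (Dy (γ (T u)) * G u) * e2
    rw [show ζ u = D (γ (T u)) from rfl, a3, a1]
    simp [hG]
    have := v1 _ ht
    field_simp
    ring
  have z1 : ∀ u ∈ Ioo p r, ζ u ≤ 1 := fun u hu => F.lt _ (hm (hT u hu).1)
  have mX : ∀ t ∈ Ioo α β, (γ t).1 ∈ Ioo p r := fun t ht => eJ ▸ mem_image_of_mem (fun t => (γ t).1) ht
  have bJ : ∀ u ∈ Ioo p r, u ∈ Icc (-1:ℝ) 1 := fun u hu => by rw [← (hT u hu).2]; exact F.bx _ (hm (hT u hu).1)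
  obtain ⟨σL, hσL, ξL, sL, kL⟩ := arc_left S (J := Ioo p r ∩ Iio 0) (isOpen_Ioo.inter isOpen_Iio) (ordConnected_Ioo.inter ordConnected_Iio)
    (fun u hu => ⟨(bJ u hu.1).1, hu.2⟩) F.he (fun u hu => dζ u hu.1) (cG.mono inter_subset_left) (fun u hu => G2 u hu.1) (fun u hu => z1 u hu.1)
  have mneg : ∀ u ∈ Ioo (-r) (-p), -u ∈ Ioo p r := fun u hu => ⟨by linarith [hu.2], by linarith [hu.1]⟩
  obtain ⟨σR, hσR, ξR, sR, kR⟩ := arc_left S.refl (J := Ioo (-r) (-p) ∩ Iio 0) (isOpen_Ioo.inter isOpen_Iio) (ordConnected_Ioo.inter ordConnected_Iio)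
    (fun u hu => ⟨by linarith [(bJ _ (mneg u hu.1)).2], hu.2⟩) (ζ := fun u => ζ (-u)) (G := fun u => - G (-u)) F.he
    (by
      intro u hu
      have := HasDerivAt.scomp u (dζ _ (mneg u hu.1)) (hasDerivAt_neg u)
      exact HasDerivAt.congr_deriv this (by simp [rA, rK]; ring))
    ((cG.comp continuous_neg.continuousOn (fun u hu => mneg u hu.1)).neg) (fun u hu => by rw [neg_sq]; exact G2 _ (mneg u hu.1))
    (fun u hu => z1 _ (mneg u hu.1))
  have hm' : ∀ t ∈ Ioo α β, 0 < (γ t).1 → -(γ t).1 ∈ Ioo (-r) (-p) ∩ Iio 0 := fun t ht h =>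
    ⟨⟨by linarith [(mX t ht).2], by linarith [(mX t ht).1]⟩, by simpa using h⟩
  have zT : ∀ t ∈ Ioo α β, ζ (γ t).1 = D (γ t) := fun t ht => congrArg (fun w => D (γ w)) (lT t ht)
  refine ⟨cP, iX, nn, σL, -σR, hσL, by rcases hσR with h | h <;> simp [h], ξL, ξR, sL, by rw [neg_neg]; exact sR, ?_, ?_, ?_⟩
  · intro t ht h
    have := kL _ ⟨mX t ht, h⟩
    rw [zT t ht] at this
    exact ⟨this.1, this.2.1⟩
  · intro t ht h
    have := kR _ (hm' t ht h)
    simp only [neg_neg] at this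
    rw [zT t ht] at this
    exact ⟨this.1, this.2.1⟩
  · intro t ht h hz
    simp only at h hz
    have h0 : (0:ℝ) ∈ Ioo p r := h ▸ mX t ht
    have z0 : ζ 0 = D (γ t) := by rw [← h]; exact zT t ht
    have cζ : ContinuousAt ζ 0 := (dζ 0 h0).continuousAt
    have cG0 : ContinuousAt G 0 := (cG 0 h0).continuousAt (isOpen_Ioo.mem_nhds h0)
    have l1 : e * G 0 = σL * √(ζ 0) := by
      have t1 : Tendsto (fun u => e * G u) (𝓝[<] 0) (𝓝 (e * G 0)) := (cG0.const_mul e).mono_left nhdsWithin_le_nhds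
      have t2 : Tendsto (fun u => σL * √(ζ u)) (𝓝[<] 0) (𝓝 (σL * √(ζ 0))) := ((cζ.sqrt).const_mul σL).mono_left nhdsWithin_le_nhds
      refine tendsto_nhds_unique (t1.congr' ?_) t2
      filter_upwards [self_mem_nhdsWithin, mem_nhdsWithin_of_mem_nhds (isOpen_Ioo.mem_nhds h0)] with u h1 h2
      exact (kL u ⟨h2, h1⟩).2.2
    have l2 : e * G 0 = -σR * √(ζ 0) := by
      have t1 : Tendsto (fun u => e * G u) (𝓝[>] 0) (𝓝 (e * G 0)) := (cG0.const_mul e).mono_left nhdsWithin_le_nhds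
      have t2 : Tendsto (fun u => -σR * √(ζ u)) (𝓝[>] 0) (𝓝 (-σR * √(ζ 0))) := ((cζ.sqrt).const_mul (-σR)).mono_left nhdsWithin_le_nhds
      refine tendsto_nhds_unique (t1.congr' ?_) t2
      filter_upwards [self_mem_nhdsWithin, mem_nhdsWithin_of_mem_nhds (isOpen_Ioo.mem_nhds h0)] with u h1 h2
      have := (kR (-u) ⟨⟨by linarith [h2.2], by linarith [h2.1]⟩, by simpa using h1⟩).2.2
      simp only [neg_neg] at this
      linarith
    have : 0 < √(ζ 0) := Real.sqrt_pos.2 (by rw [z0]; exact hz)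
    exact mul_right_cancel₀ this.ne' (l1.symm.trans l2)

open Classical in
lemma parc_to_nf (F : NF ω A K N W D Y B Dx Dy e) {P : ℝ → ℝ × ℝ} {α β : ℝ}
    (hP : PArc A K P α β) (hm : MapsTo P (Ioo α β) W) :
    ∃ γ J, IsIntegralCurveOnBDE ω γ J ∧ (fun t => ((P t).1, Y (P t))) '' Ioo α β = γ '' J := by
  have e2 : e * e = 1 := by rcases F.he with h | h <;> rw [h] <;> norm_num
  obtain ⟨p, r, T, eJ, hT, lT, cT⟩ := ivl_inv (X := fun t => (P t).1) (continuous_fst.comp_continuousOn hP.c) hP.i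
    (fun t ht => F.bx ((P t).1, Y (P t)) (F.m' _ (hm ht)))
  obtain ⟨σL, σR, hσL, hσR, ξL, ξR, sL, sR, eL, eR, e0⟩ := hP.sol
  set ζ : ℝ → ℝ := fun u => (P (T u)).2 with hζ
  have eP : ∀ u ∈ Ioo p r, P (T u) = (u, ζ u) := fun u hu => Prod.ext (hT u hu).2 rfl
  have hW : ∀ u ∈ Ioo p r, (u, ζ u) ∈ W := fun u hu => eP u hu ▸ hm (hT u hu).1
  have nn : ∀ u ∈ Ioo p r, 0 ≤ ζ u := fun u hu => hP.nn _ (hT u hu).1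
  have z1 : ∀ u ∈ Ioo p r, ζ u ≤ 1 := fun u hu => by
    have := F.lt _ (F.m' _ (hW u hu)); rwa [F.ri _ (hW u hu)] at this
  have cζ : ContinuousOn ζ (Ioo p r) := continuous_snd.comp_continuousOn (hP.c.comp cT (fun u hu => (hT u hu).1))
  have kL : ∀ u ∈ Ioo p r, u < 0 → ζ u = ξL u := by
    intro u hu h
    have := eL _ (hT u hu).1; rw [eP u hu] at this; exact (this h).2
  have kR : ∀ u ∈ Ioo p r, 0 < u → ζ u = ξR (-u) := by
    intro u hu h
    have := eR _ (hT u hu).1; rw [eP u hu] at this; exact (this h).2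
  have k0 : (0:ℝ) ∈ Ioo p r → 0 < ζ 0 → σL = σR := by
    intro h; have := e0 _ (hT 0 h).1; rw [eP 0 h] at this; exact this rfl
  have bJ : ∀ u ∈ Ioo p r, u ∈ Icc (-1:ℝ) 1 := fun u hu => F.bx _ (F.m' _ (hW u hu))
  set τ : ℝ → ℝ := fun u => if u < 0 then σL else σR with hτ
  have τs : ∀ u, τ u = 1 ∨ τ u = -1 := fun u => by simp only [hτ]; split_ifs <;> assumption
  have τL : ∀ u, u < 0 → τ u = σL := fun u h => if_pos h
  have τR : ∀ u, 0 < u → τ u = σR := fun u h => if_neg h.le.not_gt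
  have ff : ∀ u ∈ Ioo p r, ∀ σ : ℝ, FF A K σ u (ζ u) = A u (ζ u) + σ * (K u (ζ u) * √(ζ u)) := fun u hu σ => by
    rw [FF, min_eq_left (z1 u hu)]
  have dR : ∀ u ∈ Ioo p r, 0 ≤ u → HasDerivAt (fun w => ξR (-w)) (FF A K σR u (ξR (-u))) u := by
    intro u hu h
    have := SolOn.refl (J := Icc 0 1) sR (fun x hx => ⟨by linarith [hx.2], by linarith [hx.1]⟩) u ⟨h, (bJ u hu).2⟩
    rwa [rA_rA, rK_rK, neg_neg] at this
  have dζ : ∀ u ∈ Ioo p r, HasDerivAt ζ (A u (ζ u) + τ u * (K u (ζ u) * √(ζ u))) u := by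
    intro u hu
    rcases lt_trichotomy u 0 with h | h | h
    · rw [τL u h, ← ff u hu σL, kL u hu h]
      refine (sL u ⟨(bJ u hu).1, h.le⟩).congr_of_eventuallyEq ?_
      filter_upwards [isOpen_Ioo.mem_nhds hu, isOpen_Iio.mem_nhds h] with w hw hw' using kL w hw hw'
    · subst h
      have cz : ContinuousAt ζ 0 := (cζ 0 hu).continuousAt (isOpen_Ioo.mem_nhds hu)
      have n1 : ∀ᶠ w in 𝓝[<] (0:ℝ), ζ w = ξL w := by
        filter_upwards [self_mem_nhdsWithin, mem_nhdsWithin_of_mem_nhds (isOpen_Ioo.mem_nhds hu)] with w h1 h2 using kL w h2 h1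
      have n2 : ∀ᶠ w in 𝓝[>] (0:ℝ), ζ w = ξR (-w) := by
        filter_upwards [self_mem_nhdsWithin, mem_nhdsWithin_of_mem_nhds (isOpen_Ioo.mem_nhds hu)] with w h1 h2 using kR w h2 h1
      have d1 := sL 0 z0I
      have d2 := dR 0 hu (le_refl _)
      have z1 : ζ 0 = ξL 0 := tendsto_nhds_unique ((cz.mono_left nhdsWithin_le_nhds).congr' n1) (d1.continuousAt.mono_left nhdsWithin_le_nhds)
      have z2 : ζ 0 = ξR (-0) := tendsto_nhds_unique ((cz.mono_left nhdsWithin_le_nhds).congr' n2) (d2.continuousAt.mono_left nhdsWithin_le_nhds)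
      rw [← z1, ff 0 hu] at d1
      rw [← z2, ff 0 hu] at d2
      have w1 : HasDerivWithinAt ζ (A 0 (ζ 0) + σL * (K 0 (ζ 0) * √(ζ 0))) (Iio 0) 0 := d1.hasDerivWithinAt.congr_of_eventuallyEq n1 z1
      have w2 : HasDerivWithinAt ζ (A 0 (ζ 0) + σR * (K 0 (ζ 0) * √(ζ 0))) (Ioi 0) 0 := d2.hasDerivWithinAt.congr_of_eventuallyEq n2 z2
      have es : ∀ σ : ℝ, (σ = σL ∨ σ = σR) → σ * (K 0 (ζ 0) * √(ζ 0)) = τ 0 * (K 0 (ζ 0) * √(ζ 0)) := by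
        intro σ hσ
        rcases (nn 0 hu).eq_or_lt with h | h
        · rw [← h]; simp
        · have := k0 hu h
          have h3 : τ 0 = σR := by simp [hτ]
          rcases hσ with h4 | h4 <;> rw [h3, h4]
          rw [this]
      rw [es σL (Or.inl rfl)] at w1
      rw [es σR (Or.inr rfl)] at w2
      have := w1.Iic_of_Iio.union w2.Ici_of_Ioi
      rwa [Iic_union_Ici, hasDerivWithinAt_univ] at this
    · have := dR u hu h.le
      rw [τR u h, ← ff u hu σR, kR u hu h]
      refine this.congr_of_eventuallyEq ?_
      filter_upwards [isOpen_Ioo.mem_nhds hu, isOpen_Ioi.mem_nhds h] with w hw hw' using kR w hw hw'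
  have cτ : ContinuousOn (fun u => τ u * √(ζ u)) (Ioo p r) := by
    intro u hu
    have cz : ContinuousAt ζ u := (cζ u hu).continuousAt (isOpen_Ioo.mem_nhds hu)
    apply ContinuousAt.continuousWithinAt
    rcases lt_trichotomy u 0 with h | h | h
    · refine (cz.sqrt.const_mul σL).congr ?_
      filter_upwards [isOpen_Iio.mem_nhds h] with w hw
      rw [τL w hw]
    · subst h
      rcases (nn 0 hu).eq_or_lt with h | h
      · have c0 := cz.sqrt
        rw [ContinuousAt, ← h, Real.sqrt_zero] at c0
        rw [ContinuousAt, ← h, Real.sqrt_zero, mul_zero]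
        apply squeeze_zero_norm _ c0
        intro w
        rw [norm_mul]
        rcases τs w with h' | h' <;> rw [h'] <;> simp [abs_of_nonneg (Real.sqrt_nonneg _)]
      · refine (cz.sqrt.const_mul σL).congr ?_
        filter_upwards with w
        have := k0 hu h
        simp only [hτ]; split_ifs
        · rfl
        · rw [this]
    · refine (cz.sqrt.const_mul σR).congr ?_
      filter_upwards [isOpen_Ioi.mem_nhds h] with w hw
      rw [τR w hw]
  have dy : ∀ u ∈ Ioo p r, HasDerivAt (fun w => (w, Y (w, ζ w))) (1, -B (u, Y (u, ζ u)) + e * (τ u * √(ζ u))) u := by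
    intro u hu
    have h1 : HasDerivAt (fun w => (w, ζ w)) (1, _) u := (hasDerivAt_id u).prodMk (dζ u hu)
    have h2 := (F.dY _ (hW u hu)).hasFDerivAt.comp_hasDerivAt u h1
    set y' := (fderiv ℝ Y (u, ζ u)) (1, A u (ζ u) + τ u * (K u (ζ u) * √(ζ u))) with hy'
    have h3 : HasDerivAt (fun w => (w, Y (w, ζ w))) (1, y') u := (hasDerivAt_id u).prodMk h2
    have hN := F.m' _ (hW u hu)
    have h4 := (F.dD _ hN).comp_hasDerivAt u h3
    have h5 := (dζ u hu).congr_of_eventuallyEq (f₁ := D ∘ fun w => (w, Y (w, ζ w))) (by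
      filter_upwards [isOpen_Ioo.mem_nhds hu] with w hw using F.ri _ (hW w hw))
    have h6 := h4.unique h5
    have r1 := F.ri _ (hW u hu)
    simp only at r1 hN h6
    have a1 := F.hA _ hN (by rw [r1]; exact nn u hu)
    have a2 := F.hK _ hN (by rw [r1]; exact nn u hu)
    rw [r1] at a1 a2
    rw [a1, a2] at h6
    simp at h6
    have hKne : Dy (u, Y (u, ζ u)) ≠ 0 := F.ne _ hN
    have : y' = -B (u, Y (u, ζ u)) + e * (τ u * √(ζ u)) := by
      apply mul_left_cancel₀ hKne
      linear_combination h6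
    rw [← this]; exact h3
  refine ⟨fun u => (u, Y (u, ζ u)), Ioo p r, ⟨⟨p, r, rfl⟩, fun u => (1, -B (u, Y (u, ζ u)) + e * (τ u * √(ζ u))), ?_, ?_⟩, ?_⟩
  · have cγ : ContinuousOn (fun w => (w, Y (w, ζ w))) (Ioo p r) := fun u hu => (dy u hu).continuousAt.continuousWithinAt
    exact continuousOn_const.prodMk ((F.cB.comp cγ (fun u hu => F.m' _ (hW u hu))).neg.add (cτ.const_mul e))
  · intro u hu
    refine ⟨dy u hu, fun h => by simpa using congrArg Prod.fst h, ?_⟩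
    have hN := F.m' _ (hW u hu)
    rw [F.om _ hN, F.ri _ (hW u hu)]
    have : √(ζ u) * √(ζ u) = ζ u := Real.mul_self_sqrt (nn u hu)
    have t2 : τ u * τ u = 1 := by rcases τs u with h | h <;> rw [h] <;> norm_num
    simp only
    linear_combination this + (√(ζ u))^2 * τ u^2 * e2 + (√(ζ u))^2 * t2
  · ext q
    constructor
    · rintro ⟨t, ht, rfl⟩
      refine ⟨(P t).1, eJ ▸ mem_image_of_mem (fun t => (P t).1) ht, ?_⟩
      have : T (P t).1 = t := lT t ht
      simp only [hζ, this]
    · rintro ⟨u, hu, rfl⟩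
      exact ⟨T u, (hT u hu).1, by simp only [eP u hu]⟩

def hmap (D Y' : ℝ × ℝ → ℝ) (h : ℝ × ℝ → ℝ × ℝ) (p : ℝ × ℝ) : ℝ × ℝ :=
  ((h (p.1, D p)).1, Y' (h (p.1, D p)))

def hset (N W' U : Set (ℝ × ℝ)) (D : ℝ × ℝ → ℝ) (h : ℝ × ℝ → ℝ × ℝ) : Set (ℝ × ℝ) :=
  {p | p ∈ N ∧ (p.1, D p) ∈ U ∧ h (p.1, D p) ∈ W'}

variable {A' K' : ℝ → ℝ → ℝ} {L' : ℝ} {ω' : (ℝ × ℝ) → (ℝ × ℝ) → ℝ} {N' W' : Set (ℝ × ℝ)} {D' Y' B' Dx' Dy' : ℝ × ℝ → ℝ} {e' : ℝ}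

lemma half_equiv (S : Sys A K L s) (F : NF ω A K N W D Y B Dx Dy e) (F' : NF ω' A' K' N' W' D' Y' B' Dx' Dy' e')
    {U V : Set (ℝ × ℝ)} {h h' : ℝ × ℝ → ℝ × ℝ} (g : GH A K A' K' U V h h') (g' : GH A' K' A K V U h' h) :
    IsOpen (hset N W' U D h) ∧ 0 ∈ hset N W' U D h ∧ hmap D Y' h 0 = 0 ∧ ContinuousOn (hmap D Y' h) (hset N W' U D h) ∧
    MapsTo (hmap D Y' h) (hset N W' U D h) (hset N' W V D' h') ∧
    (∀ p ∈ hset N W' U D h, hmap D' Y h' (hmap D Y' h p) = p) ∧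
    (∀ γ I, IsIntegralCurveOnBDE ω γ I → Set.MapsTo γ I (hset N W' U D h) →
      ∃ σ J, IsIntegralCurveOnBDE ω' σ J ∧ (hmap D Y' h) '' (γ '' I) = σ '' J) := by
  have cD : ContinuousOn (fun p : ℝ × ℝ => (p.1, D p)) N := continuous_fst.continuousOn.prodMk
    (fun p hp => (F.dD p hp).continuousAt.continuousWithinAt)
  have z0 : ((0:ℝ × ℝ).1, D 0) = 0 := by rw [F.D0]; rfl
  have h0 : h 0 = 0 := g.ax _ g.zU rfl
  have z0' : (0:ℝ × ℝ) ∈ W' := by have := F'.m 0 F'.zN; rwa [F'.D0] at this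
  have Y0 : Y' 0 = 0 := by have := F'.li 0 F'.zN; rwa [F'.D0] at this
  have rr : ∀ p ∈ hset N W' U D h, ((hmap D Y' h p).1, D' (hmap D Y' h p)) = h (p.1, D p) := fun p hp =>
    Prod.ext rfl (F'.ri _ hp.2.2)
  refine ⟨?_, ⟨F.zN, by rw [z0]; exact g.zU, by rw [z0, h0]; exact z0'⟩, ?_, ?_, ?_, ?_, ?_⟩
  · have o1 : IsOpen (U ∩ h ⁻¹' W') := g.c.isOpen_inter_preimage g.oU F'.oW
    exact cD.isOpen_inter_preimage F.oN o1
  · rw [hmap, z0, h0, Y0]; rfl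
  · have c1 : ContinuousOn (fun p : ℝ × ℝ => h (p.1, D p)) (hset N W' U D h) :=
      g.c.comp (cD.mono fun p hp => hp.1) (fun p hp => hp.2.1)
    have cY : ContinuousOn Y' W' := fun q hq => (F'.dY q hq).continuousAt.continuousWithinAt
    exact (continuous_fst.comp_continuousOn c1).prodMk (cY.comp c1 (fun p hp => hp.2.2))
  · intro p hp
    refine ⟨F'.m' _ hp.2.2, ?_, ?_⟩
    · rw [rr p hp]; exact g.m hp.2.1
    · rw [rr p hp, g.li _ hp.2.1]; exact F.m p hp.1
  · intro p hp
    rw [hmap, rr p hp, g.li _ hp.2.1]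
    exact Prod.ext rfl (F.li p hp.1)
  · intro γ I hγ hm
    obtain ⟨α, β, rfl⟩ := hγ.1
    have p1 := nf_to_parc S F hγ (fun t ht => (hm ht).1)
    have p2 := p1.map g g' (fun t ht => (hm ht).2.1)
    obtain ⟨σ, J, hσ, he⟩ := parc_to_nf F' p2 (fun t ht => (hm ht).2.2)
    refine ⟨σ, J, hσ, ?_⟩
    rw [← he, image_image]
    rfl

theorem nf_equiv (S : Sys A K L s) (F : NF ω A K N W D Y B Dx Dy e) (S' : Sys A' K' L' s) (F' : NF ω' A' K' N' W' D' Y' B' Dx' Dy' e') :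
    TopEquivAt0 ω ω' := by
  obtain ⟨U, V, h, h', g, g'⟩ := gh_sys S S'
  obtain ⟨a1, a2, a3, a4, a5, a6, a7⟩ := half_equiv S F F' g g'
  obtain ⟨b1, b2, b3, b4, b5, b6, b7⟩ := half_equiv S' F' F g' g
  have hi : InvOn (hmap D' Y h') (hmap D Y' h) (hset N W' U D h) (hset N' W V D' h') := ⟨a6, b6⟩
  exact ⟨_, _, _, _, a1, b1, a2, b2, a3, a4, b4, hi.bijOn a5 b5, hi, a7, b7⟩

end PartTen

section PartEleven
open Topology

def eqv (α β : ℝ) (hβ : β ≠ 0) : (ℝ × ℝ) ≃L[ℝ] (ℝ × ℝ) :=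
  ContinuousLinearEquiv.equivOfInverse
    ((ContinuousLinearMap.fst ℝ ℝ ℝ).prod (α • ContinuousLinearMap.fst ℝ ℝ ℝ + β • ContinuousLinearMap.snd ℝ ℝ ℝ))
    ((ContinuousLinearMap.fst ℝ ℝ ℝ).prod ((-(α / β)) • ContinuousLinearMap.fst ℝ ℝ ℝ + (1 / β) • ContinuousLinearMap.snd ℝ ℝ ℝ))
    (by intro p; refine Prod.ext rfl ?_; simp; field_simp; ring)
    (by intro p; refine Prod.ext rfl ?_; simp; field_simp; ring)

def cl (r x : ℝ) : ℝ := max (-r) (min x r)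
def clz (r z : ℝ) : ℝ := max 0 (min z r)

lemma cl_mem {r : ℝ} (hr : 0 < r) (x : ℝ) : cl r x ∈ Icc (-r) r := ⟨le_max_left _ _, max_le (by linarith) (min_le_right _ _)⟩
lemma clz_mem {r : ℝ} (hr : 0 < r) (x : ℝ) : clz r x ∈ Icc 0 r := ⟨le_max_left _ _, max_le hr.le (min_le_right _ _)⟩
lemma clz_lip {r : ℝ} (z w : ℝ) : |clz r z - clz r w| ≤ |z - w| := by
  unfold clz
  refine (abs_max_sub_max_le_max _ _ _ _).trans ?_
  simp only [sub_self, abs_zero]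
  refine max_le (abs_nonneg _) ((abs_min_sub_min_le_max _ _ _ _).trans ?_)
  simp
lemma cl_sgn {r : ℝ} (hr : 0 < r) {x : ℝ} (hx : x ≠ 0) : ∃ k : ℝ, 0 < k ∧ k ≤ 1 ∧ cl r x = k * x := by
  rcases hx.lt_or_gt with h | h
  · refine ⟨min 1 (r / -x), lt_min one_pos (div_pos hr (by linarith)), min_le_left _ _, ?_⟩
    rw [cl, min_eq_left (by linarith)]
    have hx' : 0 < -x := by linarith
    rcases le_total 1 (r / -x) with h3 | h3
    · rw [min_eq_left h3, one_mul]
      rw [le_div_iff₀ hx'] at h3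
      exact max_eq_right (by linarith)
    · rw [min_eq_right h3]
      rw [div_le_iff₀ hx'] at h3
      rw [max_eq_left (by linarith)]
      field_simp
  · refine ⟨min 1 (r / x), lt_min one_pos (div_pos hr h), min_le_left _ _, ?_⟩
    rw [cl, max_eq_right (by rw [le_min_iff]; constructor <;> linarith), mul_comm, mul_min_of_nonneg _ _ h.le]
    congr 1
    · simp
    · field_simp

theorem good_nf {ω : (ℝ × ℝ) → (ℝ × ℝ) → ℝ} {N0 : Set (ℝ × ℝ)} {D B Dx Dy : ℝ × ℝ → ℝ} {e s : ℝ} (hN0 : N0 ∈ 𝓝 (0 : ℝ × ℝ))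
    (he : e = 1 ∨ e = -1) (hs : s = 1 ∨ s = -1)
    (hD : ∀ p ∈ N0, ContDiffAt ℝ (⊤ : ℕ∞) D p)
    (dD : ∀ p ∈ N0, HasFDerivAt D (Dx p • ContinuousLinearMap.fst ℝ ℝ ℝ + Dy p • ContinuousLinearMap.snd ℝ ℝ ℝ) p)
    (hDx : ContDiffAt ℝ 1 Dx 0) (hDy : ContDiffAt ℝ 1 Dy 0) (hB : ∀ p ∈ N0, ContDiffAt ℝ 1 B p) (D0 : D 0 = 0) (Dy0 : Dy 0 = e)
    (om : ∀ p ∈ N0, ∀ v : ℝ × ℝ, ω p v = 0 ↔ (v.2 + B p * v.1) ^ 2 = D p * v.1 ^ 2)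
    (h1 : ∀ᶠ p in 𝓝 (0 : ℝ × ℝ), D p = 0 → p.1 ≠ 0 → 0 < s * p.1 * (Dx p - Dy p * B p))
    (h2 : ∀ᶠ p in 𝓝 (0 : ℝ × ℝ), D p = 0 → |Dx p - Dy p * B p| ≤ |p.1| / 64) :
    ∃ A K L N W Y, Sys A K L s ∧ NF ω A K N W D Y B Dx Dy e ∧ (∀ q ∈ W, ContDiffAt ℝ (⊤ : ℕ∞) Y q) ∧ ∃ r > 0, W = Ioo (-r) r ×ˢ Ioo (-r) r := by
  have z0 : (0 : ℝ × ℝ) ∈ N0 := mem_of_mem_nhds hN0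
  have e2 : e * e = 1 := by rcases he with h | h <;> rw [h] <;> norm_num
  have ene : e ≠ 0 := by rintro rfl; simp at e2
  have cPsi : ∀ p ∈ N0, ContDiffAt ℝ (⊤ : ℕ∞) (fun p : ℝ × ℝ => (p.1, D p)) p := fun p hp => contDiffAt_fst.prodMk (hD p hp)
  have dPsi : ∀ p ∈ N0, ∀ h : Dy p ≠ 0, HasFDerivAt (fun p : ℝ × ℝ => (p.1, D p)) ((eqv (Dx p) (Dy p) h : (ℝ × ℝ) ≃L[ℝ] (ℝ × ℝ)) : (ℝ × ℝ) →L[ℝ] (ℝ × ℝ)) p :=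
    fun p hp h => hasFDerivAt_fst.prodMk (dD p hp)
  have hDy0 : Dy 0 ≠ 0 := Dy0 ▸ ene
  have n0 : ((⊤ : ℕ∞) : WithTop ℕ∞) ≠ 0 := by simp
  set φ := ContDiffAt.toOpenPartialHomeomorph (fun p : ℝ × ℝ => (p.1, D p)) (cPsi 0 z0) (dPsi 0 z0 hDy0) n0 with hφ
  have φc : ∀ p, φ p = (p.1, D p) := fun p => rfl
  have zs : (0 : ℝ × ℝ) ∈ φ.source := ContDiffAt.mem_toOpenPartialHomeomorph_source _ _ _
  have φ0 : φ 0 = 0 := by rw [φc, D0]; rfl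
  have zt : (0 : ℝ × ℝ) ∈ φ.target := φ0 ▸ φ.map_source zs
  have ψ0 : φ.symm 0 = 0 := by conv_lhs => rw [← φ0]
                               exact φ.left_inv zs
  have cψ : ContinuousAt φ.symm 0 := φ.continuousAt_symm zt
  have sψ : ContDiffAt ℝ (⊤ : ℕ∞) φ.symm 0 := φ.contDiffAt_symm zt (f₀' := eqv (Dx 0) (Dy 0) hDy0) (by rw [ψ0]; exact dPsi 0 z0 hDy0) (by rw [ψ0]; exact cPsi 0 z0)
  have sψ1 : ContDiffAt ℝ 1 φ.symm 0 := sψ.of_le (by exact_mod_cast le_top)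
  set A0 : ℝ × ℝ → ℝ := fun q => Dx (φ.symm q) - Dy (φ.symm q) * B (φ.symm q) with hA0
  set K0 : ℝ × ℝ → ℝ := fun q => e * Dy (φ.symm q) with hK0
  have sA : ContDiffAt ℝ 1 A0 0 := by
    have a1 : ContDiffAt ℝ 1 (fun p => Dx p - Dy p * B p) (φ.symm 0) := by rw [ψ0]; exact hDx.sub (hDy.mul (hB 0 z0))
    exact a1.comp 0 sψ1
  have sK : ContDiffAt ℝ 1 K0 0 := by
    have a1 : ContDiffAt ℝ 1 (fun p => e * Dy p) (φ.symm 0) := by rw [ψ0]; exact contDiffAt_const.mul hDy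
    exact a1.comp 0 sψ1
  obtain ⟨LA, tA, mA, lA⟩ := sA.exists_lipschitzOnWith
  obtain ⟨LK, tK, mK, lK⟩ := sK.exists_lipschitzOnWith
  have K00 : K0 0 = 1 := by simp only [hK0, ψ0, Dy0, e2]
  have ψn : Tendsto φ.symm (𝓝 0) (𝓝 0) := by have := cψ.tendsto; rwa [ψ0] at this
  have ev : ∀ᶠ q in 𝓝 (0 : ℝ × ℝ), q ∈ tA ∧ q ∈ tK ∧ q ∈ φ.target ∧ |A0 q| ≤ |A0 0| + 1 ∧ 1/2 ≤ K0 q ∧ K0 q ≤ 2 ∧ φ.symm q ∈ N0 ∧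
      (D (φ.symm q) = 0 → (φ.symm q).1 ≠ 0 → 0 < s * (φ.symm q).1 * A0 q) ∧ (D (φ.symm q) = 0 → |A0 q| ≤ |(φ.symm q).1| / 64) := by
    have c1 : ∀ᶠ q in 𝓝 (0 : ℝ × ℝ), |A0 q| ≤ |A0 0| + 1 := sA.continuousAt.abs.eventually_le_const (by linarith)
    have c2 : ∀ᶠ q in 𝓝 (0 : ℝ × ℝ), 1/2 ≤ K0 q := sK.continuousAt.eventually_const_le (by rw [K00]; norm_num)
    have c3 : ∀ᶠ q in 𝓝 (0 : ℝ × ℝ), K0 q ≤ 2 := sK.continuousAt.eventually_le_const (by rw [K00]; norm_num)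
    filter_upwards [mA, mK, φ.open_target.mem_nhds zt, c1, c2, c3, ψn.eventually hN0, ψn.eventually h1, ψn.eventually h2] with q a1 a2 a3 a4 a5 a6 a7 a8 a9
    exact ⟨a1, a2, a3, a4, a5, a6, a7, a8, a9⟩
  obtain ⟨r', hr', hb⟩ := Metric.mem_nhds_iff.1 ev
  set r := min (r' / 2) 1 with hr
  have r0 : 0 < r := lt_min (by linarith) one_pos
  have r1 : r ≤ 1 := min_le_right _ _
  have bx : ∀ x ∈ Icc (-r) r, ∀ z ∈ Icc (-r) r, (x, z) ∈ Metric.ball (0 : ℝ × ℝ) r' := by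
    intro x hx z hz
    have : r ≤ r' / 2 := min_le_left _ _
    rw [mem_ball_zero_iff, Prod.norm_def, max_lt_iff, Real.norm_eq_abs, Real.norm_eq_abs, abs_lt, abs_lt]
    exact ⟨⟨by linarith [hx.1], by linarith [hx.2]⟩, by linarith [hz.1], by linarith [hz.2]⟩
  have gd := fun x hx z hz => hb (bx x hx z hz)
  have s1 : ∀ q ∈ φ.target, (φ.symm q).1 = q.1 := fun q hq => by
    have := φ.right_inv hq; rw [φc] at this; exact (congrArg Prod.fst this :)
  have s2 : ∀ q ∈ φ.target, D (φ.symm q) = q.2 := fun q hq => by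
    have := φ.right_inv hq; rw [φc] at this; exact congrArg Prod.snd this
  have cbx : ∀ x z, cl r x ∈ Icc (-r) r ∧ clz r z ∈ Icc (-r) r := fun x z =>
    ⟨cl_mem r0 x, ⟨by linarith [(clz_mem r0 z).1], (clz_mem r0 z).2⟩⟩
  have g := fun x z => gd _ (cbx x z).1 _ (cbx x z).2
  have lipz : ∀ {M : NNReal} {t : Set (ℝ × ℝ)} {H : ℝ × ℝ → ℝ}, LipschitzOnWith M H t → (∀ x z, (cl r x, clz r z) ∈ t) →
      (Continuous fun p : ℝ × ℝ => H (cl r p.1, clz r p.2)) ∧ ∀ x z w, |H (cl r x, clz r z) - H (cl r x, clz r w)| ≤ M * |z - w| := by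
    intro M t H hH ht
    constructor
    · have : Continuous fun p : ℝ × ℝ => (cl r p.1, clz r p.2) := by unfold cl clz; fun_prop
      rw [← continuousOn_univ] at this ⊢
      exact hH.continuousOn.comp this (fun p _ => ht _ _)
    · intro x z w
      have := hH.dist_le_mul _ (ht x z) _ (ht x w)
      rw [Real.dist_eq, Prod.dist_eq, dist_self, max_eq_right dist_nonneg, Real.dist_eq] at this
      exact this.trans (mul_le_mul_of_nonneg_left (clz_lip _ _) M.2)
  obtain ⟨cA, lA'⟩ := lipz lA (fun x z => (g x z).1)
  obtain ⟨cK, lK'⟩ := lipz lK (fun x z => (g x z).2.1)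
  have cz0 : clz r 0 = 0 := by unfold clz; rw [min_eq_left r0.le, max_self]
  have cid : ∀ x ∈ Ioo (-r) r, cl r x = x := fun x hx => by unfold cl; rw [min_eq_left hx.2.le, max_eq_right hx.1.le]
  have czid : ∀ x ∈ Ioo (-r) r, 0 ≤ x → clz r x = x := fun x hx h => by unfold clz; rw [min_eq_left hx.2.le, max_eq_right h]
  have iv : ∀ {x}, x ∈ Ioo (-r) r → x ∈ Icc (-r) r := fun h => Ioo_subset_Icc_self h
  set W : Set (ℝ × ℝ) := Ioo (-r) r ×ˢ Ioo (-r) r with hW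
  have oW : IsOpen W := isOpen_Ioo.prod isOpen_Ioo
  have Wg := fun q (hq : q ∈ W) => gd q.1 (iv hq.1) q.2 (iv hq.2)
  have Wt : ∀ q ∈ W, q ∈ φ.target := fun q hq => (Wg q hq).2.2.1
  have sY : ∀ q ∈ W, ContDiffAt ℝ (⊤ : ℕ∞) (fun q => (φ.symm q).2) q := by
    intro q hq
    have hn := (Wg q hq).2.2.2.2.2.2.1
    have hk := (Wg q hq).2.2.2.2.1
    have hd : Dy (φ.symm q) ≠ 0 := by intro h; simp only [hK0, Prod.mk.eta] at hk; rw [h] at hk; norm_num at hk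
    exact contDiffAt_snd.comp q (φ.contDiffAt_symm (Wt q hq) (f₀' := eqv _ _ hd) (dPsi _ hn hd) (cPsi _ hn))
  have Yψ : ∀ q ∈ W, (q.1, (φ.symm q).2) = φ.symm q := fun q hq => Prod.ext (s1 q (Wt q hq)).symm rfl
  refine ⟨fun x z => A0 (cl r x, clz r z), fun x z => K0 (cl r x, clz r z), LA + LK + (|A0 0| + 1), φ.source ∩ φ ⁻¹' W, W, fun q => (φ.symm q).2, ?_, ?_, sY, r, r0, rfl⟩
  · constructor
    · exact hs
    · exact cA
    · exact cK
    · intro x z w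
      refine (lA' x z w).trans (mul_le_mul_of_nonneg_right ?_ (abs_nonneg _))
      have : (0:ℝ) ≤ LK := LK.2
      have := abs_nonneg (A0 0); linarith
    · intro x z w
      refine (lK' x z w).trans (mul_le_mul_of_nonneg_right ?_ (abs_nonneg _))
      have : (0:ℝ) ≤ LA := LA.2
      have := abs_nonneg (A0 0); linarith
    · intro x z
      have : (0:ℝ) ≤ LA := LA.2
      have : (0:ℝ) ≤ LK := LK.2
      linarith [(g x z).2.2.2.1]
    · intro x z; exact (g x z).2.2.2.2.1
    · intro x z; exact (g x z).2.2.2.2.2.1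
    · intro x z hz
      have : clz r z = 0 := by unfold clz; rw [min_eq_left (by linarith), max_eq_left hz]
      simp only [this, cz0]
    · intro x hx
      obtain ⟨k, k0, k1, hk⟩ := cl_sgn r0 hx
      have h3 := (g x 0).2.2.2.2.2.2.2.1
      have ht := (g x 0).2.2.1
      rw [s1 _ ht, s2 _ ht] at h3
      have h4 := h3 cz0 (by simp only [hk]; positivity)
      simp only at h4
      have : s * (cl r x) * A0 (cl r x, clz r 0) = k * (s * x * A0 (cl r x, clz r 0)) := by nth_rewrite 1 [hk]; ring
      rw [this] at h4
      exact (mul_pos_iff_of_pos_left k0).1 h4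
    · intro x
      have h3 := (g x 0).2.2.2.2.2.2.2.2
      have ht := (g x 0).2.2.1
      rw [s1 _ ht, s2 _ ht] at h3
      have h4 := h3 cz0
      simp only at h4
      refine h4.trans ?_
      rcases eq_or_ne x 0 with h | h
      · rw [h]; simp [cl, r0.le]
      · obtain ⟨k, k0, k1, hk⟩ := cl_sgn r0 h
        rw [hk, abs_mul, abs_of_pos k0]
        have := abs_nonneg x
        nlinarith
  · have gN : ∀ p ∈ φ.source ∩ φ ⁻¹' W, φ.symm (p.1, D p) = p ∧ (p.1, D p) ∈ W := fun p hp => ⟨φ.left_inv hp.1, hp.2⟩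
    have NN : ∀ p ∈ φ.source ∩ φ ⁻¹' W, p ∈ N0 := fun p hp => by
      have := (Wg _ (gN p hp).2).2.2.2.2.2.2.1
      simp only at this; rwa [(gN p hp).1] at this
    constructor
    · exact he
    · exact φ.isOpen_inter_preimage oW
    · exact ⟨zs, by rw [mem_preimage, φ0]; exact ⟨⟨by simpa using r0, r0⟩, by simpa using r0, r0⟩⟩
    · exact oW
    · exact D0
    · intro p hp; exact hp.2
    · intro q hq
      rw [Yψ q hq]
      exact ⟨φ.map_target (Wt q hq), by rw [mem_preimage, φ.right_inv (Wt q hq)]; exact hq⟩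
    · intro p hp; rw [(gN p hp).1]
    · intro q hq; rw [Yψ q hq]; exact s2 q (Wt q hq)
    · intro p hp; exact dD p (NN p hp)
    · intro q hq; exact (sY q hq).differentiableAt n0
    · intro p hp; exact (hB p (NN p hp)).continuousAt.continuousWithinAt
    · intro p hp h
      rw [cid _ (gN p hp).2.1, czid _ (gN p hp).2.2 h]
      simp only [hA0]; rw [(gN p hp).1]
    · intro p hp h
      rw [cid _ (gN p hp).2.1, czid _ (gN p hp).2.2 h]
      simp only [hK0]; rw [(gN p hp).1]
    · intro p hp h
      have hk := (Wg _ (gN p hp).2).2.2.2.2.1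
      simp only [hK0] at hk
      rw [(gN p hp).1, h] at hk; norm_num at hk
    · intro p hp
      have := (gN p hp).2.2.2
      simp only at this; linarith
    · intro p hp
      have := (gN p hp).2.1
      simp only at this; exact ⟨by linarith [this.1], by linarith [this.2]⟩
    · intro p hp; exact om p (NN p hp)

end PartEleven

section PartTwelve
open Topology

lemma pdx_fderiv {f : ℝ × ℝ → ℝ} {p : ℝ × ℝ} (hf : DifferentiableAt ℝ f p) : HasDerivAt (fun s => f (s, p.2)) (fderiv ℝ f p (1, 0)) p.1 := by
  have h1 : HasDerivAt (fun s : ℝ => (s, p.2)) ((1:ℝ), (0:ℝ)) p.1 := (hasDerivAt_id _).prodMk (hasDerivAt_const _ _)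
  exact hf.hasFDerivAt.comp_hasDerivAt p.1 h1

lemma pdy_fderiv {f : ℝ × ℝ → ℝ} {p : ℝ × ℝ} (hf : DifferentiableAt ℝ f p) : HasDerivAt (fun s => f (p.1, s)) (fderiv ℝ f p (0, 1)) p.2 := by
  have h1 : HasDerivAt (fun s : ℝ => (p.1, s)) ((0:ℝ), (1:ℝ)) p.2 := (hasDerivAt_const _ _).prodMk (hasDerivAt_id _)
  exact hf.hasFDerivAt.comp_hasDerivAt p.2 h1

lemma pdx_eq {f : ℝ × ℝ → ℝ} (hf : ContDiff ℝ (⊤ : ℕ∞) f) : pdx f = fun p => fderiv ℝ f p (1, 0) := by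
  ext p; exact (pdx_fderiv (hf.differentiable (by simp) p)).deriv
lemma pdy_eq {f : ℝ × ℝ → ℝ} (hf : ContDiff ℝ (⊤ : ℕ∞) f) : pdy f = fun p => fderiv ℝ f p (0, 1) := by
  ext p; exact (pdy_fderiv (hf.differentiable (by simp) p)).deriv

lemma pdx_smooth {f : ℝ × ℝ → ℝ} (hf : ContDiff ℝ (⊤ : ℕ∞) f) : ContDiff ℝ (⊤ : ℕ∞) (pdx f) := by
  rw [pdx_eq hf]
  exact (hf.fderiv_right (m := (⊤ : ℕ∞)) (by simp)).clm_apply contDiff_const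
lemma pdy_smooth {f : ℝ × ℝ → ℝ} (hf : ContDiff ℝ (⊤ : ℕ∞) f) : ContDiff ℝ (⊤ : ℕ∞) (pdy f) := by
  rw [pdy_eq hf]
  exact (hf.fderiv_right (m := (⊤ : ℕ∞)) (by simp)).clm_apply contDiff_const

lemma pd_hasFDerivAt {f : ℝ × ℝ → ℝ} (hf : ContDiff ℝ (⊤ : ℕ∞) f) (p : ℝ × ℝ) :
    HasFDerivAt f (pdx f p • ContinuousLinearMap.fst ℝ ℝ ℝ + pdy f p • ContinuousLinearMap.snd ℝ ℝ ℝ) p := by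
  have h := (hf.differentiable (by simp) p).hasFDerivAt
  refine h.congr_fderiv ?_
  rw [pdx_eq hf, pdy_eq hf]
  ext <;> simp

lemma taylor_chain {M T : ℝ} (n : ℕ) : ∀ (H : ℕ → ℝ → ℝ), (∀ i t, HasDerivAt (H i) (H (i+1) t) t) →
    (∀ t, |t| ≤ T → |H n t| ≤ M) → ∀ t, |t| ≤ T → |H 0 t - ∑ j ∈ Finset.range n, H j 0 * t ^ j / (j.factorial : ℝ)| ≤ M * |t| ^ n := by
  induction n with
  | zero => intro H _ hb t ht; simpa using hb t ht
  | succ n ih =>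
    intro H hd hb t ht
    have h1 := ih (fun i => H (i+1)) (fun i t => hd (i+1) t) hb
    set d : ℝ → ℝ := fun t => H 0 t - ∑ j ∈ Finset.range (n+1), H j 0 * t ^ j / (j.factorial : ℝ) with hdd
    have hder : ∀ u, HasDerivAt d (H 1 u - ∑ j ∈ Finset.range n, H (j+1) 0 * u ^ j / (j.factorial : ℝ)) u := by
      intro u
      refine (hd 0 u).sub ?_
      have : HasDerivAt (fun t : ℝ => ∑ j ∈ Finset.range (n+1), H j 0 * t ^ j / (j.factorial : ℝ)) (∑ j ∈ Finset.range (n+1), H j 0 * (j * u ^ (j-1)) / (j.factorial : ℝ)) u := by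
        refine HasDerivAt.fun_sum fun j _ => ?_
        exact ((hasDerivAt_pow j u).const_mul _).div_const _
      refine this.congr_deriv ?_
      rw [Finset.sum_range_succ']
      simp only [Nat.cast_zero, zero_mul, mul_zero, zero_div, add_zero, Nat.add_sub_cancel]
      refine Finset.sum_congr rfl fun j _ => ?_
      rw [Nat.factorial_succ]; push_cast
      have : (j.factorial : ℝ) ≠ 0 := by positivity
      field_simp
    have h0 : d 0 = 0 := by
      simp only [hdd]; rw [Finset.sum_range_succ']; simp
    have hM : 0 ≤ M := (abs_nonneg _).trans (hb 0 (by simpa using (abs_nonneg t).trans ht))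
    have key := Convex.norm_image_sub_le_of_norm_hasDerivWithin_le (f := d) (s := Icc (-|t|) |t|) (C := M * |t| ^ n) (x := 0) (y := t)
      (fun u _ => (hder u).hasDerivWithinAt) (fun u hu => by
        have hu' : |u| ≤ |t| := abs_le.2 hu
        refine (h1 u (hu'.trans ht)).trans ?_
        gcongr) (convex_Icc _ _) ⟨by simp, by simp⟩ ⟨neg_abs_le t, le_abs_self t⟩
    rw [h0, sub_zero, sub_zero, Real.norm_eq_abs, Real.norm_eq_abs] at key
    rw [pow_succ, ← mul_assoc]
    exact key

lemma jet_dx0 {R : ℝ × ℝ → ℝ} (hR : ContDiff ℝ (⊤ : ℕ∞) R) {n : ℕ} (hn : n ≤ 5)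
    (h : R =o[𝓝 (0 : ℝ × ℝ)] fun p => ‖p‖ ^ (n+1)) : pdx R =o[𝓝 (0 : ℝ × ℝ)] fun p => ‖p‖ ^ n := by
  have sm : ∀ i, ContDiff ℝ (⊤ : ℕ∞) (pdx^[i] R) := by
    intro i; induction i with
    | zero => exact hR
    | succ i ih => rw [Function.iterate_succ', Function.comp]; exact pdx_smooth ih
  have hd : ∀ (p : ℝ × ℝ) i t, HasDerivAt (fun t => (pdx^[i] R) (p.1 + t, p.2)) ((pdx^[i+1] R) (p.1 + t, p.2)) t := by
    intro p i t
    rw [Function.iterate_succ', Function.comp, pdx_eq (sm i)]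
    have h1 : HasDerivAt (fun s : ℝ => (p.1 + s, p.2)) ((1:ℝ), (0:ℝ)) t := ((hasDerivAt_id t).const_add _).prodMk (hasDerivAt_const _ _)
    exact ((sm i).differentiable (by simp) _).hasFDerivAt.comp_hasDerivAt t h1
  set M := |(pdx^[7] R) 0| + 1 with hM
  have M0 : 0 < M := by positivity
  have bd : ∀ᶠ p in 𝓝 (0 : ℝ × ℝ), |(pdx^[7] R) p| ≤ M := (sm 7).continuous.continuousAt.abs.eventually_le_const (by linarith)
  rw [isLittleO_iff] at h ⊢
  intro ε hε
  set c := ε / (4 * 4 ^ (n+1)) with hc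
  have c0 : 0 < c := by positivity
  obtain ⟨δ, δ0, hδ⟩ := Metric.eventually_nhds_iff.1 (bd.and (h c0))
  have ev : ∀ᶠ p in 𝓝 (0 : ℝ × ℝ), ‖p‖ < min (δ/4) (min 1 (ε / (400 * M))) := by
    have : Continuous fun p : ℝ × ℝ => ‖p‖ := continuous_norm
    refine this.continuousAt.eventually_lt_const ?_
    show ‖(0:ℝ×ℝ)‖ < _
    rw [norm_zero]; positivity
  filter_upwards [ev] with p hp
  rw [lt_min_iff, lt_min_iff] at hp
  obtain ⟨p1, p2, p3⟩ := hp
  rcases (norm_nonneg p).eq_or_lt with hz | hz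
  · have p0 : p = 0 := norm_eq_zero.1 hz.symm
    have hh : ∀ t : ℝ, |t| < δ → |R (t, 0)| ≤ c * |t| ^ (n+1) := by
      intro t ht
      have nt : ‖((t, 0) : ℝ × ℝ)‖ = |t| := by simp [Prod.norm_def]
      have := (hδ (y := (t, 0)) (by rw [dist_zero_right, nt]; exact ht)).2
      rw [norm_pow, nt] at this; simpa using this
    rcases Nat.eq_zero_or_pos n with n0 | n0
    · subst n0
      rw [p0]
      have d1 := hd 0 0 0
      simp only [Function.iterate_zero, id, zero_add, Function.iterate_succ, Function.comp, Prod.fst_zero, Prod.snd_zero] at d1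
      have R0 : R (0, 0) = 0 := by have := hh 0 (by simpa using δ0); simpa using this
      have := d1.le_of_lip' (C := c) c0.le (by
        filter_upwards [Metric.ball_mem_nhds (0:ℝ) δ0] with t ht
        rw [mem_ball_zero_iff] at ht
        have := hh t ht
        rw [R0]; simpa using this)
      have cε : c ≤ ε := by rw [hc]; apply div_le_self hε.le; norm_num
      have e0 : ((0:ℝ), (0:ℝ)) = 0 := rfl
      rw [e0] at this
      simp only [pow_zero, norm_one, mul_one]
      exact this.trans cε
    · rw [p0]
      have d1 := hd 0 0 0
      simp only [Function.iterate_zero, id, zero_add, Function.iterate_succ, Function.comp, Prod.fst_zero, Prod.snd_zero] at d1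
      have R0 : R (0, 0) = 0 := by have := hh 0 (by simpa using δ0); simpa using this
      have d2 : HasDerivAt (fun t => R (t, 0)) 0 0 := by
        rw [hasDerivAt_iff_isLittleO, R0]
        simp only [sub_zero, smul_zero]
        have b1 : (fun t => R (t, 0)) =O[𝓝 (0:ℝ)] fun t => t ^ (n+1) := by
          refine IsBigO.of_bound c ?_
          filter_upwards [Metric.ball_mem_nhds (0:ℝ) δ0] with t ht
          rw [mem_ball_zero_iff] at ht
          simpa using hh t ht
        exact b1.trans_isLittleO (by simpa using isLittleO_pow_pow (𝕜 := ℝ) (show 1 < n + 1 by omega))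
      have := d1.unique d2
      have e0 : ((0:ℝ), (0:ℝ)) = 0 := rfl
      rw [e0] at this
      rw [this]; simp; positivity
  set ρ := ‖p‖ with hρ
  have inb : ∀ t, |t| ≤ 3 * ρ → ‖((p.1 + t, p.2) : ℝ × ℝ)‖ ≤ 4 * ρ := by
    intro t ht
    have q1 : |p.1| ≤ ρ := norm_fst_le p
    have q2 : |p.2| ≤ ρ := norm_snd_le p
    rw [Prod.norm_def]
    refine max_le ?_ ?_
    · rw [Real.norm_eq_abs]; have := abs_add_le p.1 t; linarith
    · rw [Real.norm_eq_abs]; linarith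
  have ind : ∀ t, |t| ≤ 3 * ρ → dist ((p.1 + t, p.2) : ℝ × ℝ) 0 < δ := by
    intro t ht; rw [dist_zero_right]; have := inb t ht; linarith
  have tc := taylor_chain 7 (M := M) (T := 3 * ρ) (fun i t => (pdx^[i] R) (p.1 + t, p.2)) (hd p)
    (fun t ht => (hδ (ind t ht)).1)
  have rb : ∀ t, |t| ≤ 3 * ρ → |R (p.1 + t, p.2)| ≤ c * (4 * ρ) ^ (n+1) := by
    intro t ht
    have := (hδ (ind t ht)).2
    rw [norm_pow, norm_norm] at this
    refine this.trans ?_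
    gcongr
    exact inb t ht
  have ab : ∀ k : ℝ, 0 ≤ k → k ≤ 3 → |k * ρ| ≤ 3 * ρ ∧ |-(k * ρ)| ≤ 3 * ρ := by
    intro k k0 k3
    rw [abs_neg, abs_of_nonneg (by positivity)]
    exact ⟨by nlinarith, by nlinarith⟩
  have t1 := tc _ (ab 1 (by norm_num) (by norm_num)).1
  have t1' := tc _ (ab 1 (by norm_num) (by norm_num)).2
  have t2 := tc _ (ab 2 (by norm_num) (by norm_num)).1
  have t2' := tc _ (ab 2 (by norm_num) (by norm_num)).2
  have t3 := tc _ (ab 3 (by norm_num) (by norm_num)).1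
  have t3' := tc _ (ab 3 (by norm_num) (by norm_num)).2
  have r1 := rb _ (ab 1 (by norm_num) (by norm_num)).1
  have r1' := rb _ (ab 1 (by norm_num) (by norm_num)).2
  have r2 := rb _ (ab 2 (by norm_num) (by norm_num)).1
  have r2' := rb _ (ab 2 (by norm_num) (by norm_num)).2
  have r3 := rb _ (ab 3 (by norm_num) (by norm_num)).1
  have r3' := rb _ (ab 3 (by norm_num) (by norm_num)).2
  simp only [Finset.sum_range_succ, Finset.sum_range_zero, abs_neg, abs_of_nonneg (show (0:ℝ) ≤ 1 * ρ by positivity),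
    abs_of_nonneg (show (0:ℝ) ≤ 2 * ρ by positivity), abs_of_nonneg (show (0:ℝ) ≤ 3 * ρ by positivity), Nat.factorial] at t1 t1' t2 t2' t3 t3'
  have e0 : (pdx^[0] R) = R := rfl
  have e1 : (pdx^[1] R) = pdx R := rfl
  have ep : ((p.1 + 0, p.2) : ℝ × ℝ) = p := by simp
  rw [e0, e1, ep] at t1 t1' t2 t2' t3 t3'
  generalize R (p.1 + 1 * ρ, p.2) = u1 at *
  generalize R (p.1 + -(1 * ρ), p.2) = u1' at *
  generalize R (p.1 + 2 * ρ, p.2) = u2 at *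
  generalize R (p.1 + -(2 * ρ), p.2) = u2' at *
  generalize R (p.1 + 3 * ρ, p.2) = u3 at *
  generalize R (p.1 + -(3 * ρ), p.2) = u3' at *
  generalize (pdx^[2] R) p = g2 at *
  generalize (pdx^[3] R) p = g3 at *
  generalize (pdx^[4] R) p = g4 at *
  generalize (pdx^[5] R) p = g5 at *
  generalize (pdx^[6] R) p = g6 at *
  generalize R p = g0 at *
  generalize pdx R p = g1 at *
  have main : |g1 * ρ| ≤ 2 * (c * (4 * ρ) ^ (n+1)) + 200 * M * ρ ^ 7 := by
    push_cast at t1 t1' t2 t2' t3 t3'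
    rw [abs_le] at *
    have hpp : 0 ≤ c * (4 * ρ) ^ (n+1) := by positivity
    generalize c * (4 * ρ) ^ (n+1) = w at *
    have hq : 0 ≤ M * ρ ^ 7 := by positivity
    generalize hQ : M * ρ ^ 7 = Q at *
    have hQ1 : M * (1 * ρ) ^ 7 = Q := by rw [← hQ]; ring
    have hQ2 : M * (2 * ρ) ^ 7 = 128 * Q := by rw [← hQ]; ring
    have hQ3 : M * (3 * ρ) ^ 7 = 2187 * Q := by rw [← hQ]; ring
    have hQ4 : 200 * M * ρ ^ 7 = 200 * Q := by rw [← hQ]; ring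
    rw [hQ1] at t1 t1'
    rw [hQ2] at t2 t2'
    rw [hQ3] at t3 t3'
    rw [hQ4]
    ring_nf at *
    constructor <;> linarith
  have f1 : |g1| * ρ ≤ (ε * ρ ^ n) * ρ := by
    rw [abs_mul, abs_of_pos hz] at main
    refine main.trans ?_
    have q1 : 2 * (c * (4 * ρ) ^ (n+1)) = ε / 2 * (ρ ^ n * ρ) := by
      rw [hc, mul_pow, pow_succ ρ n]; field_simp; norm_num
    have q2 : 200 * M * ρ ^ 7 ≤ ε / 2 * (ρ ^ n * ρ) := by
      have w1 : ρ ^ 5 ≤ ρ ^ n := pow_le_pow_of_le_one hz.le p2.le hn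
      have w2 : 400 * M * ρ ≤ ε := by rw [lt_div_iff₀ (by positivity)] at p3; linarith
      calc 200 * M * ρ ^ 7 = (400 * M * ρ) / 2 * (ρ ^ 5 * ρ) := by ring
        _ ≤ _ := by gcongr
    rw [q1]; linarith
  have := le_of_mul_le_mul_right f1 hz
  rw [norm_pow, norm_norm]
  exact this

end PartTwelve

section PartThirteen
open Topology

lemma jet_dy0 {R : ℝ × ℝ → ℝ} (hR : ContDiff ℝ (⊤ : ℕ∞) R) {n : ℕ} (hn : n ≤ 5)
    (h : R =o[𝓝 (0 : ℝ × ℝ)] fun p => ‖p‖ ^ (n+1)) : pdy R =o[𝓝 (0 : ℝ × ℝ)] fun p => ‖p‖ ^ n := by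
  have ns : ∀ p : ℝ × ℝ, ‖p.swap‖ = ‖p‖ := fun p => by rw [Prod.norm_def, Prod.norm_def]; exact max_comm _ _
  have ts : Tendsto (Prod.swap : ℝ × ℝ → ℝ × ℝ) (𝓝 0) (𝓝 0) := by
    have := (continuous_swap (X := ℝ) (Y := ℝ)).tendsto 0
    simpa using this
  have h1 : (fun p : ℝ × ℝ => R p.swap) =o[𝓝 (0 : ℝ × ℝ)] fun p => ‖p‖ ^ (n+1) := by
    have := h.comp_tendsto ts
    refine this.congr_right fun p => ?_
    show ‖p.swap‖ ^ (n+1) = _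
    rw [ns]
  have h2 := jet_dx0 (R := fun p : ℝ × ℝ => R p.swap) (hR.comp (contDiff_snd.prodMk contDiff_fst)) hn h1
  have h3 := h2.comp_tendsto ts
  refine (h3.congr_right fun p => ?_).congr_left fun p => ?_
  · show ‖p.swap‖ ^ n = _
    rw [ns]
  · rfl

lemma poly6 (q0 q1 q2 q3 q4 q5 q6 s : ℝ) : HasDerivAt (fun s => q0 + q1 * s + q2 * s^2 + q3 * s^3 + q4 * s^4 + q5 * s^5 + q6 * s^6)
    (q1 + 2 * q2 * s + 3 * q3 * s^2 + 4 * q4 * s^3 + 5 * q5 * s^4 + 6 * q6 * s^5) s := by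
  have h := ((((((hasDerivAt_const s q0).add ((hasDerivAt_id s).const_mul q1)).add ((hasDerivAt_pow 2 s).const_mul q2)).add
    ((hasDerivAt_pow 3 s).const_mul q3)).add ((hasDerivAt_pow 4 s).const_mul q4)).add ((hasDerivAt_pow 5 s).const_mul q5)).add
    ((hasDerivAt_pow 6 s).const_mul q6)
  refine h.congr_deriv ?_
  push_cast; ring

lemma jet_dx {f P P' : ℝ × ℝ → ℝ} (hf : ContDiff ℝ (⊤ : ℕ∞) f) (hP : ContDiff ℝ (⊤ : ℕ∞) P) {n : ℕ} (hn : n ≤ 5)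
    (h : HasJetAt0 f P (n+1)) (q0 q1 q2 q3 q4 q5 q6 : ℝ → ℝ)
    (h1 : ∀ x y, P (x, y) = q0 y + q1 y * x + q2 y * x^2 + q3 y * x^3 + q4 y * x^4 + q5 y * x^5 + q6 y * x^6)
    (h2 : ∀ x y, P' (x, y) = q1 y + 2 * q2 y * x + 3 * q3 y * x^2 + 4 * q4 y * x^3 + 5 * q5 y * x^4 + 6 * q6 y * x^5) :
    HasJetAt0 (pdx f) P' n := by
  refine (jet_dx0 (hf.sub hP) hn h).congr_left fun p => ?_
  have d1 := pdx_fderiv (hf.differentiable (by simp) p)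
  have d2 : HasDerivAt (fun s => P (s, p.2)) (P' p) p.1 := by
    simp only [h1]
    refine (poly6 _ _ _ _ _ _ _ _).congr_deriv ?_
    rw [← h2]
  have := (d1.sub d2).deriv
  rw [pdx_eq hf]
  exact this

lemma jet_dy {f P P' : ℝ × ℝ → ℝ} (hf : ContDiff ℝ (⊤ : ℕ∞) f) (hP : ContDiff ℝ (⊤ : ℕ∞) P) {n : ℕ} (hn : n ≤ 5)
    (h : HasJetAt0 f P (n+1)) (q0 q1 q2 q3 q4 q5 q6 : ℝ → ℝ)
    (h1 : ∀ x y, P (x, y) = q0 x + q1 x * y + q2 x * y^2 + q3 x * y^3 + q4 x * y^4 + q5 x * y^5 + q6 x * y^6)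
    (h2 : ∀ x y, P' (x, y) = q1 x + 2 * q2 x * y + 3 * q3 x * y^2 + 4 * q4 x * y^3 + 5 * q5 x * y^4 + 6 * q6 x * y^5) :
    HasJetAt0 (pdy f) P' n := by
  refine (jet_dy0 (hf.sub hP) hn h).congr_left fun p => ?_
  have d1 := pdy_fderiv (hf.differentiable (by simp) p)
  have d2 : HasDerivAt (fun s => P (p.1, s)) (P' p) p.2 := by
    simp only [h1]
    refine (poly6 _ _ _ _ _ _ _ _).congr_deriv ?_
    rw [← h2]
  have := (d1.sub d2).deriv
  rw [pdy_eq hf]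
  exact this

lemma jets (c41 d31 d22 d13 d04 c60 e51 e42 e33 e24 e15 e06 : ℝ) {f : ℝ × ℝ → ℝ} (hf : ContDiff ℝ (⊤ : ℕ∞) f)
    (h : HasJetAt0 f (fun p => p.2^2 + p.1^2 * p.2 + (1/4) * p.1^4 + c41 * p.1^4 * p.2 + d31 * p.1^3 * p.2^2 + d22 * p.1^2 * p.2^3 + d13 * p.1 * p.2^4 + d04 * p.2^5 + c60 * p.1^6 + e51 * p.1^5 * p.2 + e42 * p.1^4 * p.2^2 + e33 * p.1^3 * p.2^3 + e24 * p.1^2 * p.2^4 + e15 * p.1 * p.2^5 + e06 * p.2^6) 6) :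
    HasJetAt0 (fxx f) (fun p => 2 * p.2 + 3 * p.1^2 + 12 * c41 * p.1^2 * p.2 + 6 * d31 * p.1 * p.2^2 + 2 * d22 * p.2^3 + 30 * c60 * p.1^4 + 20 * e51 * p.1^3 * p.2 + 12 * e42 * p.1^2 * p.2^2 + 6 * e33 * p.1 * p.2^3 + 2 * e24 * p.2^4) 4 ∧
    HasJetAt0 (fxy f) (fun p => 2 * p.1 + 4 * c41 * p.1^3 + 6 * d31 * p.1^2 * p.2 + 6 * d22 * p.1 * p.2^2 + 4 * d13 * p.2^3 + 5 * e51 * p.1^4 + 8 * e42 * p.1^3 * p.2 + 9 * e33 * p.1^2 * p.2^2 + 8 * e24 * p.1 * p.2^3 + 5 * e15 * p.2^4) 4 ∧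
    HasJetAt0 (fyy f) (fun p => 2 + 2 * d31 * p.1^3 + 6 * d22 * p.1^2 * p.2 + 12 * d13 * p.1 * p.2^2 + 20 * d04 * p.2^3 + 2 * e42 * p.1^4 + 6 * e33 * p.1^3 * p.2 + 12 * e24 * p.1^2 * p.2^2 + 20 * e15 * p.1 * p.2^3 + 30 * e06 * p.2^4) 4 ∧
    HasJetAt0 (pdx (fxx f)) (fun p => 6 * p.1 + 24 * c41 * p.1 * p.2 + 6 * d31 * p.2^2 + 120 * c60 * p.1^3 + 60 * e51 * p.1^2 * p.2 + 24 * e42 * p.1 * p.2^2 + 6 * e33 * p.2^3) 3 ∧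
    HasJetAt0 (pdy (fxx f)) (fun p => 2 + 12 * c41 * p.1^2 + 12 * d31 * p.1 * p.2 + 6 * d22 * p.2^2 + 20 * e51 * p.1^3 + 24 * e42 * p.1^2 * p.2 + 18 * e33 * p.1 * p.2^2 + 8 * e24 * p.2^3) 3 ∧
    HasJetAt0 (pdx (fxy f)) (fun p => 2 + 12 * c41 * p.1^2 + 12 * d31 * p.1 * p.2 + 6 * d22 * p.2^2 + 20 * e51 * p.1^3 + 24 * e42 * p.1^2 * p.2 + 18 * e33 * p.1 * p.2^2 + 8 * e24 * p.2^3) 3 ∧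
    HasJetAt0 (pdy (fxy f)) (fun p => 6 * d31 * p.1^2 + 12 * d22 * p.1 * p.2 + 12 * d13 * p.2^2 + 8 * e42 * p.1^3 + 18 * e33 * p.1^2 * p.2 + 24 * e24 * p.1 * p.2^2 + 20 * e15 * p.2^3) 3 ∧
    HasJetAt0 (pdx (fyy f)) (fun p => 6 * d31 * p.1^2 + 12 * d22 * p.1 * p.2 + 12 * d13 * p.2^2 + 8 * e42 * p.1^3 + 18 * e33 * p.1^2 * p.2 + 24 * e24 * p.1 * p.2^2 + 20 * e15 * p.2^3) 3 ∧
    HasJetAt0 (pdy (fyy f)) (fun p => 6 * d22 * p.1^2 + 24 * d13 * p.1 * p.2 + 60 * d04 * p.2^2 + 6 * e33 * p.1^3 + 24 * e24 * p.1^2 * p.2 + 60 * e15 * p.1 * p.2^2 + 120 * e06 * p.2^3) 3 := by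
  have sx := pdx_smooth hf
  have sy := pdy_smooth hf
  have sxx := pdx_smooth sx
  have sxy := pdy_smooth sx
  have syy := pdy_smooth sy
  have jx : HasJetAt0 (pdx f) (fun p => 2 * p.1 * p.2 + p.1^3 + 4 * c41 * p.1^3 * p.2 + 3 * d31 * p.1^2 * p.2^2 + 2 * d22 * p.1 * p.2^3 + d13 * p.2^4 + 6 * c60 * p.1^5 + 5 * e51 * p.1^4 * p.2 + 4 * e42 * p.1^3 * p.2^2 + 3 * e33 * p.1^2 * p.2^3 + 2 * e24 * p.1 * p.2^4 + e15 * p.2^5) 5 := jet_dx hf (by fun_prop) (by norm_num) h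
    (fun y => y^2 + d04 * y^5 + e06 * y^6) (fun y => d13 * y^4 + e15 * y^5) (fun y => y + d22 * y^3 + e24 * y^4) (fun y => d31 * y^2 + e33 * y^3) (fun y => (1/4) + c41 * y + e42 * y^2) (fun y => e51 * y) (fun y => c60) (by intro x y; simp only [Pi.zero_apply]; ring) (by intro x y; simp only [Pi.zero_apply]; ring)
  have jy : HasJetAt0 (pdy f) (fun p => 2 * p.2 + p.1^2 + c41 * p.1^4 + 2 * d31 * p.1^3 * p.2 + 3 * d22 * p.1^2 * p.2^2 + 4 * d13 * p.1 * p.2^3 + 5 * d04 * p.2^4 + e51 * p.1^5 + 2 * e42 * p.1^4 * p.2 + 3 * e33 * p.1^3 * p.2^2 + 4 * e24 * p.1^2 * p.2^3 + 5 * e15 * p.1 * p.2^4 + 6 * e06 * p.2^5) 5 := jet_dy hf (by fun_prop) (by norm_num) h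
    (fun y => (1/4) * y^4 + c60 * y^6) (fun y => y^2 + c41 * y^4 + e51 * y^5) (fun y => 1 + d31 * y^3 + e42 * y^4) (fun y => d22 * y^2 + e33 * y^3) (fun y => d13 * y + e24 * y^2) (fun y => d04 + e15 * y) (fun y => e06) (by intro x y; simp only [Pi.zero_apply]; ring) (by intro x y; simp only [Pi.zero_apply]; ring)
  have jxx : HasJetAt0 (pdx (pdx f)) (fun p => 2 * p.2 + 3 * p.1^2 + 12 * c41 * p.1^2 * p.2 + 6 * d31 * p.1 * p.2^2 + 2 * d22 * p.2^3 + 30 * c60 * p.1^4 + 20 * e51 * p.1^3 * p.2 + 12 * e42 * p.1^2 * p.2^2 + 6 * e33 * p.1 * p.2^3 + 2 * e24 * p.2^4) 4 := jet_dx sx (by fun_prop) (by norm_num) jx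
    (fun y => d13 * y^4 + e15 * y^5) (fun y => 2 * y + 2 * d22 * y^3 + 2 * e24 * y^4) (fun y => 3 * d31 * y^2 + 3 * e33 * y^3) (fun y => 1 + 4 * c41 * y + 4 * e42 * y^2) (fun y => 5 * e51 * y) (fun y => 6 * c60) 0 (by intro x y; simp only [Pi.zero_apply]; ring) (by intro x y; simp only [Pi.zero_apply]; ring)
  have jxy : HasJetAt0 (pdy (pdx f)) (fun p => 2 * p.1 + 4 * c41 * p.1^3 + 6 * d31 * p.1^2 * p.2 + 6 * d22 * p.1 * p.2^2 + 4 * d13 * p.2^3 + 5 * e51 * p.1^4 + 8 * e42 * p.1^3 * p.2 + 9 * e33 * p.1^2 * p.2^2 + 8 * e24 * p.1 * p.2^3 + 5 * e15 * p.2^4) 4 := jet_dy sx (by fun_prop) (by norm_num) jx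
    (fun y => y^3 + 6 * c60 * y^5) (fun y => 2 * y + 4 * c41 * y^3 + 5 * e51 * y^4) (fun y => 3 * d31 * y^2 + 4 * e42 * y^3) (fun y => 2 * d22 * y + 3 * e33 * y^2) (fun y => d13 + 2 * e24 * y) (fun y => e15) 0 (by intro x y; simp only [Pi.zero_apply]; ring) (by intro x y; simp only [Pi.zero_apply]; ring)
  have jyy : HasJetAt0 (pdy (pdy f)) (fun p => 2 + 2 * d31 * p.1^3 + 6 * d22 * p.1^2 * p.2 + 12 * d13 * p.1 * p.2^2 + 20 * d04 * p.2^3 + 2 * e42 * p.1^4 + 6 * e33 * p.1^3 * p.2 + 12 * e24 * p.1^2 * p.2^2 + 20 * e15 * p.1 * p.2^3 + 30 * e06 * p.2^4) 4 := jet_dy sy (by fun_prop) (by norm_num) jy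
    (fun y => y^2 + c41 * y^4 + e51 * y^5) (fun y => 2 + 2 * d31 * y^3 + 2 * e42 * y^4) (fun y => 3 * d22 * y^2 + 3 * e33 * y^3) (fun y => 4 * d13 * y + 4 * e24 * y^2) (fun y => 5 * d04 + 5 * e15 * y) (fun y => 6 * e06) 0 (by intro x y; simp only [Pi.zero_apply]; ring) (by intro x y; simp only [Pi.zero_apply]; ring)
  exact ⟨jxx,
    jxy,
    jyy,
    jet_dx sxx (by fun_prop) (by norm_num) jxx
    (fun y => 2 * y + 2 * d22 * y^3 + 2 * e24 * y^4) (fun y => 6 * d31 * y^2 + 6 * e33 * y^3) (fun y => 3 + 12 * c41 * y + 12 * e42 * y^2) (fun y => 20 * e51 * y) (fun y => 30 * c60) 0 0 (by intro x y; simp only [Pi.zero_apply]; ring) (by intro x y; simp only [Pi.zero_apply]; ring),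
    jet_dy sxx (by fun_prop) (by norm_num) jxx
    (fun y => 3 * y^2 + 30 * c60 * y^4) (fun y => 2 + 12 * c41 * y^2 + 20 * e51 * y^3) (fun y => 6 * d31 * y + 12 * e42 * y^2) (fun y => 2 * d22 + 6 * e33 * y) (fun y => 2 * e24) 0 0 (by intro x y; simp only [Pi.zero_apply]; ring) (by intro x y; simp only [Pi.zero_apply]; ring),
    jet_dx sxy (by fun_prop) (by norm_num) jxy
    (fun y => 4 * d13 * y^3 + 5 * e15 * y^4) (fun y => 2 + 6 * d22 * y^2 + 8 * e24 * y^3) (fun y => 6 * d31 * y + 9 * e33 * y^2) (fun y => 4 * c41 + 8 * e42 * y) (fun y => 5 * e51) 0 0 (by intro x y; simp only [Pi.zero_apply]; ring) (by intro x y; simp only [Pi.zero_apply]; ring),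
    jet_dy sxy (by fun_prop) (by norm_num) jxy
    (fun y => 2 * y + 4 * c41 * y^3 + 5 * e51 * y^4) (fun y => 6 * d31 * y^2 + 8 * e42 * y^3) (fun y => 6 * d22 * y + 9 * e33 * y^2) (fun y => 4 * d13 + 8 * e24 * y) (fun y => 5 * e15) 0 0 (by intro x y; simp only [Pi.zero_apply]; ring) (by intro x y; simp only [Pi.zero_apply]; ring),
    jet_dx syy (by fun_prop) (by norm_num) jyy
    (fun y => 2 + 20 * d04 * y^3 + 30 * e06 * y^4) (fun y => 12 * d13 * y^2 + 20 * e15 * y^3) (fun y => 6 * d22 * y + 12 * e24 * y^2) (fun y => 2 * d31 + 6 * e33 * y) (fun y => 2 * e42) 0 0 (by intro x y; simp only [Pi.zero_apply]; ring) (by intro x y; simp only [Pi.zero_apply]; ring),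
    jet_dy syy (by fun_prop) (by norm_num) jyy
    (fun y => 2 + 2 * d31 * y^3 + 2 * e42 * y^4) (fun y => 6 * d22 * y^2 + 6 * e33 * y^3) (fun y => 12 * d13 * y + 12 * e24 * y^2) (fun y => 20 * d04 + 20 * e15 * y) (fun y => 30 * e06) 0 0 (by intro x y; simp only [Pi.zero_apply]; ring) (by intro x y; simp only [Pi.zero_apply]; ring)⟩

end PartThirteen

section PartFourteen
open Topology

lemma lim_jet {l : Filter (ℝ × ℝ)} (le : l ≤ 𝓝 0) (hn : ∀ᶠ p in l, p.1 ≠ 0 ∧ ‖p‖ = |p.1|) (w : ℕ) {k : ℝ × ℝ → ℝ} {κ : ℝ}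
    (hy : ∀ᶠ p in l, p.2 = k p * p.1 ^ w) (hk : Tendsto k l (𝓝 κ)) {g P : ℝ × ℝ → ℝ} {n : ℕ} (h : HasJetAt0 g P n)
    (G : ℝ → ℝ → ℝ → ℝ) (cG : Continuous fun q : ℝ × ℝ × ℝ => G q.1 q.2.1 q.2.2) (m : ℕ) (g0 : ℝ × ℝ → ℝ)
    (alg : ∀ x k r, P (x, k * x ^ w) + r * x ^ n - g0 (x, k * x ^ w) = x ^ m * G x k r) :
    ∃ T : ℝ × ℝ → ℝ, (∀ᶠ p in l, g p = g0 p + p.1 ^ m * T p) ∧ Tendsto T l (𝓝 (G 0 κ 0)) := by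
  have h1 : (fun p => g p - P p) =o[l] fun p => p.1 ^ n := by
    refine (IsLittleO.mono h le).trans_isBigO (IsBigO.of_bound 1 ?_)
    filter_upwards [hn] with p hp
    rw [hp.2]; simp
  have h2 := h1.tendsto_div_nhds_zero
  have tx : Tendsto (fun p : ℝ × ℝ => p.1) l (𝓝 0) := (continuous_fst.tendsto' 0 0 rfl).mono_left le
  refine ⟨fun p => G p.1 (k p) ((g p - P p) / p.1 ^ n), ?_, ?_⟩
  · filter_upwards [hn, hy] with p hp hyp
    have := alg p.1 (k p) ((g p - P p) / p.1 ^ n)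
    rw [← hyp, div_mul_cancel₀ _ (pow_ne_zero n hp.1)] at this
    rw [← this]
    simp
  · exact (cG.tendsto (0, κ, 0)).comp (tx.prodMk_nhds (hk.prodMk_nhds h2))

lemma asym_lim (c41 d31 d22 d13 d04 c60 e51 e42 e33 e24 e15 e06 : ℝ) {f : ℝ × ℝ → ℝ} (hf : ContDiff ℝ (⊤ : ℕ∞) f) (h : HasJetAt0 f (fun p => p.2^2 + p.1^2 * p.2 + (1/4) * p.1^4 + c41 * p.1^4 * p.2 + d31 * p.1^3 * p.2^2 + d22 * p.1^2 * p.2^3 + d13 * p.1 * p.2^4 + d04 * p.2^5 + c60 * p.1^6 + e51 * p.1^5 * p.2 + e42 * p.1^4 * p.2^2 + e33 * p.1^3 * p.2^3 + e24 * p.1^2 * p.2^4 + e15 * p.1 * p.2^5 + e06 * p.2^6) 6)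
    : (∀ᶠ p in 𝓝 (0 : ℝ × ℝ), fxy f p ^ 2 - fxx f p * fyy f p = 0 → p.1 = 0 → p = 0) ∧
    Tendsto (fun p : ℝ × ℝ => (fyy f p * (2 * fxy f p * pdx (fxy f) p - pdx (fyy f) p * fxx f p - fyy f p * pdx (fxx f) p) - fxy f p * (2 * fxy f p * pdy (fxy f) p - pdy (fyy f) p * fxx f p - fyy f p * pdy (fxx f) p)) / p.1 ^ 3)
      (𝓝[{p | fxy f p ^ 2 - fxx f p * fyy f p = 0 ∧ p.1 ≠ 0}] 0) (𝓝 (-480 * (c60 - 1/2 * c41))) := by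
  obtain ⟨hc, hb, ha, hcx, hcy, hbx, hby, hax, hay⟩ := jets c41 d31 d22 d13 d04 c60 e51 e42 e33 e24 e15 e06 hf h
  generalize pdx (fyy f) = ax, pdy (fyy f) = ay, pdx (fxy f) = bx, pdy (fxy f) = by', pdx (fxx f) = cx, pdy (fxx f) = cy at *
  generalize fyy f = a, fxy f = b, fxx f = c at *
  have x1 : (fun p : ℝ × ℝ => p.1) =O[𝓝 (0 : ℝ × ℝ)] fun p => ‖p‖ := IsBigO.of_bound 1 (Eventually.of_forall fun p => by simpa using norm_fst_le p)
  have y1 : (fun p : ℝ × ℝ => p.2) =O[𝓝 (0 : ℝ × ℝ)] fun p => ‖p‖ := IsBigO.of_bound 1 (Eventually.of_forall fun p => by simpa using norm_snd_le p)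
  have n0 : Tendsto (fun p : ℝ × ℝ => ‖p‖) (𝓝 0) (𝓝 0) := by simpa using (continuous_norm (E := ℝ × ℝ)).tendsto 0
  have n4 : (fun p : ℝ × ℝ => ‖p‖ ^ 4) =o[𝓝 (0 : ℝ × ℝ)] fun p => ‖p‖ := by
    have := (isLittleO_pow_pow (𝕜 := ℝ) (show 1 < 4 by norm_num)).comp_tendsto n0
    simpa [Function.comp_def] using this
  have F1 : (fun p : ℝ × ℝ => c p - 2 * p.2) =o[𝓝 (0 : ℝ × ℝ)] fun p => ‖p‖ := by
    have u : Tendsto (fun p : ℝ × ℝ => 3 * p.1 + 12 * c41 * p.1 * p.2 + 6 * d31 * p.2^2 + 30 * c60 * p.1^3 + 20 * e51 * p.1^2 * p.2 + 12 * e42 * p.1 * p.2^2 + 6 * e33 * p.2^3) (𝓝 0) (𝓝 0) := by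
      refine Continuous.tendsto' (by fun_prop) _ _ ?_
      simp
    have v : Tendsto (fun p : ℝ × ℝ => 2 * d22 * p.2^2 + 2 * e24 * p.2^3) (𝓝 0) (𝓝 0) := by
      refine Continuous.tendsto' (by fun_prop) _ _ ?_
      simp
    have := ((x1.mul_isLittleO ((isLittleO_one_iff ℝ).2 u)).add (y1.mul_isLittleO ((isLittleO_one_iff ℝ).2 v))).congr_right (fun p => mul_one _)
    refine ((hc.trans n4).add this).congr_left fun p => ?_
    ring
  have F2 : b =O[𝓝 (0 : ℝ × ℝ)] fun p => ‖p‖ := by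
    have u : (fun p : ℝ × ℝ => 2 + 4 * c41 * p.1^2 + 6 * d31 * p.1 * p.2 + 6 * d22 * p.2^2 + 5 * e51 * p.1^3 + 8 * e42 * p.1^2 * p.2 + 9 * e33 * p.1 * p.2^2 + 8 * e24 * p.2^3) =O[𝓝 (0 : ℝ × ℝ)] fun _ => (1:ℝ) :=
      Tendsto.isBigO_one ℝ (Continuous.tendsto (by fun_prop) 0)
    have v : (fun p : ℝ × ℝ => 4 * d13 * p.2^2 + 5 * e15 * p.2^3) =O[𝓝 (0 : ℝ × ℝ)] fun _ => (1:ℝ) :=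
      Tendsto.isBigO_one ℝ (Continuous.tendsto (by fun_prop) 0)
    have := ((x1.mul u).add (y1.mul v)).congr_right (fun p => mul_one _)
    refine ((hb.trans n4).isBigO.add this).congr_left fun p => ?_
    ring
  have F3 : Tendsto a (𝓝 0) (𝓝 2) := by
    have u : Tendsto (fun p : ℝ × ℝ => 2 + 2 * d31 * p.1^3 + 6 * d22 * p.1^2 * p.2 + 12 * d13 * p.1 * p.2^2 + 20 * d04 * p.2^3 + 2 * e42 * p.1^4 + 6 * e33 * p.1^3 * p.2 + 12 * e24 * p.1^2 * p.2^2 + 20 * e15 * p.1 * p.2^3 + 30 * e06 * p.2^4) (𝓝 0) (𝓝 2) := by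
      refine Continuous.tendsto' (by fun_prop) _ _ ?_
      simp
    have v := ((ha.trans n4).trans_tendsto n0).add u
    simpa using v
  set l := 𝓝[{p : ℝ × ℝ | b p ^ 2 - c p * a p = 0 ∧ p.1 ≠ 0}] 0 with hl
  have b0 : Tendsto b (𝓝 0) (𝓝 0) := F2.trans_tendsto n0
  have F4 : (fun p : ℝ × ℝ => b p * b p - a p * (c p - 2 * p.2)) =o[𝓝 0] fun p : ℝ × ℝ => ‖p‖ := by
    have u := (F2.mul_isLittleO ((isLittleO_one_iff ℝ).2 b0)).congr_right (fun p => mul_one _)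
    have v := ((F3.isBigO_one ℝ).mul_isLittleO F1).congr_right (fun p => one_mul _)
    exact u.sub v
  have a1 : ∀ᶠ p in 𝓝 (0 : ℝ × ℝ), 1 ≤ a p := F3.eventually_const_le (by norm_num)
  have F5 : ∀ ε > 0, ∀ᶠ p in 𝓝 (0 : ℝ × ℝ), b p ^ 2 - c p * a p = 0 → |p.2| ≤ ε * ‖p‖ := by
    intro ε hε
    filter_upwards [a1, (isLittleO_iff.1 F4) hε] with p h1 h2 h3
    have e : b p * b p - a p * (c p - 2 * p.2) = 2 * a p * p.2 := by linear_combination h3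
    rw [e, norm_mul, Real.norm_eq_abs, Real.norm_eq_abs, norm_norm, abs_of_nonneg (by linarith)] at h2
    nlinarith [abs_nonneg p.2]
  have F6 : ∀ᶠ p in 𝓝 (0 : ℝ × ℝ), b p ^ 2 - c p * a p = 0 → ‖p‖ = |p.1| := by
    filter_upwards [F5 (1/2) (by norm_num)] with p h1 h2
    have h3 := h1 h2
    have h4 : ‖p‖ = max |p.1| |p.2| := Prod.norm_def p
    rcases le_total |p.2| |p.1| with h | h
    · rw [h4, max_eq_left h]
    · have h5 : ‖p‖ = |p.2| := by rw [h4, max_eq_right h]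
      have : |p.2| = 0 := le_antisymm (by linarith) (abs_nonneg _)
      have h6 : |p.1| = 0 := le_antisymm (by linarith) (abs_nonneg _)
      rw [h5, this, h6]
  refine ⟨?_, ?_⟩
  · filter_upwards [F6] with p h1 h2 h3
    have := h1 h2
    rw [h3, abs_zero, norm_eq_zero] at this
    exact this
  have le : l ≤ 𝓝 0 := nhdsWithin_le_nhds
  have mem : ∀ᶠ p in l, b p ^ 2 - c p * a p = 0 ∧ p.1 ≠ 0 := eventually_mem_nhdsWithin
  have hn : ∀ᶠ p in l, p.1 ≠ 0 ∧ ‖p‖ = |p.1| := by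
    filter_upwards [mem, F6.filter_mono le] with p h1 h2
    exact ⟨h1.2, h2 h1.1⟩
  have t0 : Tendsto (fun p : ℝ × ℝ => p.2 / p.1) l (𝓝 0) := by
    rw [← isLittleO_one_iff ℝ, isLittleO_iff]
    intro ε hε
    filter_upwards [mem, hn, (F5 ε hε).filter_mono le] with p h1 h2 h3
    have h4 := h3 h1.1
    rw [h2.2] at h4
    rw [norm_div, norm_one, mul_one, div_le_iff₀ (norm_pos_iff.2 h1.2)]
    exact h4
  have tx : Tendsto (fun p : ℝ × ℝ => p.1) l (𝓝 0) := (continuous_fst.tendsto' 0 0 rfl).mono_left le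
  have hy1 : ∀ᶠ p in l, p.2 = p.2 / p.1 * p.1 ^ 1 := by
    filter_upwards [hn] with p h; field_simp [h.1]
  obtain ⟨Tb, eTb, tTb⟩ := lim_jet le hn 1 hy1 t0 hb (fun x k r => 2 + 4 * c41 * x^2 + 6 * d31 * x^2 * k^1 + 6 * d22 * x^2 * k^2 + 4 * d13 * x^2 * k^3 + 5 * e51 * x^3 + 8 * e42 * x^3 * k^1 + 9 * e33 * x^3 * k^2 + 8 * e24 * x^3 * k^3 + 5 * e15 * x^3 * k^4 + r * x^3) (by fun_prop) 1 (fun p => 0)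
    (by intro x k r; ring)
  replace tTb : Tendsto Tb l (𝓝 (2)) := by
    convert tTb using 2
    norm_num
    try ring
  obtain ⟨Tc, eTc, tTc⟩ := lim_jet le hn 1 hy1 t0 hc (fun x k r => 3 + 12 * c41 * x^1 * k^1 + 6 * d31 * x^1 * k^2 + 2 * d22 * x^1 * k^3 + 30 * c60 * x^2 + 20 * e51 * x^2 * k^1 + 12 * e42 * x^2 * k^2 + 6 * e33 * x^2 * k^3 + 2 * e24 * x^2 * k^4 + r * x^2) (by fun_prop) 2 (fun p => 2 * p.2)
    (by intro x k r; ring)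
  replace tTc : Tendsto Tc l (𝓝 (3)) := by
    convert tTc using 2
    norm_num
    try ring
  have k0 : Tendsto (fun p : ℝ × ℝ => p.2 / p.1 ^ 2) l (𝓝 (-1/2)) := by
    have u : Tendsto (fun p => (Tb p ^ 2 / a p - Tc p) / 2) l (𝓝 (((2:ℝ) ^ 2 / 2 - 3) / 2)) :=
      (((tTb.pow 2).div (F3.mono_left le) (by norm_num)).sub tTc).div_const 2
    have e : ((2:ℝ) ^ 2 / 2 - 3) / 2 = -1/2 := by norm_num
    rw [e] at u
    refine u.congr' ?_
    filter_upwards [mem, eTb, eTc, a1.filter_mono le] with p h1 h2 h3 h4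
    have x0 := h1.2
    have h5 := h1.1
    rw [h2, h3] at h5
    have a0 : a p ≠ 0 := by linarith
    field_simp
    linear_combination h5
  have hy2 : ∀ᶠ p in l, p.2 = p.2 / p.1 ^ 2 * p.1 ^ 2 := by
    filter_upwards [hn] with p h
    have := h.1
    field_simp
  obtain ⟨A1, eA1, tA1⟩ := lim_jet le hn 2 hy2 k0 ha (fun x k r => 2 * d31 + 6 * d22 * x^1 * k^1 + 12 * d13 * x^2 * k^2 + 20 * d04 * x^3 * k^3 + 2 * e42 * x^1 + 6 * e33 * x^2 * k^1 + 12 * e24 * x^3 * k^2 + 20 * e15 * x^4 * k^3 + 30 * e06 * x^5 * k^4 + r * x^1) (by fun_prop) 3 (fun p => 2)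
    (by intro x k r; ring)
  replace tA1 : Tendsto A1 l (𝓝 (2 * d31)) := by
    convert tA1 using 2
    norm_num
    try ring
  obtain ⟨B1, eB1, tB1⟩ := lim_jet le hn 2 hy2 k0 hb (fun x k r => 4 * c41 + 6 * d31 * x^1 * k^1 + 6 * d22 * x^2 * k^2 + 4 * d13 * x^3 * k^3 + 5 * e51 * x^1 + 8 * e42 * x^2 * k^1 + 9 * e33 * x^3 * k^2 + 8 * e24 * x^4 * k^3 + 5 * e15 * x^5 * k^4 + r * x^1) (by fun_prop) 3 (fun p => 2 * p.1)
    (by intro x k r; ring)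
  replace tB1 : Tendsto B1 l (𝓝 (4 * c41)) := by
    convert tB1 using 2
    norm_num
    try ring
  obtain ⟨C1, eC1, tC1⟩ := lim_jet le hn 2 hy2 k0 hc (fun x k r => 12 * c41 * k^1 + 6 * d31 * x^1 * k^2 + 2 * d22 * x^2 * k^3 + 30 * c60 + 20 * e51 * x^1 * k^1 + 12 * e42 * x^2 * k^2 + 6 * e33 * x^3 * k^3 + 2 * e24 * x^4 * k^4 + r) (by fun_prop) 4 (fun p => 2 * p.2 + 3 * p.1 ^ 2)
    (by intro x k r; ring)
  replace tC1 : Tendsto C1 l (𝓝 (-6 * c41 + 30 * c60)) := by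
    convert tC1 using 2
    norm_num
    try ring
  obtain ⟨A2, eA2, tA2⟩ := lim_jet le hn 2 hy2 k0 hax (fun x k r => 6 * d31 + 12 * d22 * x^1 * k^1 + 12 * d13 * x^2 * k^2 + 8 * e42 * x^1 + 18 * e33 * x^2 * k^1 + 24 * e24 * x^3 * k^2 + 20 * e15 * x^4 * k^3 + r * x^1) (by fun_prop) 2 (fun p => 0)
    (by intro x k r; ring)
  replace tA2 : Tendsto A2 l (𝓝 (6 * d31)) := by
    convert tA2 using 2
    norm_num
    try ring
  obtain ⟨A3, eA3, tA3⟩ := lim_jet le hn 2 hy2 k0 hay (fun x k r => 6 * d22 + 24 * d13 * x^1 * k^1 + 60 * d04 * x^2 * k^2 + 6 * e33 * x^1 + 24 * e24 * x^2 * k^1 + 60 * e15 * x^3 * k^2 + 120 * e06 * x^4 * k^3 + r * x^1) (by fun_prop) 2 (fun p => 0)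
    (by intro x k r; ring)
  replace tA3 : Tendsto A3 l (𝓝 (6 * d22)) := by
    convert tA3 using 2
    norm_num
    try ring
  obtain ⟨B2, eB2, tB2⟩ := lim_jet le hn 2 hy2 k0 hbx (fun x k r => 12 * c41 + 12 * d31 * x^1 * k^1 + 6 * d22 * x^2 * k^2 + 20 * e51 * x^1 + 24 * e42 * x^2 * k^1 + 18 * e33 * x^3 * k^2 + 8 * e24 * x^4 * k^3 + r * x^1) (by fun_prop) 2 (fun p => 2)
    (by intro x k r; ring)
  replace tB2 : Tendsto B2 l (𝓝 (12 * c41)) := by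
    convert tB2 using 2
    norm_num
    try ring
  obtain ⟨B3, eB3, tB3⟩ := lim_jet le hn 2 hy2 k0 hby (fun x k r => 6 * d31 + 12 * d22 * x^1 * k^1 + 12 * d13 * x^2 * k^2 + 8 * e42 * x^1 + 18 * e33 * x^2 * k^1 + 24 * e24 * x^3 * k^2 + 20 * e15 * x^4 * k^3 + r * x^1) (by fun_prop) 2 (fun p => 0)
    (by intro x k r; ring)
  replace tB3 : Tendsto B3 l (𝓝 (6 * d31)) := by
    convert tB3 using 2
    norm_num
    try ring
  obtain ⟨C2, eC2, tC2⟩ := lim_jet le hn 2 hy2 k0 hcx (fun x k r => 24 * c41 * k^1 + 6 * d31 * x^1 * k^2 + 120 * c60 + 60 * e51 * x^1 * k^1 + 24 * e42 * x^2 * k^2 + 6 * e33 * x^3 * k^3 + r) (by fun_prop) 3 (fun p => 6 * p.1)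
    (by intro x k r; ring)
  replace tC2 : Tendsto C2 l (𝓝 (-12 * c41 + 120 * c60)) := by
    convert tC2 using 2
    norm_num
    try ring
  obtain ⟨C3, eC3, tC3⟩ := lim_jet le hn 2 hy2 k0 hcy (fun x k r => 12 * c41 + 12 * d31 * x^1 * k^1 + 6 * d22 * x^2 * k^2 + 20 * e51 * x^1 + 24 * e42 * x^2 * k^1 + 18 * e33 * x^3 * k^2 + 8 * e24 * x^4 * k^3 + r * x^1) (by fun_prop) 2 (fun p => 2)
    (by intro x k r; ring)
  replace tC3 : Tendsto C3 l (𝓝 (12 * c41)) := by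
    convert tC3 using 2
    norm_num
    try ring
  set k : ℝ × ℝ → ℝ := fun p => p.2 / p.1 ^ 2 with hk
  have tc : Tendsto (fun p => 2 * k p + 3 + p.1 ^ 2 * C1 p) l (𝓝 (2 * (-1/2) + 3 + 0 ^ 2 * (-6 * c41 + 30 * c60))) :=
    ((k0.const_mul 2).add_const 3).add ((tx.pow 2).mul tC1)
  set cc : ℝ × ℝ → ℝ := fun p => 2 * k p + 3 + p.1 ^ 2 * C1 p with hcc
  have tU : Tendsto (fun p => 4 * B2 p + 4 * B1 p + 2 * p.1 ^ 2 * (B1 p * B2 p) - p.1 * (A2 p * cc p) - 2 * C2 p - p.1 * (A1 p * (6 + p.1 ^ 2 * C2 p))) l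
      (𝓝 (4 * (12 * c41) + 4 * (4 * c41) + 2 * 0 ^ 2 * ((4 * c41) * (12 * c41)) - 0 * ((6 * d31) * (2 * (-1/2) + 3 + 0 ^ 2 * (-6 * c41 + 30 * c60)))
        - 2 * (-12 * c41 + 120 * c60) - 0 * ((2 * d31) * (6 + 0 ^ 2 * (-12 * c41 + 120 * c60))))) :=
    (((((tB2.const_mul 4).add (tB1.const_mul 4)).add (((tx.pow 2).const_mul 2).mul (tB1.mul tB2))).sub (tx.mul (tA2.mul tc))).sub (tC2.const_mul 2)).sub
      (tx.mul (tA1.mul (((tx.pow 2).mul tC2).const_add 6)))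
  set U : ℝ × ℝ → ℝ := fun p => 4 * B2 p + 4 * B1 p + 2 * p.1 ^ 2 * (B1 p * B2 p) - p.1 * (A2 p * cc p) - 2 * C2 p - p.1 * (A1 p * (6 + p.1 ^ 2 * C2 p)) with hU
  have tV : Tendsto (fun p => 2 * p.1 * ((2 + p.1 ^ 2 * B1 p) * B3 p) - p.1 ^ 2 * (A3 p * cc p) - 2 * C3 p - p.1 * (A1 p * (2 + p.1 ^ 2 * C3 p))) l
      (𝓝 (2 * 0 * ((2 + 0 ^ 2 * (4 * c41)) * (6 * d31)) - 0 ^ 2 * ((6 * d22) * (2 * (-1/2) + 3 + 0 ^ 2 * (-6 * c41 + 30 * c60))) - 2 * (12 * c41)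
        - 0 * ((2 * d31) * (2 + 0 ^ 2 * (12 * c41))))) :=
    ((((tx.const_mul 2).mul ((((tx.pow 2).mul tB1).const_add 2).mul tB3)).sub ((tx.pow 2).mul (tA3.mul tc))).sub (tC3.const_mul 2)).sub
      (tx.mul (tA1.mul (((tx.pow 2).mul tC3).const_add 2)))
  set V : ℝ × ℝ → ℝ := fun p => 2 * p.1 * ((2 + p.1 ^ 2 * B1 p) * B3 p) - p.1 ^ 2 * (A3 p * cc p) - 2 * C3 p - p.1 * (A1 p * (2 + p.1 ^ 2 * C3 p)) with hV
  have tM := (((((tU.const_mul 2).sub ((tx.const_mul 4).mul tA1)).add ((tx.pow 3).mul (tA1.mul tU))).add (tB1.const_mul 4)).sub (tV.const_mul 2)).sub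
    ((tx.pow 2).mul (tB1.mul tV))
  have tM' : Tendsto (fun p => 2 * U p - 4 * p.1 * A1 p + p.1 ^ 3 * (A1 p * U p) + 4 * B1 p - 2 * V p - p.1 ^ 2 * (B1 p * V p)) l (𝓝 (-480 * (c60 - 1/2 * c41))) := by
    convert tM using 2
    ring
  refine tM'.congr' ?_
  filter_upwards [hn, hy2, eA1, eB1, eC1, eA2, eA3, eB2, eB3, eC2, eC3] with p h hy h1 h2 h3 h4 h5 h6 h7 h8 h9
  have x0 := h.1
  rw [eq_div_iff (pow_ne_zero 3 x0)]
  have hkp : p.2 / p.1 ^ 2 = k p := rfl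
  rw [hkp] at hy
  rw [h1, h2, h3, h4, h5, h6, h7, h8, h9, hU, hV, hcc]
  simp only []
  generalize k p = κ at *
  rw [hy]
  ring

end PartFourteen

section PartFifteen
open Topology

lemma jet_val {g P : ℝ × ℝ → ℝ} {n : ℕ} (hn : n ≠ 0) (h : HasJetAt0 g P n) : g 0 = P 0 := by
  have := (isLittleO_iff.1 h (show (0:ℝ) < 1 by norm_num)).self_of_nhds
  simp [hn] at this
  linarith

lemma near0 (ε : ℝ) (hε : 0 < ε) : ∀ᶠ p in 𝓝 (0 : ℝ × ℝ), |p.1| < ε := by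
  have : Continuous fun p : ℝ × ℝ => |p.1| := continuous_fst.abs
  refine this.continuousAt.eventually_lt_const ?_
  simpa using hε

lemma model_nf {η : ℝ} (hη : η = 1 ∨ η = -1) : ∃ A K L N W D Y B Dx Dy, Sys A K L (-η) ∧
    NF (BDE (fun _ => 1) (fun _ => 0) (fun p => -p.2 + η * p.1 ^ 4)) A K N W D Y B Dx Dy 1 := by
  have e2 : η * η = 1 := by rcases hη with h | h <;> rw [h] <;> norm_num
  obtain ⟨A, K, L, N, W, Y, S, F, -⟩ := good_nf (ω := BDE (fun _ => 1) (fun _ => 0) (fun p => -p.2 + η * p.1 ^ 4))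
    (N0 := univ) (e := 1) (s := -η) (D := fun p => p.2 - η * p.1 ^ 4) (B := fun _ => 0)
    (Dx := fun p => -4 * η * p.1 ^ 3) (Dy := fun _ => 1) univ_mem (Or.inl rfl)
    (by rcases hη with h | h <;> rw [h] <;> norm_num)
    (fun p _ => by fun_prop)
    (fun p _ => by
      have h1 : HasFDerivAt (fun p : ℝ × ℝ => p.1) (ContinuousLinearMap.fst ℝ ℝ ℝ) p := hasFDerivAt_fst
      have h2 : HasFDerivAt (fun p : ℝ × ℝ => p.2) (ContinuousLinearMap.snd ℝ ℝ ℝ) p := hasFDerivAt_snd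
      refine (h2.sub ((h1.pow 4).const_mul η)).congr_fderiv ?_
      ext <;> simp
      ring)
    (by fun_prop) (by fun_prop) (fun p _ => by fun_prop) (by simp) rfl
    (fun p _ v => by
      unfold BDE
      constructor <;> intro h <;> linear_combination h)
    (Eventually.of_forall fun p _ hx => by
      have : -η * p.1 * (-4 * η * p.1 ^ 3 - 1 * 0) = 4 * (η * η) * p.1 ^ 4 := by ring
      rw [this, e2]; positivity)
    (by
      filter_upwards [near0 (1/16) (by norm_num)] with p hp _
      have : |-4 * η * p.1 ^ 3 - 1 * 0| = 4 * |p.1| ^ 3 := by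
        have h1 : |η| = 1 := by rcases hη with h | h <;> rw [h] <;> norm_num
        rw [mul_zero, sub_zero, abs_mul, abs_mul, abs_pow, h1]; norm_num
      rw [this]
      have h0 := abs_nonneg p.1
      have : |p.1| ^ 2 ≤ (1/16) ^ 2 := by gcongr
      nlinarith)
  exact ⟨A, K, L, N, W, _, Y, _, _, _, S, F⟩

end PartFifteen

section PartSixteen
open Topology

lemma bde_nf {a b c : ℝ × ℝ → ℝ} (sa : ContDiff ℝ (⊤ : ℕ∞) a) (sb : ContDiff ℝ (⊤ : ℕ∞) b) (sc : ContDiff ℝ (⊤ : ℕ∞) c)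
    (a0 : a 0 = 2) (b0 : b 0 = 0) (c0 : c 0 = 0) (cx0 : pdx c 0 = 0) (cy0 : pdy c 0 = 2) {C η : ℝ} (hη : η = 1 ∨ η = -1) (hC : 0 < η * C)
    (hz : ∀ᶠ p in 𝓝 (0 : ℝ × ℝ), b p ^ 2 - c p * a p = 0 → p.1 = 0 → p = 0)
    (hT : Tendsto (fun p : ℝ × ℝ => (a p * (2 * b p * pdx b p - pdx a p * c p - a p * pdx c p) - b p * (2 * b p * pdy b p - pdy a p * c p - a p * pdy c p)) / p.1 ^ 3)
      (𝓝[{p | b p ^ 2 - c p * a p = 0 ∧ p.1 ≠ 0}] 0) (𝓝 (-480 * C))) :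
    ∃ A K L N W D Y B Dx Dy, Sys A K L (-η) ∧ NF (BDE a b c) A K N W D Y B Dx Dy (-1) ∧
      (∀ q ∈ W, ContDiffAt ℝ (⊤ : ℕ∞) Y q) ∧ (∃ r > 0, W = Ioo (-r) r ×ˢ Ioo (-r) r) ∧
      ∀ᶠ p in 𝓝 (0 : ℝ × ℝ), (b p ^ 2 - c p * a p = 0 ↔ D p = 0) := by
  have ev : ∀ᶠ p in 𝓝 (0 : ℝ × ℝ), a p ≠ 0 := sa.continuous.continuousAt.eventually_ne (by rw [a0]; norm_num)
  set D : ℝ × ℝ → ℝ := fun p => (b p * (a p)⁻¹) ^ 2 - c p * (a p)⁻¹ with hD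
  set Dx : ℝ × ℝ → ℝ := fun p => 2 * (b p * (a p)⁻¹) * (pdx b p * (a p)⁻¹ - b p * pdx a p * ((a p)⁻¹) ^ 2) - (pdx c p * (a p)⁻¹ - c p * pdx a p * ((a p)⁻¹) ^ 2) with hDx
  set Dy : ℝ × ℝ → ℝ := fun p => 2 * (b p * (a p)⁻¹) * (pdy b p * (a p)⁻¹ - b p * pdy a p * ((a p)⁻¹) ^ 2) - (pdy c p * (a p)⁻¹ - c p * pdy a p * ((a p)⁻¹) ^ 2) with hDy
  set B : ℝ × ℝ → ℝ := fun p => b p * (a p)⁻¹ with hB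
  have si : ∀ p, a p ≠ 0 → ContDiffAt ℝ (⊤ : ℕ∞) (fun p => (a p)⁻¹) p := fun p hp => sa.contDiffAt.inv hp
  have a0' : a 0 ≠ 0 := by rw [a0]; norm_num
  have eqv : ∀ p, a p ≠ 0 → D p = (b p ^ 2 - c p * a p) * ((a p)⁻¹) ^ 2 := by
    intro p hp; simp only [hD]; field_simp
  have eqv' : ∀ p, a p ≠ 0 → (b p ^ 2 - c p * a p = 0 ↔ D p = 0) := by
    intro p hp; rw [eqv p hp]; simp [hp]
  have sax := pdx_smooth sa
  have say := pdy_smooth sa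
  have sbx := pdx_smooth sb
  have sby := pdy_smooth sb
  have scx := pdx_smooth sc
  have scy := pdy_smooth sc
  have i0 := si 0 a0'
  have key : ∀ p, a p ≠ 0 → D p = 0 → Dx p - Dy p * B p =
      (a p * (2 * b p * pdx b p - pdx a p * c p - a p * pdx c p) - b p * (2 * b p * pdy b p - pdy a p * c p - a p * pdy c p)) * ((a p)⁻¹) ^ 3 := by
    intro p hp h
    have hδ := (eqv' p hp).2 h
    have e : Dx p - Dy p * B p = (a p * (2 * b p * pdx b p - pdx a p * c p - a p * pdx c p) - b p * (2 * b p * pdy b p - pdy a p * c p - a p * pdy c p)) * ((a p)⁻¹) ^ 3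
        + (-2 * pdx a p * ((a p)⁻¹) ^ 3 + 2 * pdy a p * b p * ((a p)⁻¹) ^ 4) * (b p ^ 2 - c p * a p) := by
      simp only [hDx, hDy, hB]
      field_simp
      ring
    rw [e, hδ]; ring
  have ti : Tendsto (fun p => ((a p)⁻¹) ^ 3) (𝓝[{p | b p ^ 2 - c p * a p = 0 ∧ p.1 ≠ 0}] 0) (𝓝 (1/8)) := by
    have h := (i0.continuousAt.tendsto.pow 3).mono_left (nhdsWithin_le_nhds (s := {p | b p ^ 2 - c p * a p = 0 ∧ p.1 ≠ 0}))
    rw [a0] at h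
    convert h using 2
    norm_num
  have tA : Tendsto (fun p => (Dx p - Dy p * B p) / p.1 ^ 3) (𝓝[{p | b p ^ 2 - c p * a p = 0 ∧ p.1 ≠ 0}] 0) (𝓝 (-60 * C)) := by
    have h := hT.mul ti
    have e : -480 * C * (1/8) = -60 * C := by ring
    rw [e] at h
    refine h.congr' ?_
    filter_upwards [eventually_mem_nhdsWithin, ev.filter_mono nhdsWithin_le_nhds] with p h1 h2
    rw [key p h2 ((eqv' p h2).1 h1.1)]
    ring
  have e1 : ∀ᶠ p in 𝓝 (0 : ℝ × ℝ), D p = 0 → p.1 ≠ 0 → 0 < -η * ((Dx p - Dy p * B p) / p.1 ^ 3) := by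
    have := (tA.const_mul (-η)).eventually_const_lt (u := 0) (by nlinarith)
    rw [eventually_nhdsWithin_iff] at this
    filter_upwards [this, ev] with p h1 h2 h3 h4
    exact h1 ⟨(eqv' p h2).2 h3, h4⟩
  have e3 : ∀ᶠ p in 𝓝 (0 : ℝ × ℝ), D p = 0 → p.1 ≠ 0 → |(Dx p - Dy p * B p) / p.1 ^ 3| < |-60 * C| + 1 := by
    have := tA.abs.eventually_lt_const (u := |-60 * C| + 1) (by linarith)
    rw [eventually_nhdsWithin_iff] at this
    filter_upwards [this, ev] with p h1 h2 h3 h4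
    exact h1 ⟨(eqv' p h2).2 h3, h4⟩
  obtain ⟨A, K, L, N, W, Y, S, F, hY, hr⟩ := good_nf (ω := BDE a b c)
    (N0 := {p | a p ≠ 0}) (e := -1) (s := -η) (D := D) (B := B) (Dx := Dx) (Dy := Dy) ev (Or.inr rfl)
    (by rcases hη with h | h <;> rw [h] <;> norm_num)
    (fun p hp => ((sb.contDiffAt.mul (si p hp)).pow 2).sub (sc.contDiffAt.mul (si p hp)))
    (fun p hp => by
      have ha := pd_hasFDerivAt sa p
      have hb := pd_hasFDerivAt sb p
      have hc := pd_hasFDerivAt sc p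
      have hi := (hasDerivAt_inv (show a p ≠ 0 from hp)).comp_hasFDerivAt p ha
      refine (((hb.mul hi).pow 2).sub (hc.mul hi)).congr_fderiv ?_
      ext <;> simp [hDx, hDy] <;> ring)
    (by
      have i1 := i0.of_le (m := 1) (by simp)
      have h1 := sa.contDiffAt (x := 0) |>.of_le (m := 1) (by simp)
      have h2 := sb.contDiffAt (x := 0) |>.of_le (m := 1) (by simp)
      have h3 := sc.contDiffAt (x := 0) |>.of_le (m := 1) (by simp)
      have h4 := sax.contDiffAt (x := 0) |>.of_le (m := 1) (by simp)
      have h5 := sbx.contDiffAt (x := 0) |>.of_le (m := 1) (by simp)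
      have h6 := scx.contDiffAt (x := 0) |>.of_le (m := 1) (by simp)
      exact ((contDiffAt_const.mul (h2.mul i1)).mul ((h5.mul i1).sub ((h2.mul h4).mul (i1.pow 2)))).sub ((h6.mul i1).sub ((h3.mul h4).mul (i1.pow 2))))
    (by
      have i1 := i0.of_le (m := 1) (by simp)
      have h1 := sa.contDiffAt (x := 0) |>.of_le (m := 1) (by simp)
      have h2 := sb.contDiffAt (x := 0) |>.of_le (m := 1) (by simp)
      have h3 := sc.contDiffAt (x := 0) |>.of_le (m := 1) (by simp)
      have h4 := say.contDiffAt (x := 0) |>.of_le (m := 1) (by simp)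
      have h5 := sby.contDiffAt (x := 0) |>.of_le (m := 1) (by simp)
      have h6 := scy.contDiffAt (x := 0) |>.of_le (m := 1) (by simp)
      exact ((contDiffAt_const.mul (h2.mul i1)).mul ((h5.mul i1).sub ((h2.mul h4).mul (i1.pow 2)))).sub ((h6.mul i1).sub ((h3.mul h4).mul (i1.pow 2))))
    (fun p hp => (sb.contDiffAt.mul (si p hp)).of_le (by simp))
    (by simp only [hD]; rw [b0, c0]; ring)
    (by simp only [hDy]; rw [b0, c0, cy0, a0]; norm_num)
    (fun p hp v => by
      have hp' : a p ≠ 0 := hp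
      have e : BDE a b c p v = a p * ((v.2 + B p * v.1) ^ 2 - D p * v.1 ^ 2) := by
        simp only [BDE, hD, hB]; field_simp; ring
      rw [e, mul_eq_zero, sub_eq_zero]
      simp [hp'])
    (by
      filter_upwards [e1] with p h1 h2 h3
      have h4 := h1 h2 h3
      have : -η * p.1 * (Dx p - Dy p * B p) = -η * ((Dx p - Dy p * B p) / p.1 ^ 3) * p.1 ^ 4 := by field_simp
      rw [this]
      have : 0 < p.1 ^ 4 := by positivity
      positivity)
    (by
      set k := |-60 * C| + 1 with hk
      have k1 : 1 ≤ k := by have := abs_nonneg (-60 * C); linarith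
      filter_upwards [e3, hz, ev, near0 (1 / (64 * k)) (by positivity)] with p h1 h2 h3 h4 h5
      by_cases hx : p.1 = 0
      · have p0 := h2 ((eqv' p h3).2 h5) hx
        have : Dx p - Dy p * B p = 0 := by
          rw [p0]; simp only [hDx, hB]; rw [b0, c0, cx0]; ring
        rw [this]; simp; positivity
      · have h6 := h1 h5 hx
        rw [abs_div, abs_pow, div_lt_iff₀ (by positivity)] at h6
        refine h6.le.trans ?_
        have q0 : 0 < |p.1| := abs_pos.2 hx
        have q1 : k * |p.1| ≤ 1/64 := by
          rw [lt_div_iff₀ (by positivity)] at h4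
          linarith
        have q2 : |p.1| ≤ 1 := by nlinarith
        have q3 : k * |p.1| ^ 3 = (k * |p.1|) * |p.1| * |p.1| := by ring
        rw [q3]
        have : (k * |p.1|) * |p.1| * |p.1| ≤ 1/64 * 1 * |p.1| := by gcongr
        linarith)
  refine ⟨A, K, L, N, W, D, Y, B, Dx, Dy, S, F, hY, hr, ?_⟩
  filter_upwards [ev] with p hp
  exact eqv' p hp

lemma parab {ω : (ℝ × ℝ) → (ℝ × ℝ) → ℝ} {A K : ℝ → ℝ → ℝ} {N W : Set (ℝ × ℝ)} {D Y B Dx Dy δ : ℝ × ℝ → ℝ} {e r : ℝ}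
    (F : NF ω A K N W D Y B Dx Dy e) (hY : ∀ q ∈ W, ContDiffAt ℝ (⊤ : ℕ∞) Y q) (r0 : 0 < r) (hW : W = Ioo (-r) r ×ˢ Ioo (-r) r)
    (h : ∀ᶠ p in 𝓝 (0 : ℝ × ℝ), (δ p = 0 ↔ D p = 0)) :
    ∃ U ∈ nhds (0 : ℝ × ℝ), ∃ g : ℝ → ℝ, ContDiff ℝ (⊤ : ℕ∞) g ∧ g 0 = 0 ∧ ∀ p ∈ U, (δ p = 0 ↔ p.2 = g p.1) := by
  let φ : ContDiffBump (0:ℝ) := ⟨r/4, r/2, by positivity, by linarith⟩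
  have inW : ∀ x, |x| < r → (x, (0:ℝ)) ∈ W := by
    intro x hx
    rw [hW]
    exact ⟨abs_lt.1 hx, by simpa using r0⟩
  refine ⟨{p | p ∈ N ∧ (δ p = 0 ↔ D p = 0) ∧ |p.1| < r/4}, ?_, fun x => φ x * Y (x, 0), ?_, ?_, ?_⟩
  · filter_upwards [F.oN.mem_nhds F.zN, h, near0 (r/4) (by positivity)] with p h1 h2 h3
    exact ⟨h1, h2, h3⟩
  · rw [contDiff_iff_contDiffAt]
    intro x
    by_cases hx : |x| < r
    · have h1 : ContDiffAt ℝ (⊤ : ℕ∞) (fun x : ℝ => Y (x, 0)) x :=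
        ContDiffAt.comp (g := Y) (f := fun x : ℝ => (x, (0:ℝ))) x (hY _ (inW x hx)) (by fun_prop)
      exact φ.contDiff.contDiffAt.mul h1
    · have : (fun x => φ x * Y (x, 0)) =ᶠ[𝓝 x] fun _ => 0 := by
        have o : IsOpen {x : ℝ | r/2 < |x|} := isOpen_lt continuous_const continuous_abs
        filter_upwards [o.mem_nhds (show r/2 < |x| by push Not at hx; linarith)] with y hy
        have : φ y = 0 := φ.zero_of_le_dist (by rw [dist_zero_right]; exact le_of_lt hy)
        rw [this, zero_mul]
      exact contDiffAt_const.congr_of_eventuallyEq this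
  · have := F.li 0 F.zN
    rw [F.D0] at this
    show φ 0 * Y (0, 0) = 0
    have h2 : Y (0, 0) = 0 := this
    rw [h2, mul_zero]
  · rintro p ⟨h1, h2, h3⟩
    have h4 : φ p.1 = 1 := φ.one_of_mem_closedBall (by rw [mem_closedBall_zero_iff]; exact h3.le)
    have h5 := inW p.1 (by linarith)
    rw [h2]
    show _ ↔ p.2 = φ p.1 * Y (p.1, 0)
    rw [h4, one_mul]
    constructor
    · intro hD
      have := F.li p h1
      rw [hD] at this; exact this.symm
    · intro hy
      have := F.ri _ h5
      simp only [← hy] at this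
      exact this

end PartSixteen

/-- class `Π^p_{c,3}`: for smooth `f` with
`j⁵f(0) = y² + x²y + (1/4)x⁴ + yφ₄(x,y)` (`φ₄` homogeneous of degree 4 with
`x⁴`-coefficient `c₄₁`), whose degree-6 Taylor polynomial has `x⁶`-coefficient
`c₆₀`, and `C₃ = c₆₀ − (1/2)c₄₁ ≠ 0`, the parabolic set of `f` is a smooth
curve near the origin and the asymptotic BDE of `f` is topologically
equivalent at `0` to `dy² + (−y + ηx⁴)dx² = 0` for some `η ∈ {1,−1}`. -/
theorem stmt11 (c41 d31 d22 d13 d04 c60 e51 e42 e33 e24 e15 e06 : ℝ)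
    (f : ℝ × ℝ → ℝ) (hf : ContDiff ℝ (⊤ : ℕ∞) f)
    (hjet6 : HasJetAt0 f
      (fun p => p.2 ^ 2 + p.1 ^ 2 * p.2 + (1 / 4) * p.1 ^ 4 +
        p.2 * (c41 * p.1 ^ 4 + d31 * p.1 ^ 3 * p.2 + d22 * p.1 ^ 2 * p.2 ^ 2 +
          d13 * p.1 * p.2 ^ 3 + d04 * p.2 ^ 4) +
        c60 * p.1 ^ 6 + e51 * p.1 ^ 5 * p.2 + e42 * p.1 ^ 4 * p.2 ^ 2 +
        e33 * p.1 ^ 3 * p.2 ^ 3 + e24 * p.1 ^ 2 * p.2 ^ 4 +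
        e15 * p.1 * p.2 ^ 5 + e06 * p.2 ^ 6) 6)
    (hC : c60 - (1 / 2) * c41 ≠ 0) :
    (∃ U ∈ nhds (0 : ℝ × ℝ), ∃ g : ℝ → ℝ, ContDiff ℝ (⊤ : ℕ∞) g ∧ g 0 = 0 ∧
      ∀ p ∈ U, (bdeDiscr f p = 0 ↔ p.2 = g p.1)) ∧
    ∃ η : ℝ, (η = 1 ∨ η = -1) ∧
      TopEquivAt0 (asymBDE f)
        (BDE (fun _ => 1) (fun _ => 0) (fun p => -p.2 + η * p.1 ^ 4)) := by
  obtain ⟨jc, jb, ja, jcx, jcy, jbx, jby, jax, jay⟩ := jets c41 d31 d22 d13 d04 c60 e51 e42 e33 e24 e15 e06 hf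
    (IsLittleO.congr_left hjet6 fun p => by ring)
  obtain ⟨hz, hT⟩ := asym_lim c41 d31 d22 d13 d04 c60 e51 e42 e33 e24 e15 e06 hf (IsLittleO.congr_left hjet6 fun p => by ring)
  obtain ⟨η, hη, hηC⟩ : ∃ η : ℝ, (η = 1 ∨ η = -1) ∧ 0 < η * (c60 - (1 / 2) * c41) := by
    rcases lt_or_gt_of_ne hC with h | h
    · exact ⟨-1, Or.inr rfl, by linarith⟩
    · exact ⟨1, Or.inl rfl, by linarith⟩
  obtain ⟨A, K, L, N, W, D, Y, B, Dx, Dy, S, F, hY, ⟨r, r0, hW⟩, hδ⟩ := bde_nf (a := fyy f) (b := fxy f) (c := fxx f)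
    (pdy_smooth (pdy_smooth hf)) (pdy_smooth (pdx_smooth hf)) (pdx_smooth (pdx_smooth hf))
    (by rw [jet_val (by norm_num) ja]; simp) (by rw [jet_val (by norm_num) jb]; simp) (by rw [jet_val (by norm_num) jc]; simp)
    (by rw [jet_val (by norm_num) jcx]; simp) (by rw [jet_val (by norm_num) jcy]; simp) hη hηC hz hT
  obtain ⟨A', K', L', N', W', D', Y', B', Dx', Dy', S', F'⟩ := model_nf hη
  exact ⟨parab F hY r0 hW hδ, η, hη, nf_equiv S F S' F'⟩
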